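/- Under hypotheses (H1)–(H3), the nonlinear Fokker–Planck equation generates a continuous contraction semigroup on L¹(ℝ^d): there exists a family of maps S_t : L¹(ℝ^d) → L¹(ℝ^d), t ≥ 0, such that S_0 is the identity, S_{t+s} = S_t ∘ S_s for all t, s ≥ 0, ‖S_t v − S_t w‖_{L¹} ≤ ‖v − w‖_{L¹} for all v, w ∈ L¹(ℝ^d) and t ≥ 0, for each u₀ ∈ L¹(ℝ^d) the map t ↦ S_t u₀ is continuous from [0,∞) to L¹(ℝ^d), and u(t,x) := (S_t u₀)(x) is a distributional solution of ∂_t u = Σ_{i,j=1}^d ∂_i∂_j(a_ij(x,u)u) − div(b(x,u)u), i.e., for every φ ∈ C_c^∞((0,∞) × ℝ^d): ∫₀^∞ ∫_{ℝ^d} ( u(t,x) ∂_tφ(t,x) + Σ_{i,j=1}^d a_ij(x,u(t,x)) u(t,x) ∂_{x_i}∂_{x_j}φ(t,x) + u(t,x) b(x,u(t,x))·∇_xφ(t,x) ) dx dt = 0. -/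

import Mathlib

open MeasureTheory Filter

/-- The `i`-th partial derivative of `φ : ℝ^d → ℝ`. -/
noncomputable def pd {d : ℕ} (i : Fin d) (φ : (Fin d → ℝ) → ℝ) (x : Fin d → ℝ) : ℝ :=
  fderiv ℝ φ x (Pi.single i 1)

/-- The second partial derivative `∂_i ∂_j φ`. -/
noncomputable def pd2 {d : ℕ} (i j : Fin d) (φ : (Fin d → ℝ) → ℝ) (x : Fin d → ℝ) : ℝ :=
  pd i (pd j φ) x

/-- Time derivative `∂_t φ` for `φ : ℝ × ℝ^d → ℝ`. -/
noncomputable def pdt {d : ℕ} (φ : ℝ × (Fin d → ℝ) → ℝ) (p : ℝ × (Fin d → ℝ)) : ℝ :=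
  fderiv ℝ φ p ((1 : ℝ), (0 : Fin d → ℝ))

/-- Spatial partial derivative `∂_{x_i} φ` for `φ : ℝ × ℝ^d → ℝ`. -/
noncomputable def pdx {d : ℕ} (i : Fin d) (φ : ℝ × (Fin d → ℝ) → ℝ) (p : ℝ × (Fin d → ℝ)) : ℝ :=
  fderiv ℝ φ p ((0 : ℝ), (Pi.single i 1 : Fin d → ℝ))

/-- Second spatial partial derivative `∂_{x_i}∂_{x_j} φ`. -/
noncomputable def pdxx {d : ℕ} (i j : Fin d) (φ : ℝ × (Fin d → ℝ) → ℝ)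
    (p : ℝ × (Fin d → ℝ)) : ℝ :=
  pdx i (pdx j φ) p

/-- Distributional solution of the nonlinear Fokker–Planck equation
`∂_t u = Σ_{i,j} ∂_i∂_j(a_ij(x,u)u) - div(b(x,u)u)` on `(0,∞) × ℝ^d`. -/
def IsFPESol {d : ℕ} (a : Fin d → Fin d → (Fin d → ℝ) → ℝ → ℝ)
    (b : Fin d → (Fin d → ℝ) → ℝ → ℝ) (u : ℝ → (Fin d → ℝ) → ℝ) : Prop :=
  ∀ φ : ℝ × (Fin d → ℝ) → ℝ, ContDiff ℝ (⊤ : ℕ∞) φ → HasCompactSupport φ →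
    tsupport φ ⊆ {p : ℝ × (Fin d → ℝ) | 0 < p.1} →
    (∫ t in Set.Ioi (0 : ℝ), ∫ x, (u t x * pdt φ (t, x)
      + ∑ i, ∑ j, a i j x (u t x) * u t x * pdxx i j φ (t, x)
      + u t x * ∑ i, b i x (u t x) * pdx i φ (t, x))) = 0

section CrandallLiggett
open Topology

variable {X : Type*} [NormedAddCommGroup X] [NormedSpace ℝ X]

/-- A family of nonlinear resolvents. -/
structure ResFam (J : ℝ → X → X) (l0 : ℝ) : Prop where
  pos : 0 < l0
  contr : ∀ l, 0 < l → l ≤ l0 → ∀ x y, ‖J l x - J l y‖ ≤ ‖x - y‖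
  resid : ∀ m l, 0 < m → m ≤ l → l ≤ l0 → ∀ x,
    J l x = J m ((m / l) • x + (1 - m / l) • J l x)
  tend : ∀ x, Tendsto (fun l => J l x) (𝓝[>] (0:ℝ)) (𝓝 x)

lemma iter_contr {F : X → X} (hF : ∀ x y, ‖F x - F y‖ ≤ ‖x - y‖) (n : ℕ) (x y : X) :
    ‖F^[n] x - F^[n] y‖ ≤ ‖x - y‖ := by
  induction n generalizing x y with
  | zero => simp
  | succ n ih =>
    simp only [Function.iterate_succ, Function.comp]
    exact (ih _ _).trans (hF _ _)

lemma iter_dist {F : X → X} (hF : ∀ x y, ‖F x - F y‖ ≤ ‖x - y‖) (n : ℕ) (x : X) :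
    ‖F^[n] x - x‖ ≤ n * ‖F x - x‖ := by
  induction n with
  | zero => simp
  | succ n ih =>
    have h1 : ‖F^[n+1] x - F^[n] x‖ ≤ ‖F x - x‖ := by
      rw [Function.iterate_succ]; exact iter_contr hF n _ _
    calc ‖F^[n+1] x - x‖ = ‖(F^[n+1] x - F^[n] x) + (F^[n] x - x)‖ := by congr 1; abel
      _ ≤ ‖F^[n+1] x - F^[n] x‖ + ‖F^[n] x - x‖ := norm_add_le _ _
      _ ≤ ‖F x - x‖ + n * ‖F x - x‖ := add_le_add h1 ih
      _ = _ := by push_cast; ring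

lemma CL_est {J : ℝ → X → X} {l0 : ℝ} (hJ : ResFam J l0) {m l K : ℝ} (hm : 0 < m) (hml : m ≤ l)
    (hl : l ≤ l0) (hK : 0 ≤ K) {x : X} (hxm : ‖J m x - x‖ ≤ m * K) (hxl : ‖J l x - x‖ ≤ l * K)
    (i n : ℕ) :
    ‖(J m)^[i] x - (J l)^[n] x‖ ≤ K * √((n * l - i * m)^2 + n * l^2 + i * m^2) := by
  have hl0 : 0 < l := hm.trans_le hml
  have cm := hJ.contr m hm (hml.trans hl)
  have cl := hJ.contr l hl0 hl
  induction i generalizing n with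
  | zero =>
    simp only [Function.iterate_zero, id, CharP.cast_eq_zero, zero_mul, sub_zero, add_zero]
    rw [norm_sub_rev]
    calc _ ≤ n * ‖J l x - x‖ := iter_dist cl n x
      _ ≤ n * (l * K) := by gcongr
      _ = K * √((n*l)^2) := by rw [Real.sqrt_sq (by positivity)]; ring
      _ ≤ _ := by
        gcongr
        have : 0 ≤ n * l^2 := by positivity
        linarith
  | succ i ih =>
    cases n with
    | zero =>
      simp only [Function.iterate_zero, id, CharP.cast_eq_zero, zero_mul, zero_sub, add_zero]
      calc _ ≤ ((i+1 : ℕ) : ℝ) * ‖J m x - x‖ := iter_dist cm (i+1) x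
        _ ≤ ((i+1 : ℕ) : ℝ) * (m * K) := by gcongr
        _ = K * √((((i+1 : ℕ):ℝ)*m)^2) := by rw [Real.sqrt_sq (by positivity)]; ring
        _ ≤ _ := by
          gcongr
          have : 0 ≤ ((i+1 : ℕ):ℝ) * m^2 := by positivity
          nlinarith
    | succ n =>
      set al := m / l with hal
      have hal0 : 0 ≤ al := by positivity
      have hal1 : al ≤ 1 := by rw [hal, div_le_one hl0]; exact hml
      have hmal : m = al * l := by rw [hal]; field_simp
      set p := (J m)^[i] x
      set q := (J l)^[n] x
      set q' := (J l)^[n+1] x with hq'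
      have e1 : (J m)^[i+1] x = J m p := by rw [Function.iterate_succ_apply']
      have e2 : q' = J l q := by rw [hq', Function.iterate_succ_apply']
      have e3 : q' = J m (al • q + (1 - al) • q') := by
        rw [e2]; exact hJ.resid m l hm hml hl q
      have h1 := ih n
      have h2 := ih (n+1)
      set s1 := √(((n:ℝ) * l - i * m)^2 + n * l^2 + i * m^2) with hs1
      set s2 := √((((n+1 : ℕ):ℝ) * l - i * m)^2 + ((n+1 : ℕ):ℝ) * l^2 + i * m^2) with hs2
      have key : al * s1 + (1 - al) * s2 ≤
          √((((n+1:ℕ):ℝ) * l - ((i+1:ℕ):ℝ) * m)^2 + ((n+1:ℕ):ℝ) * l^2 + ((i+1:ℕ):ℝ) * m^2) := by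
        apply Real.le_sqrt_of_sq_le
        have q1 : s1^2 = ((n:ℝ) * l - i * m)^2 + n * l^2 + i * m^2 := Real.sq_sqrt (by positivity)
        have q2 : s2^2 = (((n+1 : ℕ):ℝ) * l - i * m)^2 + ((n+1 : ℕ):ℝ) * l^2 + i * m^2 :=
          Real.sq_sqrt (by positivity)
        have q3 : (al * s1 + (1 - al) * s2)^2 ≤ al * s1^2 + (1 - al) * s2^2 := by
          nlinarith [mul_nonneg (mul_nonneg hal0 (sub_nonneg.2 hal1)) (sq_nonneg (s1 - s2))]
        refine q3.trans ?_
        rw [q1, q2]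
        push_cast
        rw [hmal]
        have : 0 ≤ (al * l)^2 := sq_nonneg _
        nlinarith
      calc ‖(J m)^[i+1] x - q'‖ = ‖J m p - J m (al • q + (1 - al) • q')‖ := by rw [e1, ← e3]
        _ ≤ ‖p - (al • q + (1 - al) • q')‖ := cm _ _
        _ = ‖al • (p - q) + (1 - al) • (p - q')‖ := by congr 1; module
        _ ≤ al * ‖p - q‖ + (1 - al) * ‖p - q'‖ := by
          refine (norm_add_le _ _).trans ?_
          rw [norm_smul, norm_smul, Real.norm_of_nonneg hal0,
            Real.norm_of_nonneg (sub_nonneg.2 hal1)]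
        _ ≤ al * (K * s1) + (1 - al) * (K * s2) := by
          have := sub_nonneg.2 hal1
          gcongr
        _ = K * (al * s1 + (1 - al) * s2) := by ring
        _ ≤ _ := by gcongr

/-- The exponential formula: approximants along any `n k * lam k → t`. -/
lemma CL_close {J : ℝ → X → X} {l0 : ℝ} (hJ : ResFam J l0) {ι : Type*} {F : Filter ι}
    {m l : ι → ℝ} {i n : ι → ℕ} (hm0 : ∀ᶠ k in F, 0 < m k) (hl0 : ∀ᶠ k in F, 0 < l k)
    (hm : Tendsto m F (𝓝 0)) (hl : Tendsto l F (𝓝 0)) {t : ℝ}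
    (him : Tendsto (fun k => i k * m k) F (𝓝 t)) (hnl : Tendsto (fun k => n k * l k) F (𝓝 t))
    (x : X) : Tendsto (fun k => ‖(J (m k))^[i k] x - (J (l k))^[n k] x‖) F (𝓝 0) := by
  rw [Metric.tendsto_nhds]
  intro e he
  -- approximate by the domain
  have h1 : ∀ᶠ v in 𝓝[>] (0:ℝ), ‖J v x - x‖ < e / 4 := by
    have := (Metric.tendsto_nhds.1 (hJ.tend x)) (e/4) (by positivity)
    filter_upwards [this] with v hv using by rwa [dist_eq_norm] at hv
  have h2 : ∀ᶠ v in 𝓝[>] (0:ℝ), v ∈ Set.Ioc 0 l0 := Ioc_mem_nhdsGT hJ.pos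
  obtain ⟨v, hv1, hv0, hvl⟩ := (h1.and h2).exists
  set y := J v x with hy
  set K := ‖x - y‖ / v with hKdef
  have hK : 0 ≤ K := by positivity
  have hD : ∀ s, 0 < s → s ≤ v → ‖J s y - y‖ ≤ s * K := by
    intro s hs hsv
    have e1 := hJ.resid s v hs hsv hvl x
    rw [← hy] at e1
    calc ‖J s y - y‖ = ‖J s y - J s ((s/v) • x + (1 - s/v) • y)‖ := by rw [← e1]
      _ ≤ ‖y - ((s/v) • x + (1 - s/v) • y)‖ := hJ.contr s hs (hsv.trans hvl) _ _
      _ = ‖(s/v) • (y - x)‖ := by congr 1; module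
      _ = s * K := by
        rw [norm_smul, Real.norm_of_nonneg (by positivity), norm_sub_rev, hKdef]; ring
  have lim : Tendsto (fun k => K * √((n k * l k - i k * m k)^2 + n k * l k * l k
      + i k * m k * m k)) F (𝓝 (K * √((t-t)^2 + t * 0 + t * 0))) := by
    refine Tendsto.const_mul _ (Tendsto.sqrt ?_)
    exact (((hnl.sub him).pow 2).add (hnl.mul hl)).add (him.mul hm)
  simp only [sub_self, mul_zero, add_zero, ne_eq, OfNat.ofNat_ne_zero, not_false_eq_true,
    zero_pow, Real.sqrt_zero] at lim
  have hlim := lim.eventually (gt_mem_nhds (show (0:ℝ) < e/4 by positivity))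
  have hmv := hm.eventually (gt_mem_nhds hv0)
  have hlv := hl.eventually (gt_mem_nhds hv0)
  filter_upwards [hlim, hmv, hlv, hm0, hl0] with k hk hkm hkl hkm0 hkl0
  rw [dist_zero_right, norm_norm]
  have cm := iter_contr (hJ.contr (m k) hkm0 (hkm.le.trans hvl)) (i k) x y
  have cl := iter_contr (hJ.contr (l k) hkl0 (hkl.le.trans hvl)) (n k) x y
  have hxy : ‖x - y‖ < e/4 := by rw [norm_sub_rev]; exact hv1
  have mid : ‖(J (m k))^[i k] y - (J (l k))^[n k] y‖ < e/4 := by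
    refine lt_of_le_of_lt ?_ hk
    rcases le_total (m k) (l k) with h | h
    · refine (CL_est hJ hkm0 h (hkl.le.trans hvl) hK (hD _ hkm0 hkm.le) (hD _ hkl0 hkl.le)
        (i k) (n k)).trans (le_of_eq ?_)
      congr 2; ring
    · rw [norm_sub_rev]
      refine (CL_est hJ hkl0 h (hkm.le.trans hvl) hK (hD _ hkl0 hkl.le) (hD _ hkm0 hkm.le)
        (n k) (i k)).trans (le_of_eq ?_)
      congr 2; ring
  calc ‖(J (m k))^[i k] x - (J (l k))^[n k] x‖
      = ‖((J (m k))^[i k] x - (J (m k))^[i k] y) + ((J (m k))^[i k] y - (J (l k))^[n k] y)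
        - ((J (l k))^[n k] x - (J (l k))^[n k] y)‖ := by congr 1; abel
    _ ≤ ‖(J (m k))^[i k] x - (J (m k))^[i k] y‖ + ‖(J (m k))^[i k] y - (J (l k))^[n k] y‖
        + ‖(J (l k))^[n k] x - (J (l k))^[n k] y‖ :=
        (norm_sub_le _ _).trans (add_le_add_left (norm_add_le _ _) _)
    _ < e := by linarith

lemma floor_tendsto {ι : Type*} {F : Filter ι} {l : ι → ℝ} (hl0 : ∀ k, 0 < l k)
    (hl : Tendsto l F (𝓝 0)) {t : ℝ} (ht : 0 ≤ t) :
    Tendsto (fun k => (⌊t / l k⌋₊ : ℝ) * l k) F (𝓝 t) := by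
  have h1 : Tendsto (fun k => t - l k) F (𝓝 t) := by simpa using tendsto_const_nhds.sub hl
  refine tendsto_of_tendsto_of_tendsto_of_le_of_le h1 tendsto_const_nhds ?_ ?_
  · intro k
    have := Nat.lt_floor_add_one (t / l k)
    rw [div_lt_iff₀ (hl0 k)] at this
    simp only; linarith
  · intro k
    have := Nat.floor_le (show 0 ≤ t / l k from div_nonneg ht (hl0 k).le)
    rwa [le_div_iff₀ (hl0 k)] at this

lemma CL_close2 {J : ℝ → X → X} {l0 : ℝ} (hJ : ResFam J l0) (x : X) (T e : ℝ) (he : 0 < e) :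
    ∃ y : X, ∃ K v : ℝ, 0 ≤ K ∧ 0 < v ∧ v ≤ l0 ∧ ‖x - y‖ < e ∧
      ∀ s, 0 < s → s ≤ v → ‖J s y - y‖ ≤ s * K := by
  have h1 : ∀ᶠ v in 𝓝[>] (0:ℝ), ‖J v x - x‖ < e := by
    have := (Metric.tendsto_nhds.1 (hJ.tend x)) e he
    filter_upwards [this] with v hv using by rwa [dist_eq_norm] at hv
  have h2 : ∀ᶠ v in 𝓝[>] (0:ℝ), v ∈ Set.Ioc 0 l0 := Ioc_mem_nhdsGT hJ.pos
  obtain ⟨v, hv1, hv0, hvl⟩ := (h1.and h2).exists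
  refine ⟨J v x, ‖x - J v x‖ / v, v, by positivity, hv0, hvl, by rwa [norm_sub_rev], ?_⟩
  intro s hs hsv
  have e1 := hJ.resid s v hs hsv hvl x
  calc ‖J s (J v x) - J v x‖ = ‖J s (J v x) - J s ((s/v) • x + (1 - s/v) • J v x)‖ := by rw [← e1]
    _ ≤ ‖J v x - ((s/v) • x + (1 - s/v) • J v x)‖ := hJ.contr s hs (hsv.trans hvl) _ _
    _ = ‖(s/v) • (J v x - x)‖ := by congr 1; module
    _ = _ := by
      rw [norm_smul, Real.norm_of_nonneg (by positivity), norm_sub_rev]; ring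

theorem crandall_liggett [CompleteSpace X] {J : ℝ → X → X} {l0 : ℝ} (hJ : ResFam J l0) :
    ∃ S : ℝ → X → X, (∀ v, S 0 v = v) ∧
      (∀ t s : ℝ, 0 ≤ t → 0 ≤ s → ∀ v, S (t + s) v = S t (S s v)) ∧
      (∀ t : ℝ, 0 ≤ t → ∀ v w, ‖S t v - S t w‖ ≤ ‖v - w‖) ∧
      (∀ u₀, ContinuousOn (fun t => S t u₀) (Set.Ici (0 : ℝ))) ∧
      (∀ t, 0 ≤ t → ∀ v, Tendsto (fun k : ℕ => (J (l0 / 2^k))^[⌊t / (l0 / 2^k)⌋₊] v) atTop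
        (𝓝 (S t v))) := by
  set l : ℕ → ℝ := fun k => l0 / 2^k with hldef
  have hp := hJ.pos
  have hl0 : ∀ k, 0 < l k := fun k => by simp only [hldef]; positivity
  have hll : ∀ k, l k ≤ l0 := fun k => by
    simp only [hldef]; exact div_le_self hp.le (one_le_pow₀ (by norm_num))
  have hl : Tendsto l atTop (𝓝 0) :=
    tendsto_const_nhds.div_atTop (tendsto_pow_atTop_atTop_of_one_lt (by norm_num))
  have hc : ∀ t, 0 ≤ t → ∀ v, ∃ w, Tendsto (fun k : ℕ => (J (l k))^[⌊t / (l k)⌋₊] v) atTop (𝓝 w) := by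
    intro t ht v
    apply cauchySeq_tendsto_of_complete
    rw [cauchySeq_iff_tendsto_dist_atTop_0]
    simp only [dist_eq_norm]
    have t1 : Tendsto (fun p : ℕ × ℕ => p.1) atTop atTop := by
      rw [← prod_atTop_atTop_eq]; exact tendsto_fst
    have t2 : Tendsto (fun p : ℕ × ℕ => p.2) atTop atTop := by
      rw [← prod_atTop_atTop_eq]; exact tendsto_snd
    exact CL_close hJ (F := atTop) (m := fun p : ℕ × ℕ => l p.1) (l := fun p => l p.2)
      (i := fun p => ⌊t / l p.1⌋₊) (n := fun p => ⌊t / l p.2⌋₊)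
      (Eventually.of_forall fun p => hl0 _) (Eventually.of_forall fun p => hl0 _)
      (hl.comp t1) (hl.comp t2) (t := t) ((floor_tendsto hl0 hl ht).comp t1)
      ((floor_tendsto hl0 hl ht).comp t2) v
  choose! S hS using hc
  refine ⟨S, ?_, ?_, ?_, ?_, hS⟩
  · intro v
    have h := hS 0 le_rfl v
    simp only [zero_div, Nat.floor_zero, Function.iterate_zero, id] at h
    exact tendsto_nhds_unique h tendsto_const_nhds
  · intro t s ht hs v
    have h1 := hS (t+s) (by positivity) v
    have h2 := hS t ht (S s v)
    have h3 := hS s hs v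
    have c1 := CL_close hJ (F := atTop) (m := l) (l := l)
      (i := fun k => ⌊(t+s) / l k⌋₊) (n := fun k => ⌊t / l k⌋₊ + ⌊s / l k⌋₊)
      (Eventually.of_forall hl0) (Eventually.of_forall hl0) hl hl (t := t + s)
      (floor_tendsto hl0 hl (by positivity)) (by
        have := (floor_tendsto hl0 hl ht).add (floor_tendsto hl0 hl hs)
        refine this.congr fun k => ?_
        push_cast; ring) v
    have c2 : Tendsto (fun k => ‖(J (l k))^[⌊t / l k⌋₊ + ⌊s / l k⌋₊] v -
        (J (l k))^[⌊t / l k⌋₊] (S s v)‖) atTop (𝓝 0) := by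
      have h3' : Tendsto (fun k => ‖(J (l k))^[⌊s / l k⌋₊] v - S s v‖) atTop (𝓝 0) :=
        tendsto_iff_norm_sub_tendsto_zero.1 h3
      refine squeeze_zero (fun k => norm_nonneg _) (fun k => ?_) h3'
      rw [Function.iterate_add_apply]
      exact iter_contr (hJ.contr _ (hl0 k) (hll k)) _ _ _
    have c3 : Tendsto (fun k => (J (l k))^[⌊(t+s) / l k⌋₊] v - (J (l k))^[⌊t / l k⌋₊] (S s v))
        atTop (𝓝 0) := by
      rw [tendsto_zero_iff_norm_tendsto_zero]
      refine squeeze_zero (fun k => norm_nonneg _) (fun k => ?_) (by simpa using c1.add c2)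
      exact norm_sub_le_norm_sub_add_norm_sub _ _ _
    have c4 := tendsto_nhds_unique c3 (h1.sub h2)
    exact (sub_eq_zero.1 c4.symm)
  · intro t ht v w
    refine le_of_tendsto ((hS t ht v).sub (hS t ht w)).norm (Eventually.of_forall fun k => ?_)
    exact iter_contr (hJ.contr _ (hl0 k) (hll k)) _ _ _
  · intro u t ht
    have ht0 : (0:ℝ) ≤ t := ht
    rw [ContinuousWithinAt, Metric.tendsto_nhds]
    intro e he
    obtain ⟨y, K, v, hK, hv0, hvl, hxy, hD⟩ := CL_close2 hJ u t (e/4) (by positivity)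
    have hSc : ∀ t, 0 ≤ t → ‖S t u - S t y‖ ≤ ‖u - y‖ := by
      intro t ht
      refine le_of_tendsto ((hS t ht u).sub (hS t ht y)).norm (Eventually.of_forall fun k => ?_)
      exact iter_contr (hJ.contr _ (hl0 k) (hll k)) _ _ _
    have hlip : ∀ s, 0 ≤ s → ‖S s y - S t y‖ ≤ K * |s - t| := by
      intro s hs
      have lim1 := ((hS s hs y).sub (hS t ht0 y)).norm
      have f1 := floor_tendsto hl0 hl hs
      have f2 := floor_tendsto hl0 hl ht0
      have lim2 : Tendsto (fun k => K * √((⌊t / l k⌋₊ * l k - ⌊s / l k⌋₊ * l k)^2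
          + ⌊t / l k⌋₊ * l k * l k + ⌊s / l k⌋₊ * l k * l k)) atTop
          (𝓝 (K * √((t-s)^2 + t * 0 + s * 0))) := by
        refine Tendsto.const_mul _ (Tendsto.sqrt ?_)
        exact (((f2.sub f1).pow 2).add (f2.mul hl)).add (f1.mul hl)
      have : K * √((t-s)^2 + t * 0 + s * 0) = K * |s - t| := by
        rw [mul_zero, mul_zero, add_zero, add_zero, Real.sqrt_sq_eq_abs, abs_sub_comm]
      rw [this] at lim2
      refine le_of_tendsto_of_tendsto lim1 lim2 ?_
      have hlv := hl.eventually (gt_mem_nhds hv0)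
      filter_upwards [hlv] with k hk
      refine (CL_est hJ (hl0 k) le_rfl (hll k) hK (hD _ (hl0 k) hk.le) (hD _ (hl0 k) hk.le)
        _ _).trans (le_of_eq ?_)
      congr 2; ring
    have hcont : Tendsto (fun s => K * |s - t|) (𝓝[Set.Ici 0] t) (𝓝 (K * |t - t|)) := by
      apply Tendsto.mono_left _ nhdsWithin_le_nhds
      exact (Continuous.tendsto (by fun_prop) t)
    simp only [sub_self, abs_zero, mul_zero] at hcont
    filter_upwards [hcont.eventually (gt_mem_nhds (show (0:ℝ) < e/4 by positivity)),
      self_mem_nhdsWithin] with s hs1 hs2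
    have hs0 : (0:ℝ) ≤ s := hs2
    rw [dist_eq_norm]
    have a1 := hSc s hs0
    have a2 := hSc t ht0
    have a3 := hlip s hs0
    calc ‖S s u - S t u‖ = ‖(S s u - S s y) + (S s y - S t y) - (S t u - S t y)‖ := by
          congr 1; abel
      _ ≤ ‖S s u - S s y‖ + ‖S s y - S t y‖ + ‖S t u - S t y‖ :=
        (norm_sub_le _ _).trans (add_le_add_left (norm_add_le _ _) _)
      _ < e := by linarith

end CrandallLiggett

section AbstractResolvent
open Topology

variable {X : Type*} [NormedAddCommGroup X] [NormedSpace ℝ X]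

lemma nonexp_res_contr {T : X → X} (hT : ∀ x y, ‖T x - T y‖ ≤ ‖x - y‖) {c : ℝ} (hc : 0 ≤ c)
    {u v f g : X} (hu : u = f + c • (T u - u)) (hv : v = g + c • (T v - v)) :
    ‖u - v‖ ≤ ‖f - g‖ := by
  have h1 : (1 + c) • (u - v) = (f - g) + c • (T u - T v) := by
    have hu' : (1 + c) • u = f + c • T u := by
      rw [add_smul, one_smul]; nth_rewrite 1 [hu]; module
    have hv' : (1 + c) • v = g + c • T v := by
      rw [add_smul, one_smul]; nth_rewrite 1 [hv]; module
    rw [smul_sub, hu', hv']; module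
  have h2 : (1 + c) * ‖u - v‖ ≤ ‖f - g‖ + c * ‖u - v‖ := by
    calc (1 + c) * ‖u - v‖ = ‖(1 + c) • (u - v)‖ := by
          rw [norm_smul, Real.norm_of_nonneg (by positivity)]
      _ ≤ ‖f - g‖ + ‖c • (T u - T v)‖ := by rw [h1]; exact norm_add_le _ _
      _ ≤ _ := by
        rw [norm_smul, Real.norm_of_nonneg hc]
        gcongr
        exact hT u v
  linarith

lemma nonexp_res_exists [CompleteSpace X] {T : X → X} (hT : ∀ x y, ‖T x - T y‖ ≤ ‖x - y‖)
    {c : ℝ} (hc : 0 ≤ c) (f : X) : ∃ u, u = f + c • (T u - u) := by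
  let F : X → X := fun u => (1 + c)⁻¹ • (f + c • T u)
  have hK : c / (1 + c) < 1 := by rw [div_lt_one (by positivity)]; linarith
  have hF : ContractingWith ⟨c / (1 + c), by positivity⟩ F := by
    refine ⟨hK, LipschitzWith.of_dist_le_mul fun x y => ?_⟩
    simp only [F, dist_eq_norm]
    calc _ = ‖((1 + c)⁻¹ * c) • (T x - T y)‖ := by congr 1; module
      _ = c / (1 + c) * ‖T x - T y‖ := by
        rw [norm_smul, Real.norm_of_nonneg (by positivity)]; ring
      _ ≤ c / (1 + c) * ‖x - y‖ := mul_le_mul_of_nonneg_left (hT x y) (by positivity)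
  have hfix : F hF.fixedPoint = hF.fixedPoint := hF.fixedPoint_isFixedPt
  refine ⟨hF.fixedPoint, ?_⟩
  set u := hF.fixedPoint
  have h1 : (1 + c) • u = f + c • T u := by
    nth_rewrite 1 [← hfix]
    simp only [F]
    rw [smul_smul, mul_inv_cancel₀ (by positivity), one_smul]
  have h2 : (1 + c) • u = u + c • u := by rw [add_smul, one_smul]
  rw [smul_sub, ← add_sub_assoc, ← h1, h2]; abel

theorem nonexp_resolvent [CompleteSpace X] {T : X → X} (hT : ∀ x y, ‖T x - T y‖ ≤ ‖x - y‖)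
    {τ : ℝ} (hτ : 0 < τ) : ∃ J : ℝ → X → X,
      (∀ l, 0 < l → ∀ f, J l f = f + (l / τ) • (T (J l f) - J l f)) ∧
      (∀ l, 0 < l → ∀ f g, ‖J l f - J l g‖ ≤ ‖f - g‖) ∧
      (∀ m l, 0 < m → m ≤ l → ∀ f, J l f = J m ((m / l) • f + (1 - m / l) • J l f)) := by
  have hc : ∀ l : ℝ, 0 < l → ∀ f : X, ∃ u, u = f + (l / τ) • (T u - u) :=
    fun l hl f => nonexp_res_exists hT (by positivity) f
  choose! J hJ using hc
  refine ⟨J, hJ, fun l hl f g => nonexp_res_contr hT (by positivity) (hJ l hl f) (hJ l hl g), ?_⟩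
  intro m l hm hml f
  have hl : 0 < l := hm.trans_le hml
  set u := J l f with hu
  have h1 : u = ((m / l) • f + (1 - m / l) • u) + (m / τ) • (T u - u) := by
    have h2 : u - f = (l / τ) • (T u - u) := by
      nth_rewrite 1 [hu]; rw [hJ l hl f]; simp [hu]
    have h3 : (m / τ) • (T u - u) = (m / l) • (u - f) := by
      rw [h2, smul_smul]; congr 1; field_simp
    rw [h3]; module
  have h4 := nonexp_res_contr hT (by positivity : 0 ≤ m / τ) h1
    (hJ m hm ((m / l) • f + (1 - m / l) • u))
  rw [sub_self, norm_zero] at h4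
  exact sub_eq_zero.1 (norm_le_zero_iff.1 h4)

lemma ultra_tendsto [CompleteSpace X] {ι : Type*} (U : Ultrafilter ι) (u : ι → X)
    (h : ∀ e > 0, ∃ K : Set X, TotallyBounded K ∧ ∀ᶠ n in (U : Filter ι), ∃ k ∈ K, ‖u n - k‖ ≤ e) :
    ∃ x, Tendsto u U (𝓝 x) := by
  have hC : Cauchy (map u (U : Filter ι)) := by
    rw [Metric.cauchy_iff]
    refine ⟨inferInstance, fun e he => ?_⟩
    obtain ⟨K, hK, hev⟩ := h (e/8) (by positivity)
    obtain ⟨t, htf, ht⟩ := Metric.totallyBounded_iff.1 hK (e/8) (by positivity)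
    have h1 : (⋃ y ∈ t, u ⁻¹' (Metric.ball y (e/2))) ∈ U := by
      filter_upwards [hev] with n hn
      obtain ⟨k, hk, hnk⟩ := hn
      obtain ⟨y, hy, hky⟩ := Set.mem_iUnion₂.1 (ht hk)
      refine Set.mem_iUnion₂.2 ⟨y, hy, ?_⟩
      rw [Set.mem_preimage, Metric.mem_ball]
      rw [Metric.mem_ball] at hky
      rw [← dist_eq_norm] at hnk
      have := dist_triangle (u n) k y
      linarith
    rw [Ultrafilter.finite_biUnion_mem_iff htf] at h1
    obtain ⟨y, hy, hU⟩ := h1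
    refine ⟨Metric.ball y (e/2), hU, fun a ha b hb => ?_⟩
    rw [Metric.mem_ball] at ha hb
    have := dist_triangle_right a b y
    linarith
  obtain ⟨x, hx⟩ := CompleteSpace.complete hC
  exact ⟨x, hx⟩

theorem ultra_resolvent [CompleteSpace X] {Jn : ℕ → ℝ → X → X} {l0 : ℝ} (hl0 : 0 < l0)
    (hcontr : ∀ n l, 0 < l → l ≤ l0 → ∀ f g, ‖Jn n l f - Jn n l g‖ ≤ ‖f - g‖)
    (hres : ∀ n m l, 0 < m → m ≤ l → l ≤ l0 →
      ∀ f, Jn n l f = Jn n m ((m / l) • f + (1 - m / l) • Jn n l f))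
    (D : Set X) (hD : Dense D)
    (hcpt : ∀ l, 0 < l → l ≤ l0 → ∀ f ∈ D, ∀ e > 0, ∃ K : Set X, TotallyBounded K ∧
      ∀ᶠ n in atTop, ∃ k ∈ K, ‖Jn n l f - k‖ ≤ e)
    (htend : ∀ f ∈ D, ∀ e > 0, ∃ d > 0, ∀ l, 0 < l → l ≤ d → l ≤ l0 →
      ∀ᶠ n in atTop, ‖Jn n l f - f‖ ≤ e) :
    ∃ J : ℝ → X → X, ResFam J l0 ∧ ∀ l, 0 < l → l ≤ l0 → ∀ f,
      Tendsto (fun n => Jn n l f) (hyperfilter ℕ : Filter ℕ) (𝓝 (J l f)) := by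
  have hU : (hyperfilter ℕ : Filter ℕ) ≤ atTop := by
    rw [← Nat.cofinite_eq_atTop]; exact hyperfilter_le_cofinite
  have hex : ∀ l, 0 < l → l ≤ l0 → ∀ f, ∃ x,
      Tendsto (fun n => Jn n l f) (hyperfilter ℕ : Filter ℕ) (𝓝 x) := by
    intro l hl hll f
    apply ultra_tendsto
    intro e he
    obtain ⟨g, hgD, hg⟩ := Metric.dense_iff.1 hD f (e/2) (by positivity)
    obtain ⟨K, hK, hev⟩ := hcpt l hl hll g hg (e/2) (by positivity)
    refine ⟨K, hK, ?_⟩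
    filter_upwards [hU hev] with n hn
    obtain ⟨k, hk, hnk⟩ := hn
    refine ⟨k, hk, ?_⟩
    have h1 := hcontr n l hl hll f g
    have h2 : ‖f - g‖ < e/2 := by rw [← dist_eq_norm, dist_comm]; exact hgD
    have := norm_sub_le_norm_sub_add_norm_sub (Jn n l f) (Jn n l g) k
    linarith
  choose! J hJ using hex
  refine ⟨J, ⟨hl0, ?_, ?_, ?_⟩, hJ⟩
  · intro l hl hll x y
    exact le_of_tendsto ((hJ l hl hll x).sub (hJ l hl hll y)).norm
      (Eventually.of_forall fun n => hcontr n l hl hll x y)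
  · intro m l hm hml hll x
    have hl : 0 < l := hm.trans_le hml
    set g := (m / l) • x + (1 - m / l) • J l x with hg
    set gn : ℕ → X := fun n => (m / l) • x + (1 - m / l) • Jn n l x with hgn
    have h1 : Tendsto gn (hyperfilter ℕ : Filter ℕ) (𝓝 g) :=
      tendsto_const_nhds.add ((hJ l hl hll x).const_smul _)
    have h2 := hJ m hm (hml.trans hll) g
    have h3 : Tendsto (fun n => Jn n m (gn n) - Jn n m g) (hyperfilter ℕ : Filter ℕ) (𝓝 0) := by
      rw [tendsto_zero_iff_norm_tendsto_zero]
      refine squeeze_zero (fun _ => norm_nonneg _)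
        (fun n => hcontr n m hm (hml.trans hll) _ _) (tendsto_iff_norm_sub_tendsto_zero.1 h1)
    have h4 : Tendsto (fun n => Jn n l x) (hyperfilter ℕ : Filter ℕ) (𝓝 (0 + J m g)) := by
      refine (h3.add h2).congr fun n => ?_
      rw [sub_add_cancel]
      exact (hres n m l hm hml hll x).symm
    rw [zero_add] at h4
    exact tendsto_nhds_unique (hJ l hl hll x) h4
  · intro x
    rw [Metric.tendsto_nhds]
    intro e he
    obtain ⟨g, hgD, hg⟩ := Metric.dense_iff.1 hD x (e/4) (by positivity)
    obtain ⟨δ, hδ, hev⟩ := htend g hg (e/4) (by positivity)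
    have hmem : ∀ᶠ v in 𝓝[>] (0:ℝ), v ∈ Set.Ioc 0 (min δ l0) :=
      Ioc_mem_nhdsGT (lt_min hδ hl0)
    filter_upwards [hmem] with l hl
    have hll := hl.2.trans (min_le_right _ _)
    have a1 : ‖J l g - g‖ ≤ e/4 :=
      le_of_tendsto ((hJ l hl.1 hll g).sub_const g).norm
        (hU (hev l hl.1 (hl.2.trans (min_le_left _ _)) hll))
    have a2 : ‖J l x - J l g‖ ≤ ‖x - g‖ :=
      le_of_tendsto ((hJ l hl.1 hll x).sub (hJ l hl.1 hll g)).norm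
        (Eventually.of_forall fun n => hcontr n l hl.1 hll x g)
    have a3 : ‖x - g‖ < e/4 := by rw [← dist_eq_norm, dist_comm]; exact hgD
    rw [dist_eq_norm]
    calc ‖J l x - x‖ = ‖(J l x - J l g) + (J l g - g) - (x - g)‖ := by congr 1; abel
      _ ≤ ‖J l x - J l g‖ + ‖J l g - g‖ + ‖x - g‖ :=
        (norm_sub_le _ _).trans (add_le_add_left (norm_add_le _ _) _)
      _ < e := by linarith

end AbstractResolvent

/-- The space `ℝ^d`. -/
abbrev EE (d : ℕ) := Fin d → ℝ

/-- Jump kernels: `Φ y x r` is the flux from `x` to `y` for density value `r` at `x`. -/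
structure JumpK {d : ℕ} (Φ : EE d → EE d → ℝ → ℝ) (q : EE d → ℝ) : Prop where
  meas : Measurable fun p : EE d × EE d × ℝ => Φ p.1 p.2.1 p.2.2
  zero : ∀ y x, Φ y x 0 = 0
  mono : ∀ y x, Monotone (Φ y x)
  lip : ∀ y x r s, |Φ y x r - Φ y x s| ≤ q (y - x) * |r - s|
  qmeas : Measurable q
  qint : Integrable q
  qnn : ∀ z, 0 ≤ q z
  qbd : ∃ Q, ∀ z, q z ≤ Q

/-- The jump operator. -/
noncomputable def JB {d : ℕ} (Φ : EE d → EE d → ℝ → ℝ) (u : EE d → ℝ) (x : EE d) : ℝ :=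
  (∫ y, Φ x y (u y)) - ∫ y, Φ y x (u x)

/-- The dual jump operator applied to a test function. -/
noncomputable def JL {d : ℕ} (Φ : EE d → EE d → ℝ → ℝ) (φ : EE d → ℝ) (x : EE d) (r : ℝ) : ℝ :=
  ∫ y, Φ y x r * (φ y - φ x)

section Jump
variable {d : ℕ} {Φ : EE d → EE d → ℝ → ℝ} {q : EE d → ℝ}

lemma JumpK.absle (h : JumpK Φ q) (y x : EE d) (r : ℝ) : |Φ y x r| ≤ q (y - x) * |r| := by
  simpa [h.zero] using h.lip y x r 0

lemma JumpK.int_q (h : JumpK Φ q) {u : EE d → ℝ} (hu : Integrable u) :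
    Integrable (fun p : EE d × EE d => q (p.1 - p.2) * |u p.2|) (volume.prod volume) := by
  have := Integrable.convolution_integrand (ContinuousLinearMap.mul ℝ ℝ) hu.abs h.qint
  refine this.congr (Eventually.of_forall fun p => ?_)
  simp [mul_comm]

lemma JumpK.int_of_le (h : JumpK Φ q) {u : EE d → ℝ} (hu : Integrable u) {H : EE d × EE d → ℝ}
    (hH : Measurable H) (C : ℝ) (hle : ∀ y x, |H (y, x)| ≤ C * (q (y - x) * |u x|)) :
    Integrable H (volume.prod volume) :=
  ((h.int_q hu).const_mul C).mono' hH.aestronglyMeasurable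
    (Eventually.of_forall fun p => hle p.1 p.2)

lemma JumpK.measH (h : JumpK Φ q) {u : EE d → ℝ} (hm : Measurable u) :
    Measurable (fun p : EE d × EE d => Φ p.1 p.2 (u p.2)) :=
  h.meas.comp (measurable_fst.prodMk (measurable_snd.prodMk (hm.comp measurable_snd)))

lemma JumpK.int (h : JumpK Φ q) {u : EE d → ℝ} (hu : Integrable u) (hm : Measurable u) :
    Integrable (fun p : EE d × EE d => Φ p.1 p.2 (u p.2)) (volume.prod volume) :=
  h.int_of_le hu (h.measH hm) 1 (fun y x => by rw [one_mul]; exact h.absle y x _)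

lemma JumpK.qint' (h : JumpK Φ q) (x : EE d) : Integrable (fun y => q (y - x)) :=
  h.qint.comp_sub_right x

/-- For every point, integrability in the target variable. -/
lemma JumpK.int1 (h : JumpK Φ q) (x : EE d) (r : ℝ) : Integrable (fun y => Φ y x r) := by
  refine ((h.qint' x).mul_const |r|).mono' ?_ (Eventually.of_forall fun y => h.absle y x r)
  exact (h.meas.comp (measurable_id.prodMk (measurable_const (a := (x, r))))).aestronglyMeasurable

lemma JumpK.qint'' (h : JumpK Φ q) {u : EE d → ℝ} (hu : Integrable u) (x : EE d) :
    Integrable (fun y => q (x - y) * |u y|) := by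
  obtain ⟨Q, hQ⟩ := h.qbd
  refine (hu.abs.const_mul Q).mono' ?_ (Eventually.of_forall fun y => ?_)
  · exact (h.qmeas.comp (measurable_const.sub measurable_id)).aestronglyMeasurable.mul
      hu.abs.aestronglyMeasurable
  · rw [Real.norm_of_nonneg (mul_nonneg (h.qnn _) (abs_nonneg _))]
    exact mul_le_mul_of_nonneg_right (hQ _) (abs_nonneg _)

lemma JumpK.int2 (h : JumpK Φ q) {u : EE d → ℝ} (hu : Integrable u) (hm : Measurable u)
    (x : EE d) : Integrable (fun y => Φ x y (u y)) := by
  refine (h.qint'' hu x).mono' ?_ (Eventually.of_forall fun y => h.absle x y _)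
  exact (h.meas.comp (measurable_const.prodMk (measurable_id.prodMk hm))).aestronglyMeasurable

lemma JumpK.int_JB (h : JumpK Φ q) {u : EE d → ℝ} (hu : Integrable u) (hm : Measurable u) :
    Integrable (JB Φ u) := by
  have := h.int hu hm
  exact this.integral_prod_left.sub this.integral_prod_right

lemma JumpK.nonexp_fun (h : JumpK Φ q) {τ : ℝ} (hτ : 0 < τ) (hτq : τ * ∫ z, q z ≤ 1)
    {u v : EE d → ℝ} (hu : Integrable u) (hmu : Measurable u) (hv : Integrable v)
    (hmv : Measurable v) :
    ∫ x, |(u x + τ * JB Φ u x) - (v x + τ * JB Φ v x)| ≤ ∫ x, |u x - v x| := by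
  set D : EE d × EE d → ℝ := fun p => |Φ p.1 p.2 (u p.2) - Φ p.1 p.2 (v p.2)| with hD
  have hDi : Integrable D (volume.prod volume) := ((h.int hu hmu).sub (h.int hv hmv)).abs
  have hA : Integrable (fun x => ∫ y, D (y, x)) := hDi.integral_prod_right
  have hB : Integrable (fun x => ∫ y, D (x, y)) := hDi.integral_prod_left
  have hsw : ∫ x, ∫ y, D (x, y) = ∫ x, ∫ y, D (y, x) := integral_integral_swap hDi
  have key : ∀ x, |(u x + τ * JB Φ u x) - (v x + τ * JB Φ v x)| ≤
      |u x - v x| - τ * (∫ y, D (y, x)) + τ * ∫ y, D (x, y) := by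
    intro x
    have i1 := h.int1 x (u x)
    have i2 := h.int1 x (v x)
    have i3 := h.int2 hu hmu x
    have i4 := h.int2 hv hmv x
    have e1 : (u x + τ * JB Φ u x) - (v x + τ * JB Φ v x) =
        ((u x - v x) - τ * ∫ y, (Φ y x (u x) - Φ y x (v x))) +
        τ * ∫ y, (Φ x y (u y) - Φ x y (v y)) := by
      rw [integral_sub i1 i2, integral_sub i3 i4]; simp only [JB]; ring
    have e2 : |τ * ∫ y, (Φ x y (u y) - Φ x y (v y))| ≤ τ * ∫ y, D (x, y) := by
      rw [abs_mul, abs_of_pos hτ]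
      exact mul_le_mul_of_nonneg_left abs_integral_le_integral_abs hτ.le
    have hq : ∫ y, D (y, x) ≤ (∫ z, q z) * |u x - v x| := by
      rw [← integral_sub_right_eq_self (fun z => q z) x, ← integral_mul_const]
      refine integral_mono (i1.sub i2).abs ((h.qint' x).mul_const _) fun y => ?_
      exact h.lip y x _ _
    have hq2 : τ * ∫ y, D (y, x) ≤ |u x - v x| := by
      calc τ * ∫ y, D (y, x) ≤ τ * ((∫ z, q z) * |u x - v x|) := by gcongr
        _ = (τ * ∫ z, q z) * |u x - v x| := by ring
        _ ≤ 1 * |u x - v x| := by gcongr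
        _ = _ := one_mul _
    have e3 : |(u x - v x) - τ * ∫ y, (Φ y x (u x) - Φ y x (v x))| ≤
        |u x - v x| - τ * ∫ y, D (y, x) := by
      rcases le_total (v x) (u x) with hle | hle
      · have : ∀ y, Φ y x (u x) - Φ y x (v x) = D (y, x) := fun y => by
          simp only [hD]; rw [abs_of_nonneg (sub_nonneg.2 (h.mono y x hle))]
        simp_rw [this]
        rw [abs_of_nonneg (sub_nonneg.2 hle)] at hq2 ⊢
        rw [abs_of_nonneg (by linarith)]
      · have : ∀ y, Φ y x (u x) - Φ y x (v x) = - D (y, x) := fun y => by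
          simp only [hD]; rw [abs_of_nonpos (sub_nonpos.2 (h.mono y x hle)), neg_neg]
        simp_rw [this]
        rw [integral_neg]
        rw [abs_of_nonpos (sub_nonpos.2 hle)] at hq2 ⊢
        rw [abs_of_nonpos (by linarith)]
        linarith
    rw [e1]
    exact (abs_add_le _ _).trans (add_le_add e3 e2)
  have hI1 : Integrable (fun x => |u x - v x|) := (hu.sub hv).abs
  have hI2 : Integrable (fun x => |u x - v x| - τ * (∫ y, D (y, x))) := hI1.sub (hA.const_mul τ)
  have hI : Integrable (fun x => |u x - v x| - τ * (∫ y, D (y, x)) + τ * ∫ y, D (x, y)) :=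
    hI2.add (hB.const_mul τ)
  have hI0 : Integrable (fun x => |(u x + τ * JB Φ u x) - (v x + τ * JB Φ v x)|) :=
    ((hu.add ((h.int_JB hu hmu).const_mul τ)).sub (hv.add ((h.int_JB hv hmv).const_mul τ))).abs
  calc _ ≤ ∫ x, (|u x - v x| - τ * (∫ y, D (y, x)) + τ * ∫ y, D (x, y)) :=
        integral_mono hI0 hI key
    _ = ∫ x, |u x - v x| := by
      rw [integral_add hI2 (hB.const_mul τ),
        integral_sub hI1 (hA.const_mul τ), integral_const_mul, integral_const_mul, hsw]
      ring

/-- `L¹(ℝ^d)`. -/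
noncomputable abbrev L1E (d : ℕ) := Lp ℝ 1 (volume : Measure (EE d))

lemma L1E.int (u : L1E d) : Integrable (u : EE d → ℝ) := L1.integrable_coeFn u
lemma L1E.meas (u : L1E d) : Measurable (u : EE d → ℝ) := (Lp.stronglyMeasurable u).measurable

lemma L1E.norm_sub (u v : L1E d) : ‖u - v‖ = ∫ x, |u x - v x| := by
  rw [L1.norm_eq_integral_norm]
  refine integral_congr_ae ?_
  filter_upwards [Lp.coeFn_sub u v] with x hx
  rw [hx]; rfl

lemma JumpK.exists_resolvent (h : JumpK Φ q) : ∃ J : ℝ → L1E d → L1E d,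
      (∀ l, 0 < l → ∀ f, (J l f : EE d → ℝ) =ᵐ[volume]
        fun x => f x + l * JB Φ (J l f) x) ∧
      (∀ l, 0 < l → ∀ f g, ‖J l f - J l g‖ ≤ ‖f - g‖) ∧
      (∀ m l, 0 < m → m ≤ l → ∀ f, J l f = J m ((m / l) • f + (1 - m / l) • J l f)) := by
  have hq0 : 0 ≤ ∫ z, q z := integral_nonneg h.qnn
  set τ : ℝ := 1 / (1 + ∫ z, q z) with hτd
  have hτ : 0 < τ := by positivity
  have hτq : τ * ∫ z, q z ≤ 1 := by
    rw [hτd, one_div, inv_mul_le_iff₀ (by positivity)]; linarith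
  have hI : ∀ u : L1E d, Integrable (fun x => u x + τ * JB Φ u x) := fun u =>
    (L1E.int u).add ((h.int_JB (L1E.int u) (L1E.meas u)).const_mul τ)
  let T : L1E d → L1E d := fun u => (hI u).toL1 _
  have hTc : ∀ u, (T u : EE d → ℝ) =ᵐ[volume] fun x => u x + τ * JB Φ u x :=
    fun u => (hI u).coeFn_toL1
  have hT : ∀ u v, ‖T u - T v‖ ≤ ‖u - v‖ := by
    intro u v
    rw [L1E.norm_sub, L1E.norm_sub]
    refine le_trans (le_of_eq ?_) (h.nonexp_fun hτ hτq (L1E.int u) (L1E.meas u) (L1E.int v) (L1E.meas v))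
    refine integral_congr_ae ?_
    filter_upwards [hTc u, hTc v] with x h1 h2
    rw [h1, h2]
  obtain ⟨J, h1, h2, h3⟩ := nonexp_resolvent hT hτ
  refine ⟨J, fun l hl f => ?_, h2, h3⟩
  set u := J l f with hu
  have e := h1 l hl f
  rw [← hu] at e
  have e' : (u : EE d → ℝ) =ᵐ[volume] (f + (l / τ) • (T u - u) : L1E d) := by
    nth_rewrite 1 [e]; rfl
  filter_upwards [e', Lp.coeFn_add f ((l / τ) • (T u - u)), Lp.coeFn_smul (l / τ) (T u - u),
    Lp.coeFn_sub (T u) u, hTc u] with x a1 a2 a3 a4 a5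
  rw [a1, a2, Pi.add_apply, a3, Pi.smul_apply, a4, Pi.sub_apply, a5, smul_eq_mul]
  field_simp
  ring

lemma JB_weak (h : JumpK Φ q) {u : EE d → ℝ} (hu : Integrable u) (hm : Measurable u)
    {φ : EE d → ℝ} (hφ : Measurable φ) {C : ℝ} (hC : ∀ x, |φ x| ≤ C) :
    ∫ x, JB Φ u x * φ x = ∫ x, JL Φ φ x (u x) := by
  have hC0 : 0 ≤ C := (abs_nonneg _).trans (hC 0)
  have i1 : Integrable (fun p : EE d × EE d => Φ p.1 p.2 (u p.2) * φ p.1) (volume.prod volume) := by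
    refine h.int_of_le hu ((h.measH hm).mul (hφ.comp measurable_fst)) C fun y x => ?_
    rw [abs_mul, mul_comm]
    exact mul_le_mul (hC _) (h.absle _ _ _) (abs_nonneg _) hC0
  have i2 : Integrable (fun p : EE d × EE d => Φ p.1 p.2 (u p.2) * φ p.2) (volume.prod volume) := by
    refine h.int_of_le hu ((h.measH hm).mul (hφ.comp measurable_snd)) C fun y x => ?_
    rw [abs_mul, mul_comm]
    exact mul_le_mul (hC _) (h.absle _ _ _) (abs_nonneg _) hC0
  have s1 : ∀ x, JB Φ u x * φ x = (∫ y, Φ x y (u y) * φ x) - ∫ y, Φ y x (u x) * φ x := by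
    intro x; rw [integral_mul_const, integral_mul_const, JB]; ring
  have s2 : ∀ x, JL Φ φ x (u x) = (∫ y, Φ y x (u x) * φ y) - ∫ y, Φ y x (u x) * φ x := by
    intro x
    rw [JL, ← integral_sub]
    · congr 1; ext y; ring
    · refine ((h.int1 x (u x)).mul_bdd hφ.aestronglyMeasurable (Eventually.of_forall hC))
    · exact (h.int1 x (u x)).mul_const _
  simp_rw [s1, s2]
  have j1 : Integrable (fun x => ∫ y, Φ x y (u y) * φ x) := i1.integral_prod_left
  have j2 : Integrable (fun x => ∫ y, Φ y x (u x) * φ x) := i2.integral_prod_right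
  have j3 : Integrable (fun x => ∫ y, Φ y x (u x) * φ y) := i1.integral_prod_right
  rw [integral_sub j1 j2, integral_sub j3 j2]
  congr 1
  exact integral_integral_swap i1

lemma JL_int (h : JumpK Φ q) {u : EE d → ℝ} (hu : Integrable u) (hm : Measurable u)
    {φ : EE d → ℝ} (hφ : Measurable φ) {C : ℝ} (hC : ∀ x, |φ x| ≤ C) :
    Integrable (fun x => JL Φ φ x (u x)) := by
  have hC0 : 0 ≤ C := (abs_nonneg _).trans (hC 0)
  have i1 : Integrable (fun p : EE d × EE d => Φ p.1 p.2 (u p.2) * (φ p.1 - φ p.2))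
      (volume.prod volume) := by
    refine h.int_of_le hu ((h.measH hm).mul ((hφ.comp measurable_fst).sub
      (hφ.comp measurable_snd))) (C + C) fun y x => ?_
    rw [abs_mul, mul_comm]
    exact mul_le_mul ((abs_sub _ _).trans (add_le_add (hC _) (hC _))) (h.absle _ _ _)
      (abs_nonneg _) (by positivity)
  exact i1.integral_prod_right

/-- pointwise Kato inequality -/
lemma kato_pt (h : JumpK Φ q) {u : EE d → ℝ} (hu : Integrable u) (hm : Measurable u)
    {f l : ℝ} (hl : 0 < l) {x : EE d} (he : u x = f + l * JB Φ u x) :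
    |u x| + l * ∫ y, |Φ y x (u x)| ≤ |f| + l * ∫ y, |Φ x y (u y)| := by
  have e1 : u x + l * ∫ y, Φ y x (u x) = f + l * ∫ y, Φ x y (u y) := by
    rw [JB] at he; linarith
  have e2 : |f + l * ∫ y, Φ x y (u y)| ≤ |f| + l * ∫ y, |Φ x y (u y)| := by
    refine (abs_add_le _ _).trans ?_
    rw [abs_mul, abs_of_pos hl]
    gcongr
    exact abs_integral_le_integral_abs
  have e3 : |u x| + l * ∫ y, |Φ y x (u x)| = |u x + l * ∫ y, Φ y x (u x)| := by
    rcases le_total 0 (u x) with h0 | h0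
    · have h1 : ∀ y, 0 ≤ Φ y x (u x) := fun y => by rw [← h.zero y x]; exact h.mono y x h0
      simp_rw [fun y => abs_of_nonneg (h1 y)]
      rw [abs_of_nonneg h0, abs_of_nonneg]
      have : 0 ≤ ∫ y, Φ y x (u x) := integral_nonneg h1
      positivity
    · have h1 : ∀ y, Φ y x (u x) ≤ 0 := fun y => by rw [← h.zero y x]; exact h.mono y x h0
      simp_rw [fun y => abs_of_nonpos (h1 y)]
      rw [integral_neg, abs_of_nonpos h0, abs_of_nonpos]
      · ring
      have : ∫ y, Φ y x (u x) ≤ 0 := integral_nonpos h1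
      nlinarith
  rw [e3, e1]; exact e2

lemma abs_JL (h : JumpK Φ q) (φ : EE d → ℝ) (x : EE d) (r : ℝ) :
    ∫ y, |Φ y x r| * (φ x - φ y) ≤ |JL Φ φ x r| := by
  rcases le_total 0 r with h0 | h0
  · have h1 : ∀ y, 0 ≤ Φ y x r := fun y => by rw [← h.zero y x]; exact h.mono y x h0
    have : ∫ y, |Φ y x r| * (φ x - φ y) = - JL Φ φ x r := by
      rw [JL, ← integral_neg]; congr 1; ext y; rw [abs_of_nonneg (h1 y)]; ring
    rw [this]; exact neg_le_abs _
  · have h1 : ∀ y, Φ y x r ≤ 0 := fun y => by rw [← h.zero y x]; exact h.mono y x h0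
    have : ∫ y, |Φ y x r| * (φ x - φ y) = JL Φ φ x r := by
      rw [JL]; congr 1; ext y; rw [abs_of_nonpos (h1 y)]; ring
    rw [this]; exact le_abs_self _

/-- tightness -/
lemma kato_weight (h : JumpK Φ q) {u f : EE d → ℝ} (hu : Integrable u) (hm : Measurable u)
    (hf : Integrable f) {l : ℝ} (hl : 0 < l) (he : ∀ᵐ x, u x = f x + l * JB Φ u x)
    {φ : EE d → ℝ} (hφ : Measurable φ) (h0 : ∀ x, 0 ≤ φ x) (h1 : ∀ x, φ x ≤ 1) :
    ∫ x, |u x| * (1 - φ x) ≤ (∫ x, |f x| * (1 - φ x)) + l * ∫ x, |JL Φ φ x (u x)| := by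
  have hb : ∀ x, |φ x| ≤ 1 := fun x => by rw [abs_of_nonneg (h0 x)]; exact h1 x
  have hb' : ∀ x, ‖1 - φ x‖ ≤ 1 := fun x => by
    rw [Real.norm_eq_abs, abs_of_nonneg (by linarith [h1 x])]; linarith [h0 x]
  set P : EE d × EE d → ℝ := fun p => |Φ p.1 p.2 (u p.2)| with hP
  have hPm : Measurable P := by
    have := (h.measH hm).norm
    simpa [hP, Real.norm_eq_abs] using this
  have hP1 : Integrable (fun p : EE d × EE d => P p * (1 - φ p.1)) (volume.prod volume) := by
    refine (h.int hu hm).abs.mul_bdd ?_ (Eventually.of_forall fun p => hb' _)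
    exact (measurable_const.sub (hφ.comp measurable_fst)).aestronglyMeasurable
  have hP2 : Integrable (fun p : EE d × EE d => P p * (1 - φ p.2)) (volume.prod volume) := by
    refine (h.int hu hm).abs.mul_bdd ?_ (Eventually.of_forall fun p => hb' _)
    exact (measurable_const.sub (hφ.comp measurable_snd)).aestronglyMeasurable
  have hwm : AEStronglyMeasurable (fun x => 1 - φ x) volume :=
    (measurable_const.sub hφ).aestronglyMeasurable
  have iu : Integrable (fun x => |u x| * (1 - φ x)) :=
    hu.abs.mul_bdd hwm (Eventually.of_forall hb')
  have jf : Integrable (fun x => |f x| * (1 - φ x)) :=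
    hf.abs.mul_bdd hwm (Eventually.of_forall hb')
  have j1 : Integrable (fun x => ∫ y, P (y, x) * (1 - φ x)) := hP2.integral_prod_right
  have j2 : Integrable (fun x => ∫ y, P (x, y) * (1 - φ x)) := hP1.integral_prod_left
  have j3 : Integrable (fun x => ∫ y, P (y, x) * (1 - φ y)) := hP1.integral_prod_right
  have pt : ∀ᵐ x, |u x| * (1 - φ x) + l * (∫ y, P (y, x) * (1 - φ x)) ≤
      |f x| * (1 - φ x) + l * ∫ y, P (x, y) * (1 - φ x) := by
    filter_upwards [he] with x hx
    have := kato_pt h hu hm hl hx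
    have h2 : 0 ≤ 1 - φ x := by linarith [h1 x]
    rw [integral_mul_const, integral_mul_const]
    simp only [hP]
    nlinarith
  have I := integral_mono_ae (iu.add (j1.const_mul l)) (jf.add (j2.const_mul l)) pt
  simp only [Pi.add_apply] at I
  rw [integral_add iu (j1.const_mul l), integral_add jf (j2.const_mul l), integral_const_mul,
    integral_const_mul] at I
  have sw : ∫ x, ∫ y, P (x, y) * (1 - φ x) = ∫ x, ∫ y, P (y, x) * (1 - φ y) :=
    integral_integral_swap hP1
  rw [sw] at I
  have fin : (∫ x, ∫ y, P (y, x) * (1 - φ y)) - (∫ x, ∫ y, P (y, x) * (1 - φ x)) ≤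
      ∫ x, |JL Φ φ x (u x)| := by
    rw [← integral_sub j3 j1]
    refine integral_mono (j3.sub j1) (JL_int h hu hm hφ hb).abs fun x => ?_
    refine le_trans (le_of_eq ?_) (abs_JL h φ x (u x))
    rw [← integral_sub]
    · congr 1; ext y; simp only [hP]; ring
    · exact (h.int1 x (u x)).abs.mul_bdd hwm (Eventually.of_forall hb')
    · exact (h.int1 x (u x)).abs.mul_const _
  nlinarith

lemma JB_congr {u v : EE d → ℝ} (huv : u =ᵐ[volume] v) : JB Φ u =ᵐ[volume] JB Φ v := by
  filter_upwards [huv] with x hx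
  simp only [JB]
  rw [hx]
  congr 1
  refine integral_congr_ae ?_
  filter_upwards [huv] with y hy
  rw [hy]

/-- bounded data gives bounded solutions -/
lemma sol_bdd (h : JumpK Φ q) {u f : EE d → ℝ} (hu : Integrable u) (hm : Measurable u)
    {l : ℝ} (hl : 0 < l) (he : ∀ᵐ x, u x = f x + l * JB Φ u x) {C : ℝ} (hC : ∀ᵐ x, |f x| ≤ C) :
    ∃ C', ∀ᵐ x, |u x| ≤ C' := by
  obtain ⟨Q, hQ⟩ := h.qbd
  refine ⟨C + l * (Q * ∫ y, |u y|), ?_⟩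
  filter_upwards [he, hC] with x hx hCx
  have k := kato_pt h hu hm hl hx
  have k1 : 0 ≤ ∫ y, |Φ y x (u x)| := integral_nonneg fun y => abs_nonneg _
  have k2 : ∫ y, |Φ x y (u y)| ≤ Q * ∫ y, |u y| := by
    rw [← integral_const_mul]
    refine integral_mono (h.int2 hu hm x).abs (hu.abs.const_mul Q) fun y => ?_
    exact (h.absle x y _).trans (mul_le_mul_of_nonneg_right (hQ _) (abs_nonneg _))
  have k3 : l * ∫ y, |Φ x y (u y)| ≤ l * (Q * ∫ y, |u y|) := by gcongr
  have k4 : 0 ≤ l * ∫ y, |Φ y x (u x)| := by positivity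
  linarith

/-- replace the solution by a bounded everywhere representative -/
lemma sol_rep (h : JumpK Φ q) {u f : EE d → ℝ} (hu : Integrable u) (hm : Measurable u)
    {l : ℝ} (hl : 0 < l) (he : ∀ᵐ x, u x = f x + l * JB Φ u x) {C : ℝ} (hC : ∀ᵐ x, |f x| ≤ C) :
    ∃ v : EE d → ℝ, v =ᵐ[volume] u ∧ Integrable v ∧ Measurable v ∧ (∃ C', ∀ x, |v x| ≤ C') ∧
      ∀ᵐ x, v x = f x + l * JB Φ v x := by
  obtain ⟨C', hC'⟩ := sol_bdd h hu hm hl he hC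
  set v : EE d → ℝ := fun x => max (-|C'|) (min |C'| (u x)) with hv
  have hvu : v =ᵐ[volume] u := by
    filter_upwards [hC'] with x hx
    have h1 := abs_le.1 (hx.trans (le_abs_self C'))
    simp only [hv]
    rw [min_eq_right h1.2, max_eq_right h1.1]
  refine ⟨v, hvu, hu.congr hvu.symm, ?_, ⟨|C'|, fun x => ?_⟩, ?_⟩
  · exact measurable_const.max (measurable_const.min hm)
  · simp only [hv, abs_le]
    exact ⟨le_max_left _ _, max_le (by linarith [abs_nonneg C']) (min_le_left _ _)⟩
  · filter_upwards [he, hvu, JB_congr (Φ := Φ) hvu] with x a1 a2 a3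
    rw [a2, a3, a1]

end Jump

section Compact
variable {d : ℕ}

/-- squared `L²` modulus of continuity -/
noncomputable def GG (u : EE d → ℝ) (η : EE d) : ENNReal :=
  ∫⁻ x, ENNReal.ofReal ((u (x + η) - u x) ^ 2)

lemma GG_meas2 {u : EE d → ℝ} (hu : Measurable u) :
    Measurable (fun p : EE d × EE d => ENNReal.ofReal ((u (p.2 + p.1) - u p.2) ^ 2)) := by
  have h1 : Measurable (fun p : EE d × EE d => u (p.2 + p.1)) :=
    hu.comp (measurable_snd.add measurable_fst)
  exact ((h1.sub (hu.comp measurable_snd)).pow_const 2).ennreal_ofReal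

lemma GG_meas {u : EE d → ℝ} (hu : Measurable u) : Measurable (GG u) :=
  (GG_meas2 hu).lintegral_prod_right'

lemma GG_shift (u : EE d → ℝ) (η ζ : EE d) :
    ∫⁻ x, ENNReal.ofReal ((u (x + ζ + η) - u (x + ζ)) ^ 2) = GG u η :=
  lintegral_add_right_eq_self (fun x => ENNReal.ofReal ((u (x + η) - u x) ^ 2)) ζ

lemma GG_term_meas {u : EE d → ℝ} (hu : Measurable u) (η ζ : EE d) :
    Measurable (fun x => ENNReal.ofReal ((u (x + ζ + η) - u (x + ζ)) ^ 2)) := by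
  have h1 : Measurable (fun x : EE d => u (x + ζ + η)) :=
    hu.comp ((measurable_id.add_const ζ).add_const η)
  have h2 : Measurable (fun x : EE d => u (x + ζ)) := hu.comp (measurable_id.add_const ζ)
  exact ((h1.sub h2).pow_const 2).ennreal_ofReal

lemma GG_split {u : EE d → ℝ} (hu : Measurable u) (η ζ : EE d) :
    GG u η ≤ 2 * GG u ζ + 2 * GG u (η - ζ) := by
  rw [← GG_shift u (η - ζ) ζ]
  have m1 : Measurable (fun x => ENNReal.ofReal ((u (x + ζ) - u x) ^ 2)) := by
    simpa using GG_term_meas hu ζ 0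
  unfold GG
  rw [← lintegral_const_mul _ m1, ← lintegral_const_mul _ (GG_term_meas hu _ _),
    ← lintegral_add_left (m1.const_mul 2)]
  refine lintegral_mono fun x => ?_
  have e : x + ζ + (η - ζ) = x + η := by abel
  have e2 : (2 : ENNReal) = ENNReal.ofReal 2 := by simp
  simp only [e]
  rw [e2, ← ENNReal.ofReal_mul (by norm_num), ← ENNReal.ofReal_mul (by norm_num),
    ← ENNReal.ofReal_add (by positivity) (by positivity)]
  refine ENNReal.ofReal_le_ofReal ?_
  nlinarith [sq_nonneg ((u (x + ζ) - u x) - (u (x + η) - u (x + ζ)))]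

lemma GG_nsmul {u : EE d → ℝ} (hu : Measurable u) (η : EE d) (n : ℕ) :
    GG u (n • η) ≤ ENNReal.ofReal ((n : ℝ) ^ 2) * GG u η := by
  have hk : ∀ x, ENNReal.ofReal ((u (x + n • η) - u x) ^ 2) ≤
      ENNReal.ofReal n * ∑ k ∈ Finset.range n,
        ENNReal.ofReal ((u (x + k • η + η) - u (x + k • η)) ^ 2) := by
    intro x
    have e : u (x + n • η) - u x = ∑ k ∈ Finset.range n, (u (x + k • η + η) - u (x + k • η)) := by
      have := Finset.sum_range_sub (fun k : ℕ => u (x + k • η)) n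
      simp only [succ_nsmul, zero_smul, add_zero, ← add_assoc] at this
      exact this.symm
    rw [← ENNReal.ofReal_sum_of_nonneg (fun _ _ => sq_nonneg _), ← ENNReal.ofReal_mul (by positivity)]
    refine ENNReal.ofReal_le_ofReal ?_
    rw [e]
    simpa using sq_sum_le_card_mul_sum_sq (s := Finset.range n)
      (f := fun k => u (x + k • η + η) - u (x + k • η))
  calc GG u (n • η) ≤ ∫⁻ x, ENNReal.ofReal n * ∑ k ∈ Finset.range n,
        ENNReal.ofReal ((u (x + k • η + η) - u (x + k • η)) ^ 2) := lintegral_mono hk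
    _ = ENNReal.ofReal n * ∑ k ∈ Finset.range n, GG u η := by
      rw [lintegral_const_mul _ (Finset.measurable_sum _ fun k _ => GG_term_meas hu η (k • η)),
        lintegral_finsetSum _ (fun k _ => GG_term_meas hu η (k • η))]
      simp only [GG_shift]
    _ = _ := by
      rw [Finset.sum_const, Finset.card_range, nsmul_eq_mul, ← mul_assoc, sq,
        ENNReal.ofReal_mul (by positivity)]
      simp

lemma GG_small {u : EE d → ℝ} (hu : Measurable u) {h C : ℝ} (hh : 0 < h) (hC : 0 ≤ C)
    (hE : ∫⁻ ζ in Metric.closedBall (0 : EE d) h, GG u ζ ≤ ENNReal.ofReal (C * h ^ (d + 2)))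
    {η : EE d} (hη : ‖η‖ ≤ h) : GG u η ≤ ENNReal.ofReal (4 * C * h ^ 2) := by
  set B := Metric.closedBall (0 : EE d) h with hB
  set S := Metric.closedBall ((1 / 2 : ℝ) • η) (h / 2) with hS
  have hn : ‖(1 / 2 : ℝ) • η‖ ≤ h / 2 := by
    rw [norm_smul]; norm_num; linarith
  have hSB : S ⊆ B := by
    intro z hz
    rw [hS, mem_closedBall_iff_norm] at hz
    rw [hB, mem_closedBall_zero_iff]
    calc ‖z‖ = ‖(z - (1 / 2 : ℝ) • η) + (1 / 2 : ℝ) • η‖ := by simp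
      _ ≤ h / 2 + h / 2 := (norm_add_le _ _).trans (add_le_add hz hn)
      _ = h := by ring
  have hSm : MeasurableSet S := Metric.isClosed_closedBall.measurableSet
  have hvol : volume S = ENNReal.ofReal (h ^ d) := by
    rw [hS, Real.volume_pi_closedBall _ (by positivity)]; simp; ring_nf
  have hrefl : ∫⁻ ζ in S, GG u (η - ζ) = ∫⁻ ζ in S, GG u ζ := by
    rw [← lintegral_indicator hSm, ← lintegral_indicator hSm,
      ← lintegral_sub_left_eq_self (S.indicator fun ζ => GG u ζ) η]
    congr 1; ext ζ
    have : ζ ∈ S ↔ η - ζ ∈ S := by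
      rw [hS, mem_closedBall_iff_norm, mem_closedBall_iff_norm]
      have : η - ζ - (1 / 2 : ℝ) • η = -(ζ - (1 / 2 : ℝ) • η) := by
        ext i; simp; ring
      rw [this, norm_neg]
    by_cases hz : ζ ∈ S
    · rw [Set.indicator_of_mem hz, Set.indicator_of_mem (this.1 hz)]
    · rw [Set.indicator_of_notMem hz, Set.indicator_of_notMem (fun h => hz (this.2 h))]
  have key : GG u η * volume S ≤ 4 * ∫⁻ ζ in B, GG u ζ := by
    calc GG u η * volume S = ∫⁻ ζ in S, GG u η := by simp
      _ ≤ ∫⁻ ζ in S, (2 * GG u ζ + 2 * GG u (η - ζ)) :=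
        lintegral_mono fun ζ => GG_split hu η ζ
      _ = 2 * (∫⁻ ζ in S, GG u ζ) + 2 * ∫⁻ ζ in S, GG u (η - ζ) := by
        rw [lintegral_add_left ((GG_meas hu).const_mul 2), lintegral_const_mul _ (GG_meas hu),
          lintegral_const_mul]
        exact (GG_meas hu).comp (measurable_const.sub measurable_id)
      _ = 4 * ∫⁻ ζ in S, GG u ζ := by rw [hrefl, ← add_mul]; norm_num
      _ ≤ _ := by gcongr
  rw [hvol] at key
  have hpos : 0 < h ^ d := by positivity
  have k2 : GG u η * ENNReal.ofReal (h ^ d) ≤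
      ENNReal.ofReal (4 * C * h ^ 2) * ENNReal.ofReal (h ^ d) := by
    refine key.trans ?_
    rw [← ENNReal.ofReal_mul (by positivity)]
    calc 4 * ∫⁻ ζ in B, GG u ζ ≤ 4 * ENNReal.ofReal (C * h ^ (d + 2)) := by gcongr
      _ = ENNReal.ofReal (4 * (C * h ^ (d + 2))) := by
        rw [ENNReal.ofReal_mul (p := 4) (by norm_num)]; simp
      _ = _ := by congr 1; ring
  exact (ENNReal.mul_le_mul_iff_left (by simpa using hpos) (by simp)).1 k2

lemma GG_bound {u : EE d → ℝ} (hu : Measurable u) {h C : ℝ} (hh : 0 < h) (hC : 0 ≤ C)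
    (hE : ∫⁻ ζ in Metric.closedBall (0 : EE d) h, GG u ζ ≤ ENNReal.ofReal (C * h ^ (d + 2)))
    (η : EE d) : GG u η ≤ ENNReal.ofReal (4 * C * (‖η‖ + h) ^ 2) := by
  by_cases h0 : ‖η‖ ≤ h
  · refine (GG_small hu hh hC hE h0).trans (ENNReal.ofReal_le_ofReal ?_)
    gcongr
    linarith [norm_nonneg η]
  · push Not at h0
    set n := ⌈‖η‖ / h⌉₊ with hn
    have hn0 : (0 : ℝ) < n := by
      rw [hn, Nat.cast_pos, Nat.ceil_pos]; exact div_pos (hh.trans h0) hh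
    have h1 : ‖η‖ / h ≤ n := Nat.le_ceil _
    have h2 : (n : ℝ) < ‖η‖ / h + 1 := Nat.ceil_lt_add_one (by positivity)
    set ζ : EE d := (1 / (n : ℝ)) • η with hζ
    have e : η = n • ζ := by
      rw [hζ, ← Nat.cast_smul_eq_nsmul ℝ, smul_smul]; field_simp; simp
    have hz : ‖ζ‖ ≤ h := by
      rw [hζ, norm_smul, Real.norm_of_nonneg (by positivity), one_div, inv_mul_le_iff₀ hn0]
      rwa [div_le_iff₀ hh] at h1
    calc GG u η = GG u (n • ζ) := by rw [← e]
      _ ≤ _ := GG_nsmul hu ζ n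
      _ ≤ ENNReal.ofReal ((n : ℝ) ^ 2) * ENNReal.ofReal (4 * C * h ^ 2) := by
        gcongr; exact GG_small hu hh hC hE hz
      _ = ENNReal.ofReal ((n : ℝ) ^ 2 * (4 * C * h ^ 2)) := by
        rw [ENNReal.ofReal_mul (p := (n : ℝ) ^ 2) (by positivity)]
      _ ≤ _ := by
        refine ENNReal.ofReal_le_ofReal ?_
        have : (n : ℝ) * h ≤ ‖η‖ + h := by
          have := mul_le_mul_of_nonneg_right h2.le hh.le
          rw [add_mul, div_mul_cancel₀ _ hh.ne'] at this; linarith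
        calc (n : ℝ) ^ 2 * (4 * C * h ^ 2) = 4 * C * ((n : ℝ) * h) ^ 2 := by ring
          _ ≤ _ := by gcongr

/-- grid cell -/
def cell (δ : ℝ) (c : Fin d → ℤ) : Set (EE d) := {x | ∀ i, ⌊x i / δ⌋ = c i}

lemma cell_meas (δ : ℝ) (c : Fin d → ℤ) : MeasurableSet (cell δ c) := by
  have : cell δ c = ⋂ i, {x : EE d | ⌊x i / δ⌋ = c i} := by ext x; simp [cell]
  rw [this]
  refine MeasurableSet.iInter fun i => ?_
  have hm : Measurable (fun x : EE d => ⌊x i / δ⌋) :=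
    Int.measurable_floor.comp ((measurable_pi_apply (X := fun _ => ℝ) i).div_const δ)
  exact hm (measurableSet_singleton (c i))

lemma cell_vol {δ : ℝ} (hδ : 0 < δ) (c : Fin d → ℤ) :
    volume (cell δ c) = ENNReal.ofReal (δ ^ d) := by
  have : cell δ c = Set.pi Set.univ fun i => Set.Ico (c i * δ) ((c i + 1) * δ) := by
    ext x
    simp only [cell, Set.mem_ofPred_eq, Set.mem_pi, Set.mem_univ, forall_true_left, Set.mem_Ico]
    refine forall_congr' fun i => ?_
    rw [Int.floor_eq_iff, le_div_iff₀ hδ, div_lt_iff₀ hδ]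
  rw [this, Real.volume_pi_Ico]
  have : ∀ i, ((c i : ℝ) + 1) * δ - c i * δ = δ := fun i => by ring
  simp [this, ENNReal.ofReal_pow hδ.le]

lemma cell_dist {δ : ℝ} (hδ : 0 < δ) {x y : EE d} {c : Fin d → ℤ} (hx : x ∈ cell δ c)
    (hy : y ∈ cell δ c) : ‖y - x‖ ≤ δ := by
  rw [pi_norm_le_iff_of_nonneg hδ.le]
  intro i
  have := Int.abs_sub_lt_one_of_floor_eq_floor ((hy i).trans (hx i).symm)
  rw [← sub_div, abs_div, abs_of_pos hδ, div_lt_one hδ] at this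
  exact this.le

/-- the finite set of cells -/
noncomputable def cells (d : ℕ) (m : ℕ) : Finset (Fin d → ℤ) := Fintype.piFinset fun _ => Finset.Icc (-m : ℤ) m

/-- the point lies in one of the finitely many cells -/
lemma mem_cells {δ : ℝ} (hδ : 0 < δ) {R : ℝ} {m : ℕ} (hm : R / δ + 1 ≤ m) {x : EE d}
    (hx : ‖x‖ ≤ R) : (fun i => ⌊x i / δ⌋) ∈ cells d m := by
  simp only [cells, Fintype.mem_piFinset, Finset.mem_Icc]
  intro i
  have h1 := abs_le.1 ((norm_le_pi_norm x i).trans hx)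
  have h2 : x i / δ ≤ R / δ := by gcongr; exact h1.2
  have h3 : -(R / δ) ≤ x i / δ := by rw [← neg_div]; gcongr; exact h1.1
  have h4 := Int.floor_le (x i / δ)
  have h5 := Int.lt_floor_add_one (x i / δ)
  constructor
  · have : (-(m : ℝ)) ≤ (⌊x i / δ⌋ : ℝ) := by linarith
    exact_mod_cast this
  · have : (⌊x i / δ⌋ : ℝ) ≤ m := by linarith
    exact_mod_cast this

lemma L1_coeFn_sum {ι : Type*} (s : Finset ι) (f : ι → L1E d) :
    ∀ᵐ x, ((∑ i ∈ s, f i : L1E d) : EE d → ℝ) x = ∑ i ∈ s, (f i : EE d → ℝ) x := by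
  classical
  induction s using Finset.induction_on with
  | empty => simp
  | insert i s hi ih =>
    rw [Finset.sum_insert hi]
    filter_upwards [ih, Lp.coeFn_add (f i) (∑ i ∈ s, f i)] with x h1 h2
    rw [h2, Pi.add_apply, h1, Finset.sum_insert hi]

/-- truncated cell -/
def tcell (δ R : ℝ) (c : Fin d → ℤ) : Set (EE d) := cell δ c ∩ Metric.closedBall 0 R

lemma tcell_meas (δ R : ℝ) (c : Fin d → ℤ) : MeasurableSet (tcell δ R c) :=
  (cell_meas δ c).inter Metric.isClosed_closedBall.measurableSet

lemma tcell_fin (δ R : ℝ) (c : Fin d → ℤ) : volume (tcell δ R c) ≠ ⊤ :=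
  ne_top_of_le_ne_top (measure_closedBall_lt_top (x := (0 : EE d)) (r := R)).ne
    (measure_mono Set.inter_subset_right)

/-- step function in `L¹` -/
noncomputable def stepL (δ R : ℝ) (m : ℕ) (t : cells d m → ℝ) : L1E d :=
  ∑ c : cells d m, t c • indicatorConstLp 1 (tcell_meas δ R c.1) (tcell_fin δ R c.1) (1 : ℝ)

lemma stepL_cont (δ R : ℝ) (m : ℕ) : Continuous (stepL (d := d) δ R m) := by
  unfold stepL
  fun_prop

lemma stepL_ae (δ R : ℝ) (m : ℕ) (t : cells d m → ℝ) :
    ∀ᵐ x, (∀ c : cells d m, x ∈ tcell δ R c.1 → (stepL δ R m t : EE d → ℝ) x = t c) ∧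
      (x ∉ Metric.closedBall (0 : EE d) R → (stepL δ R m t : EE d → ℝ) x = 0) := by
  set F : cells d m → L1E d := fun c =>
    indicatorConstLp 1 (tcell_meas δ R c.1) (tcell_fin δ R c.1) (1 : ℝ) with hF
  have h1 : ∀ᵐ x, ∀ c : cells d m, (F c : EE d → ℝ) x =
      (tcell δ R c.1).indicator (fun _ => (1 : ℝ)) x :=
    ae_all_iff.2 fun c => indicatorConstLp_coeFn
  have h2 : ∀ᵐ x, ∀ c : cells d m, (t c • F c : L1E d) x = t c • (F c : EE d → ℝ) x :=
    ae_all_iff.2 fun c => Lp.coeFn_smul _ _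
  have h3 := L1_coeFn_sum Finset.univ (fun c : cells d m => t c • F c)
  filter_upwards [h1, h2, h3] with x a1 a2 a3
  have e : (stepL δ R m t : EE d → ℝ) x =
      ∑ c : cells d m, t c * (tcell δ R c.1).indicator (fun _ => (1 : ℝ)) x := by
    rw [stepL, a3]
    exact Finset.sum_congr rfl fun c _ => by rw [a2, a1, smul_eq_mul]
  rw [e]
  refine ⟨fun c hc => ?_, fun hx => ?_⟩
  · rw [Finset.sum_eq_single c]
    · rw [Set.indicator_of_mem hc]; simp
    · intro b _ hb
      rw [Set.indicator_of_notMem]; · simp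
      intro hxb
      apply hb
      ext i
      rw [← hc.1 i, ← hxb.1 i]
    · simp
  · refine Finset.sum_eq_zero fun c _ => ?_
    rw [Set.indicator_of_notMem (fun h => hx h.2), mul_zero]

/-- cell averages -/
noncomputable def avgs (δ : ℝ) (m : ℕ) (u : EE d → ℝ) (c : cells d m) : ℝ :=
  (δ ^ d)⁻¹ * ∫ y in cell δ c.1, u y

lemma avg_err {u : EE d → ℝ} (hi : Integrable u) {δ : ℝ} (hδ : 0 < δ) {m : ℕ}
    {x : EE d} {c : cells d m} (hc : x ∈ cell δ c.1) :
    ‖u x - avgs δ m u c‖ₑ ≤ ENNReal.ofReal (δ ^ d)⁻¹ *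
      ∫⁻ ζ in Metric.closedBall (0 : EE d) δ, ‖u (x + ζ) - u x‖ₑ := by
  have hv : volume.real (cell δ c.1) = δ ^ d := by
    rw [Measure.real, cell_vol hδ, ENNReal.toReal_ofReal (by positivity)]
  have hfin : volume (cell δ c.1) < ⊤ := by rw [cell_vol hδ]; exact ENNReal.ofReal_lt_top
  have hpos : 0 < δ ^ d := by positivity
  have e : u x - avgs δ m u c = (δ ^ d)⁻¹ * ∫ y in cell δ c.1, (u x - u y) := by
    have i0 : Integrable (fun _ : EE d => u x) (volume.restrict (cell δ c.1)) :=
      integrableOn_const hfin.ne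
    rw [integral_sub i0 hi.integrableOn, setIntegral_const, hv, avgs,
      smul_eq_mul]
    field_simp
  rw [e, enorm_mul, Real.enorm_of_nonneg (inv_nonneg.2 hpos.le)]
  gcongr
  refine (enorm_integral_le_lintegral_enorm _).trans ?_
  have sub : cell δ c.1 ⊆ Metric.closedBall x δ := fun y hy => by
    rw [mem_closedBall_iff_norm]; exact cell_dist hδ hc hy
  refine (lintegral_mono_set sub).trans (le_of_eq ?_)
  have hm1 : MeasurableSet (Metric.closedBall x δ) := Metric.isClosed_closedBall.measurableSet
  have hm2 : MeasurableSet (Metric.closedBall (0 : EE d) δ) :=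
    Metric.isClosed_closedBall.measurableSet
  rw [← lintegral_indicator hm1, ← lintegral_indicator hm2,
    ← lintegral_add_left_eq_self _ x]
  congr 1; ext ζ
  simp only [Set.indicator, mem_closedBall_iff_norm, add_sub_cancel_left, sub_zero]
  rw [enorm_sub_rev]

lemma enorm_le_sq (a : ℝ) {s : ℝ} (hs : 0 < s) :
    ‖a‖ₑ ≤ ENNReal.ofReal s + ENNReal.ofReal s⁻¹ * ENNReal.ofReal (a ^ 2) := by
  rw [Real.enorm_eq_ofReal_abs, ← ENNReal.ofReal_mul (by positivity),
    ← ENNReal.ofReal_add (by positivity) (by positivity)]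
  refine ENNReal.ofReal_le_ofReal ?_
  rw [← sq_abs a]
  have h0 := abs_nonneg a
  rw [← sub_nonneg]
  have : s + s⁻¹ * |a| ^ 2 - |a| = s⁻¹ * ((s - |a| / 2) ^ 2 + 3 / 4 * |a| ^ 2) := by
    field_simp; ring
  rw [this]; positivity

lemma step_tonelli {u : EE d → ℝ} (hm0 : Measurable u) {δ R h C s : ℝ} (hδ : 0 < δ) (hR : 0 ≤ R)
    (hh : 0 < h) (hC : 0 ≤ C) (hs : 0 < s)
    (hE : ∫⁻ ζ in Metric.closedBall (0 : EE d) h, GG u ζ ≤ ENNReal.ofReal (C * h ^ (d + 2))) :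
    ∫⁻ x in Metric.closedBall (0 : EE d) R, ENNReal.ofReal (δ ^ d)⁻¹ *
      ∫⁻ ζ in Metric.closedBall (0 : EE d) δ, (ENNReal.ofReal s +
          ENNReal.ofReal s⁻¹ * ENNReal.ofReal ((u (x + ζ) - u x) ^ 2)) ≤
      ENNReal.ofReal (2 ^ d * (s * (2 * R) ^ d + 4 * C * (δ + h) ^ 2 / s)) := by
  set U := Metric.closedBall (0 : EE d) R with hU
  set B := Metric.closedBall (0 : EE d) δ with hB
  have hvU : volume U = ENNReal.ofReal ((2 * R) ^ d) := by
    rw [hU, Real.volume_pi_closedBall _ hR]; simp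
  have hvB : volume B = ENNReal.ofReal ((2 * δ) ^ d) := by
    rw [hB, Real.volume_pi_closedBall _ hδ.le]; simp
  have hsw0 : Measurable (fun p : EE d × EE d => ENNReal.ofReal ((u (p.1 + p.2) - u p.1) ^ 2)) := by
    have h1 : Measurable (fun p : EE d × EE d => u (p.1 + p.2)) :=
      hm0.comp (measurable_fst.add measurable_snd)
    exact ((h1.sub (hm0.comp measurable_fst)).pow_const 2).ennreal_ofReal
  have hsw : Measurable (fun p : EE d × EE d => ENNReal.ofReal s + ENNReal.ofReal s⁻¹ *
      ENNReal.ofReal ((u (p.1 + p.2) - u p.1) ^ 2)) :=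
    measurable_const.add (measurable_const.mul hsw0)
  have hsw2 : Measurable (fun x => ∫⁻ ζ in B, (ENNReal.ofReal s +
          ENNReal.ofReal s⁻¹ * ENNReal.ofReal ((u (x + ζ) - u x) ^ 2))) :=
    hsw.lintegral_prod_right'
  have hsw3 : ∫⁻ x in U, ∫⁻ ζ in B, (ENNReal.ofReal s +
          ENNReal.ofReal s⁻¹ * ENNReal.ofReal ((u (x + ζ) - u x) ^ 2)) =
        ∫⁻ ζ in B, ∫⁻ x in U, (ENNReal.ofReal s +
          ENNReal.ofReal s⁻¹ * ENNReal.ofReal ((u (x + ζ) - u x) ^ 2)) :=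
    lintegral_lintegral_swap hsw.aemeasurable
  rw [lintegral_const_mul _ hsw2, hsw3]
  have hb : ∫⁻ ζ in B, ∫⁻ x in U, (ENNReal.ofReal s +
          ENNReal.ofReal s⁻¹ * ENNReal.ofReal ((u (x + ζ) - u x) ^ 2)) ≤
       ∫⁻ ζ in B, ENNReal.ofReal (s * (2 * R) ^ d + s⁻¹ * (4 * C * (δ + h) ^ 2)) := by
    refine setLIntegral_mono measurable_const fun ζ hζ => ?_
    have hz : ‖ζ‖ ≤ δ := by rwa [hB, mem_closedBall_zero_iff] at hζ
    have mz : Measurable fun x => ENNReal.ofReal ((u (x + ζ) - u x) ^ 2) := by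
      have h1 : Measurable (fun x : EE d => u (x + ζ)) := hm0.comp (measurable_id.add_const ζ)
      exact ((h1.sub hm0).pow_const 2).ennreal_ofReal
    rw [lintegral_add_left measurable_const, lintegral_const_mul _ mz, setLIntegral_const, hvU,
      ENNReal.ofReal_add (by positivity) (by positivity), ENNReal.ofReal_mul hs.le,
      ENNReal.ofReal_mul (p := s⁻¹) (by positivity)]
    gcongr
    refine (setLIntegral_le_lintegral _ _).trans ((GG_bound hm0 hh hC hE ζ).trans ?_)
    refine ENNReal.ofReal_le_ofReal ?_
    gcongr
  refine (mul_le_mul' le_rfl hb).trans (le_of_eq ?_)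
  rw [setLIntegral_const, hvB, ← ENNReal.ofReal_mul (by positivity),
    ← ENNReal.ofReal_mul (by positivity)]
  congr 1
  rw [mul_pow 2 δ]
  field_simp

lemma step_err (u : L1E d) {δ R h C s : ℝ} (hδ : 0 < δ) (hR : 0 ≤ R) {m : ℕ}
    (hm : R / δ + 1 ≤ m) (hh : 0 < h) (hC : 0 ≤ C) (hs : 0 < s)
    (hE : ∫⁻ ζ in Metric.closedBall (0 : EE d) h, GG u ζ ≤ ENNReal.ofReal (C * h ^ (d + 2))) :
    ‖u - stepL δ R m (avgs δ m u)‖ ≤ 2 ^ d * (s * (2 * R) ^ d + 4 * C * (δ + h) ^ 2 / s) +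
      ∫ x in (Metric.closedBall (0 : EE d) R)ᶜ, |u x| := by
  set U := Metric.closedBall (0 : EE d) R with hU
  set B := Metric.closedBall (0 : EE d) δ with hB
  have hUm : MeasurableSet U := Metric.isClosed_closedBall.measurableSet
  set P := stepL δ R m (avgs δ m u) with hP
  have hm0 := L1E.meas u
  have hi : Integrable (fun x => |u x - P x|) := ((L1E.int u).sub (L1E.int P)).abs
  rw [L1E.norm_sub, ← integral_add_compl hUm hi]
  have hae := stepL_ae δ R m (avgs δ m u)
  refine add_le_add ?_ (le_of_eq ?_)
  · rw [integral_eq_lintegral_of_nonneg_ae (Eventually.of_forall fun x => abs_nonneg _)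
      hi.integrableOn.aestronglyMeasurable]
    refine ENNReal.toReal_le_of_le_ofReal (by positivity) ?_
    calc ∫⁻ x in U, ENNReal.ofReal |u x - P x|
        ≤ ∫⁻ x in U, ENNReal.ofReal (δ ^ d)⁻¹ * ∫⁻ ζ in B, (ENNReal.ofReal s +
          ENNReal.ofReal s⁻¹ * ENNReal.ofReal ((u (x + ζ) - u x) ^ 2)) := by
          refine lintegral_mono_ae ?_
          filter_upwards [ae_restrict_of_ae hae, ae_restrict_mem hUm] with x hx hxU
          have hxn : ‖x‖ ≤ R := by rwa [hU, mem_closedBall_zero_iff] at hxU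
          set c : cells d m := ⟨_, mem_cells hδ hm hxn⟩ with hc
          have hxc : x ∈ cell δ c.1 := fun i => rfl
          rw [hx.1 c ⟨hxc, hxU⟩, ← Real.enorm_eq_ofReal_abs]
          refine (avg_err (L1E.int u) hδ hxc).trans ?_
          gcongr with ζ
          exact enorm_le_sq _ hs
      _ ≤ _ := step_tonelli hm0 hδ hR hh hC hs hE
  · refine setIntegral_congr_ae hUm.compl ?_
    filter_upwards [hae] with x hx hxU
    rw [hP, hx.2 hxU, sub_zero]

lemma compact_crit (u : ℕ → L1E d) (h : ℕ → ℝ) (hpos : ∀ n, 0 < h n)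
    (hlim : Tendsto h atTop (nhds 0)) {C : ℝ} (hC : 0 ≤ C)
    (hE : ∀ᶠ n in atTop, ∫⁻ ζ in Metric.closedBall (0 : EE d) (h n), GG (u n) ζ ≤
      ENNReal.ofReal (C * h n ^ (d + 2)))
    (hT : ∀ e > 0, ∃ R, 0 ≤ R ∧ ∀ᶠ n in atTop,
      ∫ x in (Metric.closedBall (0 : EE d) R)ᶜ, |u n x| ≤ e)
    {B : ℝ} (hB : ∀ᶠ n in atTop, ‖u n‖ ≤ B) {e : ℝ} (he : 0 < e) :
    ∃ K : Set (L1E d), TotallyBounded K ∧ ∀ᶠ n in atTop, ∃ k ∈ K, ‖u n - k‖ ≤ e := by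
  obtain ⟨R, hR, hT⟩ := hT (e / 3) (by positivity)
  obtain ⟨s, hs, hs1⟩ : ∃ s > 0, 2 ^ d * (s * (2 * R) ^ d) ≤ e / 3 := by
    refine ⟨e / 3 / (2 ^ d * (2 * R) ^ d + 1), by positivity, ?_⟩
    have : 2 ^ d * (e / 3 / (2 ^ d * (2 * R) ^ d + 1) * (2 * R) ^ d) =
      e / 3 * ((2 ^ d * (2 * R) ^ d) / (2 ^ d * (2 * R) ^ d + 1)) := by field_simp
    rw [this]
    refine mul_le_of_le_one_right (by positivity) ?_
    rw [div_le_one (by positivity)]; linarith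
  obtain ⟨δ, hδ, hδ1⟩ : ∃ δ > 0, 2 ^ d * (4 * C * (δ + δ) ^ 2 / s) ≤ e / 3 := by
    have ht : Tendsto (fun δ : ℝ => 2 ^ d * (4 * C * (δ + δ) ^ 2 / s)) (nhdsWithin 0 (Set.Ioi 0))
        (nhds (2 ^ d * (4 * C * (0 + 0) ^ 2 / s))) := by
      refine (Continuous.tendsto ?_ 0).mono_left nhdsWithin_le_nhds
      fun_prop
    have h0 : 2 ^ d * (4 * C * (0 + 0) ^ 2 / s) < e / 3 := by simp; positivity
    obtain ⟨δ, h1, h2⟩ := ((ht.eventually (eventually_lt_nhds h0)).and self_mem_nhdsWithin).exists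
    exact ⟨δ, h2, h1.le⟩
  obtain ⟨m, hm⟩ := exists_nat_ge (R / δ + 1)
  refine ⟨stepL δ R m '' Metric.closedBall 0 ((δ ^ d)⁻¹ * |B|),
    ((isCompact_closedBall _ _).image (stepL_cont δ R m)).totallyBounded, ?_⟩
  filter_upwards [hE, hT, hB, hlim.eventually (eventually_le_nhds hδ)] with n a1 a2 a3 a4
  refine ⟨_, ⟨avgs δ m (u n), ?_, rfl⟩, ?_⟩
  · rw [mem_closedBall_zero_iff, pi_norm_le_iff_of_nonneg (by positivity)]
    intro c
    rw [avgs, norm_mul, Real.norm_of_nonneg (by positivity)]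
    gcongr
    refine (norm_integral_le_integral_norm _).trans ?_
    refine (setIntegral_le_integral (L1E.int (u n)).norm
      (Eventually.of_forall fun x => norm_nonneg _)).trans ?_
    rw [← L1.norm_eq_integral_norm]
    exact a3.trans (le_abs_self B)
  · refine (step_err (u n) hδ hR hm (hpos n) hC hs a1).trans ?_
    have : 2 ^ d * (4 * C * (δ + h n) ^ 2 / s) ≤ 2 ^ d * (4 * C * (δ + δ) ^ 2 / s) := by
      have := hpos n
      gcongr
    rw [mul_add]
    linarith

end Compact

section Tools
variable {d : ℕ}

/-- Generalised dominated convergence for superposition operators. -/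
lemma nemytskii {U : ℕ → L1E d} {u : L1E d} (hU : Tendsto U atTop (nhds u))
    {G : ℕ → EE d → ℝ → ℝ} {g : EE d → ℝ → ℝ} {K : ℝ} (hK : 0 ≤ K)
    (hb : ∀ k x r, |G k x r| ≤ K * |r|)
    (hm : ∀ k, AEStronglyMeasurable (fun x => G k x (U k x)) volume)
    (hg : ∀ x r, Tendsto (fun p : ℕ × ℝ => G p.1 x p.2) (atTop ×ˢ nhds r) (nhds (g x r))) :
    Tendsto (fun k => ∫ x, G k x (U k x)) atTop (nhds (∫ x, g x (u x))) := by
  refine tendsto_of_subseq_tendsto fun ns hns => ?_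
  obtain ⟨ms, hms, hae⟩ := (tendstoInMeasure_of_tendsto_Lp (hU.comp hns)).exists_seq_tendsto_ae
  refine ⟨ms, ?_⟩
  have hnm : Tendsto (fun k => ns (ms k)) atTop atTop := hns.comp hms.tendsto_atTop
  set V : ℕ → L1E d := fun k => U (ns (ms k)) with hV
  set F : ℕ → EE d → ℝ := fun k x => G (ns (ms k)) x (V k x) with hF
  have hFm : ∀ k, AEStronglyMeasurable (F k) volume := fun k => hm _
  have hFb : ∀ k x, |F k x| ≤ K * |V k x| := fun k x => hb _ _ _
  have hFi : ∀ k, Integrable (F k) := fun k =>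
    ((L1E.int (V k)).abs.const_mul K).mono' (hFm k) (Eventually.of_forall (hFb k))
  have hFl : ∀ᵐ x, Tendsto (fun k => F k x) atTop (nhds (g x (u x))) := by
    filter_upwards [hae] with x hx
    exact (hg x (u x)).comp (hnm.prodMk hx)
  have hVu : Tendsto (fun k => ∫ x, |V k x - u x|) atTop (nhds 0) := by
    have := tendsto_iff_norm_sub_tendsto_zero.1 (hU.comp hnm)
    refine this.congr fun k => ?_
    rw [L1E.norm_sub]; rfl
  -- the clipped functions
  set c : ℕ → EE d → ℝ := fun k x => max (-(K * |u x|)) (min (K * |u x|) (F k x)) with hc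
  have um : AEStronglyMeasurable (fun x => K * |u x|) volume :=
    ((L1E.int u).abs.const_mul K).aestronglyMeasurable
  have hcm : ∀ k, AEStronglyMeasurable (c k) volume := fun k => um.neg.sup (um.inf (hFm k))
  have hcb : ∀ k x, ‖c k x‖ ≤ K * |u x| := fun k x => by
    have : 0 ≤ K * |u x| := by positivity
    rw [Real.norm_eq_abs, abs_le]
    exact ⟨le_max_left _ _, max_le (by linarith) (min_le_left _ _)⟩
  have hci : ∀ k, Integrable (c k) := fun k =>
    ((L1E.int u).abs.const_mul K).mono' (hcm k) (Eventually.of_forall (hcb k))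
  have hcl : Tendsto (fun k => ∫ x, c k x) atTop (nhds (∫ x, g x (u x))) := by
    refine tendsto_integral_of_dominated_convergence (fun x => K * |u x|) hcm
      ((L1E.int u).abs.const_mul K) (fun k => Eventually.of_forall (hcb k)) ?_
    filter_upwards [hFl, hae] with x hx hx2
    have hlim : |g x (u x)| ≤ K * |u x| := by
      refine le_of_tendsto_of_tendsto hx.abs (hx2.abs.const_mul K) (Eventually.of_forall fun k => ?_)
      exact hFb k x
    have e : g x (u x) = max (-(K * |u x|)) (min (K * |u x|) (g x (u x))) := by
      rw [abs_le] at hlim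
      rw [min_eq_right hlim.2, max_eq_right hlim.1]
    rw [e]
    exact tendsto_const_nhds.max (tendsto_const_nhds.min hx)
  have hdiff : Tendsto (fun k => (∫ x, F k x) - ∫ x, c k x) atTop (nhds 0) := by
    rw [tendsto_zero_iff_norm_tendsto_zero]
    have h0 : Tendsto (fun k => K * ∫ x, |V k x - u x|) atTop (nhds 0) := by
      simpa using hVu.const_mul K
    refine squeeze_zero (fun k => norm_nonneg _) (fun k => ?_) h0
    rw [← integral_sub (hFi k) (hci k), ← integral_const_mul]
    have hI : Integrable (fun x => K * |V k x - u x|) :=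
      (((L1E.int (V k)).sub (L1E.int u)).abs).const_mul K
    refine (norm_integral_le_integral_norm _).trans (integral_mono ((hFi k).sub (hci k)).norm hI
      fun x => ?_)
    have h1 := abs_le.1 (hFb k x)
    have h2 : K * |V k x| ≤ K * |u x| + K * |V k x - u x| := by
      rw [← mul_add]
      refine mul_le_mul_of_nonneg_left ?_ hK
      calc |V k x| = |u x + (V k x - u x)| := by ring_nf
        _ ≤ _ := abs_add_le _ _
    have h3 : 0 ≤ K * |V k x - u x| := by positivity
    have h4 : 0 ≤ K * |u x| := by positivity
    simp only [hc, Real.norm_eq_abs]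
    rw [abs_le]
    rcases le_total (F k x) (K * |u x|) with a1 | a1
    · rw [min_eq_right a1]
      rcases le_total (-(K * |u x|)) (F k x) with a2 | a2
      · rw [max_eq_right a2]; constructor <;> linarith
      · rw [max_eq_left a2]; constructor <;> linarith
    · rw [min_eq_left a1, max_eq_right (by linarith)]; constructor <;> linarith
  have := hdiff.add hcl
  simpa using this

/-- smooth compactly supported test functions -/
def TF (φ : EE d → ℝ) : Prop := ContDiff ℝ (⊤ : ℕ∞) φ ∧ HasCompactSupport φ

lemma pd_contDiff {φ : EE d → ℝ} (h : ContDiff ℝ (⊤ : ℕ∞) φ) (i : Fin d) :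
    ContDiff ℝ (⊤ : ℕ∞) (pd i φ) := by
  have : ContDiff ℝ (⊤ : ℕ∞) (fderiv ℝ φ) := h.fderiv_right (by simp)
  exact this.clm_apply contDiff_const

lemma TF.pd {φ : EE d → ℝ} (h : TF φ) (i : Fin d) : TF (pd i φ) :=
  ⟨pd_contDiff h.1 i, h.2.fderiv_apply ℝ _⟩

lemma TF.bdd {φ : EE d → ℝ} (h : TF φ) : ∃ C, 0 ≤ C ∧ ∀ x, |φ x| ≤ C := by
  obtain ⟨C, hC⟩ := h.2.exists_bound_of_continuous h.1.continuous
  exact ⟨C, (norm_nonneg _).trans (hC 0), hC⟩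

lemma TF.integrable {φ : EE d → ℝ} (h : TF φ) : Integrable φ :=
  h.1.continuous.integrable_of_hasCompactSupport h.2

lemma TF.meas {φ : EE d → ℝ} (h : TF φ) : Measurable φ := h.1.continuous.measurable

/-- bound for the first and second derivatives -/
def DB (φ : EE d → ℝ) (D : ℝ) : Prop := (∀ i x, |pd i φ x| ≤ D) ∧ ∀ i j x, |pd2 i j φ x| ≤ D

lemma TF.db {φ : EE d → ℝ} (h : TF φ) : ∃ D, 0 ≤ D ∧ DB φ D := by
  choose A hA0 hA using fun i => (h.pd i).bdd
  choose B hB0 hB using fun i j => ((h.pd j).pd i).bdd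
  have h1 : 0 ≤ ∑ i, A i := Finset.sum_nonneg fun i _ => hA0 i
  have h2 : 0 ≤ ∑ i, ∑ j, B i j := Finset.sum_nonneg fun i _ => Finset.sum_nonneg fun j _ => hB0 i j
  refine ⟨(∑ i, A i) + ∑ i, ∑ j, B i j, by positivity, fun i x => ?_, fun i j x => ?_⟩
  · have := Finset.single_le_sum (f := A) (fun i _ => hA0 i) (Finset.mem_univ i)
    linarith [hA i x]
  · have e1 := Finset.single_le_sum (f := fun j => B i j) (fun j _ => hB0 i j) (Finset.mem_univ j)
    have e2 := Finset.single_le_sum (f := fun i => ∑ j, B i j)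
      (fun i _ => Finset.sum_nonneg fun j _ => hB0 i j) (Finset.mem_univ i)
    have := hB i j x
    simp only [pd2]
    linarith

lemma pd_comp_smul {φ : EE d → ℝ} (h : Differentiable ℝ φ) (i : Fin d) (c : ℝ) (x : EE d) :
    pd i (fun y => φ (c • y)) x = c * pd i φ (c • x) := by
  have h1 : HasFDerivAt (fun y : EE d => c • y) (c • ContinuousLinearMap.id ℝ (EE d)) x :=
    (hasFDerivAt_id x).const_smul c
  have h2 := (h (c • x)).hasFDerivAt.comp x h1
  have h3 : HasFDerivAt (fun y => φ (c • y)) _ x := h2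
  rw [pd, h3.fderiv, pd]
  simp

/-- cutoff functions -/
lemma cutoff (d : ℕ) : ∃ c : ℝ, 0 ≤ c ∧ ∀ R : ℝ, 1 ≤ R → ∃ φ : EE d → ℝ, TF φ ∧ (∀ x, 0 ≤ φ x) ∧
    (∀ x, φ x ≤ 1) ∧ (∀ x, ‖x‖ ≤ R → φ x = 1) ∧ (∀ x, 2 * R ≤ ‖x‖ → φ x = 0) ∧ DB φ (c / R) := by
  let χ : ContDiffBump (0 : EE d) := ⟨1, 2, by norm_num, by norm_num⟩
  have hχ : TF (χ : EE d → ℝ) := ⟨χ.contDiff, χ.hasCompactSupport⟩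
  obtain ⟨c, hc, hD⟩ := hχ.db
  refine ⟨c, hc, fun R hR => ?_⟩
  have hR0 : 0 < R := by linarith
  have hRi : R⁻¹ ≤ 1 := inv_le_one_of_one_le₀ hR
  have hn : ∀ x : EE d, ‖R⁻¹ • x‖ = ‖x‖ / R := fun x => by
    rw [norm_smul, Real.norm_of_nonneg (by positivity)]; ring
  have hdf : Differentiable ℝ (χ : EE d → ℝ) := hχ.1.differentiable (by simp)
  have e1 : ∀ i, pd i (fun x : EE d => χ (R⁻¹ • x)) = fun x => R⁻¹ * pd i χ (R⁻¹ • x) :=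
    fun i => funext fun x => pd_comp_smul hdf i _ x
  refine ⟨fun x => χ (R⁻¹ • x), ⟨?_, ?_⟩, fun x => χ.nonneg, fun x => χ.le_one, fun x hx => ?_,
    fun x hx => ?_, fun i x => ?_, fun i j x => ?_⟩
  · exact hχ.1.comp (contDiff_const_smul _)
  · exact hχ.2.comp_smul (inv_ne_zero hR0.ne')
  · refine χ.one_of_mem_closedBall ?_
    rw [mem_closedBall_zero_iff, hn]
    exact (div_le_one hR0).2 hx
  · refine χ.zero_of_le_dist ?_
    rw [dist_zero_right, hn, le_div_iff₀ hR0]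
    exact hx
  · rw [e1, abs_mul, abs_of_pos (by positivity), div_eq_inv_mul]
    exact mul_le_mul_of_nonneg_left (hD.1 _ _) (by positivity)
  · rw [pd2, e1]
    have e2 : pd i (fun x => R⁻¹ * pd j χ (R⁻¹ • x)) x = R⁻¹ * (R⁻¹ * pd2 i j χ (R⁻¹ • x)) := by
      have hd2 : Differentiable ℝ (pd j χ) := (pd_contDiff hχ.1 j).differentiable (by simp)
      have := pd_comp_smul hd2 i R⁻¹ x
      rw [pd2, ← this, pd, fderiv_const_mul]
      · rfl
      · exact (hd2.comp (differentiable_id.const_smul R⁻¹)) x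
    rw [e2, abs_mul, abs_mul, abs_of_pos (show 0 < R⁻¹ by positivity), div_eq_inv_mul]
    refine mul_le_mul_of_nonneg_left ?_ (by positivity)
    calc R⁻¹ * |pd2 i j χ (R⁻¹ • x)| ≤ 1 * |pd2 i j χ (R⁻¹ • x)| := by gcongr
      _ ≤ c := by rw [one_mul]; exact hD.2 _ _ _

end Tools

section Approx
variable {d : ℕ}

/-- the limiting operator acting on test functions -/
noncomputable def Lop (a : Fin d → Fin d → EE d → ℝ → ℝ) (b : Fin d → EE d → ℝ → ℝ)
    (φ : EE d → ℝ) (x : EE d) (r : ℝ) : ℝ :=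
  (∑ i, ∑ j, a i j x r * r * pd2 i j φ x) + r * ∑ i, b i x r * pd i φ x

/-- the energy -/
noncomputable def EN (h : ℝ) (u : EE d → ℝ) : ENNReal :=
  ∫⁻ ζ in Metric.closedBall (0 : EE d) h, GG u ζ

/-- consistent family of jump kernels -/
structure ApproxFam (a : Fin d → Fin d → EE d → ℝ → ℝ) (b : Fin d → EE d → ℝ → ℝ)
    (Φ : ℕ → EE d → EE d → ℝ → ℝ) (q : ℕ → EE d → ℝ) (h : ℕ → ℝ) (C κ : ℝ) : Prop where
  jk : ∀ n, JumpK (Φ n) (q n)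
  hpos : ∀ n, 0 < h n
  hlim : Tendsto h atTop (nhds 0)
  Cnn : 0 ≤ C
  κpos : 0 < κ
  energy : ∀ n (u : EE d → ℝ), Integrable u → Measurable u → (∃ M, ∀ x, |u x| ≤ M) →
    κ * (h n ^ (d + 2))⁻¹ * (EN (h n) u).toReal + ∫ x, JL (Φ n) u x (u x) ≤ C * ∫ x, u x ^ 2
  bound : ∀ φ : EE d → ℝ, TF φ → ∃ L : ℕ → ℝ, Tendsto L atTop (nhds 0) ∧
    ∀ D, DB φ D → ∀ n x r, |JL (Φ n) φ x r| ≤ (C * D + L n) * |r|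
  cons : ∀ φ : EE d → ℝ, TF φ → ∀ x r,
    Tendsto (fun p : ℕ × ℝ => JL (Φ p.1) φ x p.2) (atTop ×ˢ nhds r) (nhds (Lop a b φ x r))

lemma GG_congr {u v : EE d → ℝ} (huv : u =ᵐ[volume] v) (η : EE d) : GG u η = GG v η := by
  refine lintegral_congr_ae ?_
  have := (measurePreserving_add_right volume η).quasiMeasurePreserving.ae huv
  filter_upwards [huv, this] with x h1 h2
  rw [h1, h2]

lemma EN_congr {u v : EE d → ℝ} (huv : u =ᵐ[volume] v) (h : ℝ) : EN h u = EN h v := by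
  simp only [EN, GG_congr huv]

lemma int_sq {u : EE d → ℝ} (hu : Integrable u) {M : ℝ} (hM : ∀ x, |u x| ≤ M) :
    Integrable (fun x => u x ^ 2) := by
  have := hu.mul_bdd hu.aestronglyMeasurable (Eventually.of_forall hM)
  simpa [sq] using this

lemma GG_le {u : EE d → ℝ} (hu : Integrable u) (hm : Measurable u) {M : ℝ} (hM : ∀ x, |u x| ≤ M)
    (η : EE d) : GG u η ≤ ENNReal.ofReal (4 * ∫ x, u x ^ 2) := by
  have hs := int_sq hu hM
  have hs2 : Integrable (fun x => u (x + η) ^ 2) := hs.comp_add_right η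
  have e : ∫ x, u (x + η) ^ 2 = ∫ x, u x ^ 2 := integral_add_right_eq_self (fun x => u x ^ 2) η
  have hI : Integrable (fun x => 2 * u (x + η) ^ 2 + 2 * u x ^ 2) :=
    (hs2.const_mul 2).add (hs.const_mul 2)
  have e2 : 4 * ∫ x, u x ^ 2 = ∫ x, (2 * u (x + η) ^ 2 + 2 * u x ^ 2) := by
    rw [integral_add (hs2.const_mul 2) (hs.const_mul 2), integral_const_mul, integral_const_mul, e]
    ring
  rw [e2, ofReal_integral_eq_lintegral_ofReal hI (Eventually.of_forall fun x => by positivity)]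
  refine lintegral_mono fun x => ENNReal.ofReal_le_ofReal ?_
  nlinarith [sq_nonneg (u (x + η) + u x)]

lemma EN_fin {u : EE d → ℝ} (hu : Integrable u) (hm : Measurable u) {M : ℝ}
    (hM : ∀ x, |u x| ≤ M) (h : ℝ) : EN h u ≠ ⊤ := by
  refine ne_top_of_le_ne_top ?_ (lintegral_mono fun ζ => GG_le hu hm hM ζ)
  rw [lintegral_const, Measure.restrict_apply_univ]
  exact ENNReal.mul_ne_top ENNReal.ofReal_ne_top measure_closedBall_lt_top.ne

/-- basic identities for the solution of the resolvent equation -/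
lemma sol_weak {Φ : EE d → EE d → ℝ → ℝ} {q : EE d → ℝ} (h : JumpK Φ q) {v f : EE d → ℝ} {l : ℝ}
    (hv : Integrable v) (hm : Measurable v) (hf : Integrable f)
    (he : ∀ᵐ x, v x = f x + l * JB Φ v x)
    {φ : EE d → ℝ} (hφ : Measurable φ) {M : ℝ} (hM : ∀ x, |φ x| ≤ M) :
    (∫ x, v x * φ x) - ∫ x, f x * φ x = l * ∫ x, JL Φ φ x (v x) := by
  have i1 : Integrable (fun x => v x * φ x) :=
    hv.mul_bdd hφ.aestronglyMeasurable (Eventually.of_forall hM)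
  have i2 : Integrable (fun x => f x * φ x) :=
    hf.mul_bdd hφ.aestronglyMeasurable (Eventually.of_forall hM)
  rw [← JB_weak h hv hm hφ hM, ← integral_sub i1 i2, ← integral_const_mul]
  refine integral_congr_ae ?_
  filter_upwards [he] with x hx
  have : JB Φ v x * l = v x - f x := by linarith
  linear_combination (-φ x) * this

lemma sol_L1 {Φ : EE d → EE d → ℝ → ℝ} {q : EE d → ℝ} (h : JumpK Φ q) {v f : EE d → ℝ} {l : ℝ}
    (hl : 0 < l) (hv : Integrable v) (hm : Measurable v) (hf : Integrable f)
    (he : ∀ᵐ x, v x = f x + l * JB Φ v x) : ∫ x, |v x| ≤ ∫ x, |f x| := by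
  have := kato_weight h hv hm hf hl he (φ := fun _ => 0) measurable_const (fun _ => le_rfl)
    (fun _ => zero_le_one)
  simpa [JL] using this

lemma sol_energy {Φ : EE d → EE d → ℝ → ℝ} {q : EE d → ℝ} (h : JumpK Φ q) {v f : EE d → ℝ} {l : ℝ}
    (hl : 0 < l) (hv : Integrable v) (hm : Measurable v) {M : ℝ} (hM : ∀ x, |v x| ≤ M)
    (hf : Integrable f) {Mf : ℝ} (hMf : ∀ x, |f x| ≤ Mf)
    (he : ∀ᵐ x, v x = f x + l * JB Φ v x) {E C : ℝ} (hE0 : 0 ≤ E) (hlC : l * C ≤ 1 / 4)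
    (hC : 0 ≤ C) (hE : E + ∫ x, JL Φ v x (v x) ≤ C * ∫ x, v x ^ 2) :
    l * E ≤ (∫ x, f x ^ 2) / 2 ∧ ∫ x, v x ^ 2 ≤ (1 + 4 * l * C) * ∫ x, f x ^ 2 := by
  have w := sol_weak h hv hm hf he hm hM
  have e1 : ∫ x, v x * v x = ∫ x, v x ^ 2 := by congr 1; ext x; ring
  rw [e1] at w
  have sv := int_sq hv hM
  have sf := int_sq hf hMf
  have i2 : Integrable (fun x => f x * v x) :=
    hf.mul_bdd hm.aestronglyMeasurable (Eventually.of_forall hM)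
  have am : ∫ x, f x * v x ≤ (∫ x, f x ^ 2) / 2 + (∫ x, v x ^ 2) / 2 := by
    rw [← integral_div, ← integral_div, ← integral_add (sf.div_const 2) (sv.div_const 2)]
    refine integral_mono i2 ((sf.div_const 2).add (sv.div_const 2)) fun x => ?_
    simp only [Pi.add_apply]
    nlinarith [sq_nonneg (f x - v x)]
  set V := ∫ x, v x ^ 2 with hV
  set F := ∫ x, f x ^ 2 with hF
  have V0 : 0 ≤ V := integral_nonneg fun x => sq_nonneg _
  have F0 : 0 ≤ F := integral_nonneg fun x => sq_nonneg _
  have k1 : l * E + (V - ∫ x, f x * v x) ≤ l * C * V := by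
    rw [w]; nlinarith
  have k0 : l * C * V ≤ 1 / 4 * V := by gcongr
  have lE : 0 ≤ l * E := by positivity
  refine ⟨by linarith, ?_⟩
  have k2 : V ≤ 2 * F := by linarith
  have k3 : l * C * V ≤ l * C * (2 * F) := by gcongr
  nlinarith

end Approx

section Limit
variable {d : ℕ} {a : Fin d → Fin d → EE d → ℝ → ℝ} {b : Fin d → EE d → ℝ → ℝ}
  {Φ : ℕ → EE d → EE d → ℝ → ℝ} {q : ℕ → EE d → ℝ} {h : ℕ → ℝ} {C κ : ℝ}

/-- solution of the resolvent equation -/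
structure IsSol (Φ : EE d → EE d → ℝ → ℝ) (l : ℝ) (f v : EE d → ℝ) : Prop where
  int : Integrable v
  meas : Measurable v
  eq : ∀ᵐ x, v x = f x + l * JB Φ v x

lemma ApproxFam.tight (A : ApproxFam a b Φ q h C κ) {f : EE d → ℝ} (hf : TF f) {e : ℝ}
    (he : 0 < e) : ∃ R, 0 ≤ R ∧ (∀ x, x ∉ Metric.closedBall (0 : EE d) R → f x = 0) ∧
      ∀ᶠ n in atTop, ∀ l v, 0 < l → l ≤ 1 → IsSol (Φ n) l f v →
        ∫ x in (Metric.closedBall (0 : EE d) R)ᶜ, |v x| ≤ e := by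
  obtain ⟨c, hc, hcut⟩ := cutoff d
  have hC := A.Cnn
  set I := ∫ x, |f x| with hI
  have I0 : 0 ≤ I := integral_nonneg fun x => abs_nonneg _
  obtain ⟨R0, hR0⟩ := hf.2.isCompact.isBounded.subset_closedBall (0 : EE d)
  set R := max (max 1 R0) (2 * C * c * I / e) with hR
  have hR1 : 1 ≤ R := (le_max_left _ _).trans (le_max_left _ _)
  have hRR0 : R0 ≤ R := (le_max_right _ _).trans (le_max_left _ _)
  have hRe : C * (c / R) * I ≤ e / 2 := by
    have : 2 * C * c * I / e ≤ R := le_max_right _ _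
    rw [div_le_iff₀ he] at this
    have hRp : 0 < R := by linarith
    rw [show C * (c / R) * I = C * c * I / R by ring, div_le_iff₀ hRp]
    linarith
  have hf0 : ∀ x, R < ‖x‖ → f x = 0 := fun x hx => by
    refine image_eq_zero_of_notMem_tsupport fun hx' => ?_
    have := hR0 hx'
    rw [mem_closedBall_zero_iff] at this
    linarith
  obtain ⟨φ, hφ, p0, p1, pin, pout, hD⟩ := hcut R hR1
  obtain ⟨L, hL, hb⟩ := A.bound φ hφ
  refine ⟨2 * R, by linarith, fun x hx => hf0 x ?_, ?_⟩
  · rw [mem_closedBall_zero_iff] at hx; linarith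
  have hLe : ∀ᶠ n in atTop, L n * I ≤ e / 2 := by
    have h1 : Tendsto (fun n => L n * I) atTop (nhds (0 * I)) := hL.mul_const I
    rw [zero_mul] at h1
    exact h1.eventually (eventually_le_nhds (by positivity))
  filter_upwards [hLe] with n hn l v hl hl1 hv
  have hk := kato_weight (A.jk n) hv.int hv.meas hf.integrable hl hv.eq hφ.meas p0 p1
  have z : ∫ x, |f x| * (1 - φ x) = 0 := by
    rw [← integral_zero (EE d) ℝ]
    congr 1; ext x
    rcases le_or_gt ‖x‖ R with h1 | h1
    · rw [pin x h1]; ring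
    · rw [hf0 x h1]; simp
  have hJ : ∫ x, |JL (Φ n) φ x (v x)| ≤ e := by
    have hvf := sol_L1 (A.jk n) hl hv.int hv.meas hf.integrable hv.eq
    obtain ⟨M, -, hM⟩ := hφ.bdd
    have h1 : ∫ x, |JL (Φ n) φ x (v x)| ≤ ∫ x, (C * (c / R) + L n) * |v x| :=
      integral_mono (JL_int (A.jk n) hv.int hv.meas hφ.meas hM).abs (hv.int.abs.const_mul _)
        fun x => hb _ hD n x _
    rw [integral_const_mul] at h1
    by_cases hs : 0 ≤ C * (c / R) + L n
    · have : (C * (c / R) + L n) * ∫ x, |v x| ≤ (C * (c / R) + L n) * I := by gcongr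
      linarith
    · have : 0 ≤ ∫ x, |v x| := integral_nonneg fun x => abs_nonneg _
      push Not at hs
      nlinarith
  have hJ0 : 0 ≤ ∫ x, |JL (Φ n) φ x (v x)| := integral_nonneg fun x => abs_nonneg _
  have hset : ∫ x in (Metric.closedBall (0 : EE d) (2 * R))ᶜ, |v x| ≤ ∫ x, |v x| * (1 - φ x) := by
    have hms : MeasurableSet (Metric.closedBall (0 : EE d) (2 * R))ᶜ :=
      Metric.isClosed_closedBall.measurableSet.compl
    rw [← integral_indicator hms]
    refine integral_mono (hv.int.abs.indicator hms) ?_ fun x => ?_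
    · refine hv.int.abs.mul_bdd (c := 1) (measurable_const.sub hφ.meas).aestronglyMeasurable
        (Eventually.of_forall fun x => ?_)
      rw [Real.norm_eq_abs, abs_of_nonneg (by linarith [p1 x])]; linarith [p0 x]
    · by_cases hx : x ∈ (Metric.closedBall (0 : EE d) (2 * R))ᶜ
      · rw [Set.indicator_of_mem hx]
        rw [Set.mem_compl_iff, mem_closedBall_zero_iff] at hx
        simp only [pout x (by linarith), sub_zero, mul_one, le_refl]
      · rw [Set.indicator_of_notMem hx]
        exact mul_nonneg (abs_nonneg _) (by linarith [p1 x])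
  calc _ ≤ _ := hset
    _ ≤ l * ∫ x, |JL (Φ n) φ x (v x)| := by linarith
    _ ≤ 1 * ∫ x, |JL (Φ n) φ x (v x)| := by gcongr
    _ ≤ e := by linarith

/-- `L²` closeness -/
lemma ApproxFam.close2 (A : ApproxFam a b Φ q h C κ) {f : EE d → ℝ} (hf : TF f) :
    ∃ K, 0 ≤ K ∧ ∀ᶠ n in atTop, ∀ l v, 0 < l → l * C ≤ 1 / 4 → IsSol (Φ n) l f v →
      (∃ M, ∀ x, |v x| ≤ M) → ∫ x, (v x - f x) ^ 2 ≤ K * l := by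
  have hC := A.Cnn
  obtain ⟨L, hL, hb⟩ := A.bound f hf
  obtain ⟨D, hD0, hD⟩ := hf.db
  obtain ⟨Mf, hMf0, hMf⟩ := hf.bdd
  set I := ∫ x, |f x| with hI
  set F := ∫ x, f x ^ 2 with hF
  have I0 : 0 ≤ I := integral_nonneg fun x => abs_nonneg _
  have F0 : 0 ≤ F := integral_nonneg fun x => sq_nonneg _
  refine ⟨4 * C * F + 2 * ((C * D + 1) * I), by positivity, ?_⟩
  filter_upwards [hL.eventually (eventually_le_nhds zero_lt_one)] with n hn l v hl hlC hv hM
  obtain ⟨M, hM⟩ := hM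
  have hhn := A.hpos n
  have hκ := A.κpos
  have hvf := sol_L1 (A.jk n) hl hv.int hv.meas hf.integrable hv.eq
  have en := (sol_energy (A.jk n) hl hv.int hv.meas hM hf.integrable hMf hv.eq
    (by positivity) hlC hC (A.energy n v hv.int hv.meas ⟨M, hM⟩)).2
  have w := sol_weak (A.jk n) hv.int hv.meas hf.integrable hv.eq hf.meas hMf
  have hJ : |∫ x, JL (Φ n) f x (v x)| ≤ (C * D + 1) * I := by
    refine abs_integral_le_integral_abs.trans ?_
    have h1 : ∫ x, |JL (Φ n) f x (v x)| ≤ ∫ x, (C * D + 1) * |v x| :=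
      integral_mono (JL_int (A.jk n) hv.int hv.meas hf.meas hMf).abs (hv.int.abs.const_mul _)
        fun x => (hb _ hD n x _).trans (by gcongr)
    rw [integral_const_mul] at h1
    refine h1.trans ?_
    gcongr
  have e2 : ∫ x, f x * f x = F := by rw [hF]; congr 1; ext x; ring
  have i2 : Integrable (fun x => v x * f x) :=
    hv.int.mul_bdd hf.meas.aestronglyMeasurable (Eventually.of_forall hMf)
  have sv := int_sq hv.int hM
  have sf := int_sq hf.integrable hMf
  have e3 : ∫ x, (v x - f x) ^ 2 = (∫ x, v x ^ 2) - 2 * (∫ x, v x * f x) + F := by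
    have i3 : Integrable (fun x => v x ^ 2 - 2 * (v x * f x)) := sv.sub (i2.const_mul 2)
    rw [hF, ← integral_const_mul, ← integral_sub sv (i2.const_mul 2), ← integral_add i3 sf]
    congr 1; ext x; ring
  rw [e3]
  rw [e2] at w
  have h5 := (abs_le.1 hJ).1
  have h6 : l * (-((C * D + 1) * I)) ≤ l * ∫ x, JL (Φ n) f x (v x) := by gcongr
  nlinarith

lemma ApproxFam.close1 (A : ApproxFam a b Φ q h C κ) {f : EE d → ℝ} (hf : TF f) {e : ℝ}
    (he : 0 < e) : ∃ δ > 0, ∀ᶠ n in atTop, ∀ l v, 0 < l → l ≤ δ → l ≤ 1 → l * C ≤ 1 / 4 →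
      IsSol (Φ n) l f v → (∃ M, ∀ x, |v x| ≤ M) → ∫ x, |v x - f x| ≤ e := by
  obtain ⟨R, hR, hfR, hT⟩ := A.tight hf (show 0 < e / 3 by positivity)
  obtain ⟨K, hK, hcl⟩ := A.close2 hf
  set U := Metric.closedBall (0 : EE d) R with hU
  have hUm : MeasurableSet U := Metric.isClosed_closedBall.measurableSet
  have hUf : volume U ≠ ⊤ := measure_closedBall_lt_top.ne
  set s := e / 3 / (volume.real U + 1) with hs
  have hv0 : 0 ≤ volume.real U := measureReal_nonneg
  have hs0 : 0 < s := by positivity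
  obtain ⟨Mf, hMf0, hMf⟩ := hf.bdd
  refine ⟨e / 3 * s / (K + 1), by positivity, ?_⟩
  filter_upwards [hT, hcl] with n hT hcl l v hl hlδ hl1 hlC hv hM
  have h1 := hT l v hl hl1 hv
  have h2 := hcl l v hl hlC hv hM
  obtain ⟨M, hM⟩ := hM
  have hi : Integrable (fun x => |v x - f x|) := (hv.int.sub hf.integrable).abs
  have his : Integrable (fun x => (v x - f x) ^ 2) :=
    int_sq (u := fun x => v x - f x) (hv.int.sub hf.integrable) (M := M + Mf)
      (fun x => (abs_sub _ _).trans (add_le_add (hM x) (hMf x)))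
  rw [← integral_add_compl hUm hi]
  have e1 : ∫ x in Uᶜ, |v x - f x| = ∫ x in Uᶜ, |v x| :=
    setIntegral_congr_fun hUm.compl fun x hx => by simp only [hfR x hx, sub_zero]
  have e2 : ∫ x in U, |v x - f x| ≤ ∫ x in U, (s + s⁻¹ * (v x - f x) ^ 2) := by
    refine integral_mono hi.integrableOn ?_ fun x => ?_
    · exact (integrableOn_const hUf).add (his.const_mul _).integrableOn
    · simp only
      rw [← sq_abs (v x - f x)]
      rw [← sub_nonneg]
      have : s + s⁻¹ * |v x - f x| ^ 2 - |v x - f x| =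
        s⁻¹ * ((s - |v x - f x| / 2) ^ 2 + 3 / 4 * |v x - f x| ^ 2) := by field_simp; ring
      rw [this]; positivity
  have i0 : Integrable (fun _ : EE d => s) (volume.restrict U) := integrableOn_const hUf
  have e3 : ∫ x in U, (s + s⁻¹ * (v x - f x) ^ 2) ≤ s * volume.real U + s⁻¹ * (K * l) := by
    rw [integral_add i0 (his.const_mul _).integrableOn, setIntegral_const,
      integral_const_mul, smul_eq_mul, mul_comm]
    gcongr
    exact (setIntegral_le_integral his (Eventually.of_forall fun x => sq_nonneg _)).trans h2
  have e4 : s * volume.real U ≤ e / 3 := by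
    rw [hs, div_mul_eq_mul_div, div_le_iff₀ (by positivity)]
    nlinarith
  have e5 : s⁻¹ * (K * l) ≤ e / 3 := by
    rw [inv_mul_le_iff₀ hs0]
    have : (K + 1) * l ≤ e / 3 * s := by
      rwa [le_div_iff₀ (by positivity), mul_comm] at hlδ
    nlinarith
  linarith

theorem ApproxFam.limit (A : ApproxFam a b Φ q h C κ) : ∃ l0 : ℝ, ∃ J : ℝ → L1E d → L1E d,
    ResFam J l0 ∧ ∀ l, 0 < l → l ≤ l0 → ∀ (f : L1E d) (φ : EE d → ℝ), TF φ →
      (∫ x, J l f x * φ x) - ∫ x, f x * φ x = l * ∫ x, Lop a b φ x (J l f x) := by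
  have hC := A.Cnn
  set l0 : ℝ := 1 / (4 * (C + 1)) with hl0
  have hl0p : 0 < l0 := by positivity
  have hl01 : l0 ≤ 1 := by rw [hl0, div_le_one (by positivity)]; linarith
  have hl0C : l0 * C ≤ 1 / 4 := by
    rw [hl0, div_mul_eq_mul_div, div_le_iff₀ (by positivity)]; linarith
  choose Jn hJ1 hJ2 hJ3 using fun n => (A.jk n).exists_resolvent
  set D : Set (L1E d) := {f | ∃ g : EE d → ℝ, f =ᵐ[volume] g ∧ HasCompactSupport g ∧
    ContDiff ℝ (⊤ : ℕ∞) g} with hDd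
  have hD : Dense D := Lp.dense_hasCompactSupport_contDiff (by simp)
  -- representatives
  have rep : ∀ (f : L1E d) (g : EE d → ℝ), f =ᵐ[volume] g → TF g → ∀ n l, 0 < l →
      ∃ v : EE d → ℝ, v =ᵐ[volume] (Jn n l f : EE d → ℝ) ∧ IsSol (Φ n) l g v ∧
        ∃ M, ∀ x, |v x| ≤ M := by
    intro f g hfg hg n l hl
    obtain ⟨M, -, hM⟩ := hg.bdd
    have he : ∀ᵐ x, (Jn n l f : EE d → ℝ) x = g x + l * JB (Φ n) (Jn n l f) x := by
      filter_upwards [hJ1 n l hl f, hfg] with x h1 h2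
      rw [h1, h2]
    obtain ⟨v, h1, h2, h3, h4, h5⟩ := sol_rep (A.jk n) (L1E.int (Jn n l f)) (L1E.meas _) hl he
      (Eventually.of_forall hM)
    exact ⟨v, h1, ⟨h2, h3, h5⟩, h4⟩
  have hcpt : ∀ l, 0 < l → l ≤ l0 → ∀ f ∈ D, ∀ e > 0, ∃ K : Set (L1E d), TotallyBounded K ∧
      ∀ᶠ n in atTop, ∃ k ∈ K, ‖Jn n l f - k‖ ≤ e := by
    rintro l hl hll0 f ⟨g, hfg, hg2, hg1⟩ e he
    have hg : TF g := ⟨hg1, hg2⟩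
    obtain ⟨Mg, -, hMg⟩ := hg.bdd
    have hκ := A.κpos
    have F0 : 0 ≤ ∫ x, g x ^ 2 := integral_nonneg fun x => sq_nonneg _
    have hlC : l * C ≤ 1 / 4 := (mul_le_mul_of_nonneg_right hll0 hC).trans hl0C
    refine compact_crit (fun n => Jn n l f) h A.hpos A.hlim
      (C := (∫ x, g x ^ 2) / (2 * l * κ)) (by positivity) (Eventually.of_forall fun n => ?_)
      (fun e' he' => ?_) (B := ∫ x, |g x|) (Eventually.of_forall fun n => ?_) he
    · obtain ⟨v, hv1, hv, M, hM⟩ := rep f g hfg hg n l hl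
      have hhn := A.hpos n
      have en := (sol_energy (A.jk n) hl hv.int hv.meas hM hg.integrable hMg hv.eq
        (by positivity) hlC hC (A.energy n v hv.int hv.meas ⟨M, hM⟩)).1
      have := EN_congr hv1 (h n)
      change EN (h n) (Jn n l f) ≤ _
      rw [← this, ← ENNReal.ofReal_toReal (EN_fin hv.int hv.meas hM (h n))]
      refine ENNReal.ofReal_le_ofReal ?_
      rw [div_mul_eq_mul_div, le_div_iff₀ (by positivity)]
      have hp : 0 < h n ^ (d + 2) := by positivity
      have e6 : l * (κ * (h n ^ (d + 2))⁻¹ * (EN (h n) v).toReal) * (2 * h n ^ (d + 2)) =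
        (EN (h n) v).toReal * (2 * l * κ) := by field_simp
      rw [← e6]
      nlinarith
    · obtain ⟨R, hR, -, hT⟩ := A.tight hg he'
      refine ⟨R, hR, ?_⟩
      filter_upwards [hT] with n hn
      obtain ⟨v, hv1, hv, M, hM⟩ := rep f g hfg hg n l hl
      have := hn l v hl (hll0.trans hl01) hv
      refine le_trans (le_of_eq ?_) this
      refine integral_congr_ae (ae_restrict_of_ae ?_)
      filter_upwards [hv1] with x hx
      rw [hx]
    · obtain ⟨v, hv1, hv, M, hM⟩ := rep f g hfg hg n l hl
      have := sol_L1 (A.jk n) hl hv.int hv.meas hg.integrable hv.eq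
      rw [L1.norm_eq_integral_norm]
      refine le_trans (le_of_eq ?_) this
      refine integral_congr_ae ?_
      filter_upwards [hv1] with x hx
      rw [hx, Real.norm_eq_abs]
  have htend : ∀ f ∈ D, ∀ e > 0, ∃ δ > 0, ∀ l, 0 < l → l ≤ δ → l ≤ l0 →
      ∀ᶠ n in atTop, ‖Jn n l f - f‖ ≤ e := by
    rintro f ⟨g, hfg, hg2, hg1⟩ e he
    have hg : TF g := ⟨hg1, hg2⟩
    obtain ⟨δ, hδ, hcl⟩ := A.close1 hg he
    refine ⟨δ, hδ, fun l hl hlδ hll0 => ?_⟩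
    filter_upwards [hcl] with n hn
    obtain ⟨v, hv1, hv, hM⟩ := rep f g hfg hg n l hl
    have hlC : l * C ≤ 1 / 4 := (mul_le_mul_of_nonneg_right hll0 hC).trans hl0C
    rw [L1E.norm_sub]
    refine le_trans (le_of_eq ?_) (hn l v hl hlδ (hll0.trans hl01) hlC hv hM)
    refine integral_congr_ae ?_
    filter_upwards [hv1, hfg] with x h1 h2
    rw [h1, h2]
  obtain ⟨J, hJ, hlimJ⟩ := ultra_resolvent (Jn := Jn) hl0p
    (fun n l hl _ f g => hJ2 n l hl f g) (fun n m l hm hml _ f => hJ3 n m l hm hml f) D hD hcpt htend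
  refine ⟨l0, J, hJ, fun l hl hll0 f φ hφ => ?_⟩
  -- subsequence
  have hsub : ∀ k : ℕ, ∃ n, k ≤ n ∧ ‖Jn n l f - J l f‖ ≤ 1 / ((k : ℝ) + 1) := by
    intro k
    have h1 := (tendsto_iff_norm_sub_tendsto_zero.1 (hlimJ l hl hll0 f)).eventually
      (eventually_le_nhds (show (0 : ℝ) < 1 / ((k : ℝ) + 1) by positivity))
    have h2 : ∀ᶠ n in (hyperfilter ℕ : Filter ℕ), k ≤ n :=
      Nat.hyperfilter_le_atTop (eventually_ge_atTop k)
    obtain ⟨n, a1, a2⟩ := (h2.and h1).exists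
    exact ⟨n, a1, a2⟩
  choose ns hns1 hns2 using hsub
  have hns : Tendsto ns atTop atTop := tendsto_atTop_mono hns1 tendsto_id
  have hU : Tendsto (fun k => Jn (ns k) l f) atTop (nhds (J l f)) := by
    rw [tendsto_iff_norm_sub_tendsto_zero]
    exact squeeze_zero (fun k => norm_nonneg _) hns2 tendsto_one_div_add_atTop_nhds_zero_nat
  obtain ⟨M, hM0, hM⟩ := hφ.bdd
  obtain ⟨L, hL, hb⟩ := A.bound φ hφ
  obtain ⟨D1, hD1, hDB⟩ := hφ.db
  obtain ⟨B, hB⟩ := hL.bddAbove_range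
  have r1 : Tendsto (fun k => ∫ x, JL (Φ (ns k)) φ x (Jn (ns k) l f x)) atTop
      (nhds (∫ x, Lop a b φ x (J l f x))) := by
    refine nemytskii hU (G := fun k => JL (Φ (ns k)) φ) (g := Lop a b φ) (K := C * D1 + |B|)
      (by positivity) (fun k x r => (hb _ hDB _ x r).trans ?_) (fun k => ?_) (fun x r => ?_)
    · gcongr
      exact (hB ⟨ns k, rfl⟩).trans (le_abs_self B)
    · exact (JL_int (A.jk _) (L1E.int _) (L1E.meas _) hφ.meas hM).aestronglyMeasurable
    · exact (A.cons φ hφ x r).comp ((hns.comp tendsto_fst).prodMk tendsto_snd)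
  have r2 : Tendsto (fun k => ∫ x, Jn (ns k) l f x * φ x) atTop (nhds (∫ x, J l f x * φ x)) := by
    refine nemytskii hU (G := fun _ x r => r * φ x) (g := fun x r => r * φ x) (K := M)
      hM0 (fun k x r => ?_) (fun k => ?_) (fun x r => ?_)
    · rw [abs_mul, mul_comm]; gcongr; exact hM x
    · exact (L1E.int _).aestronglyMeasurable.mul hφ.meas.aestronglyMeasurable
    · exact (tendsto_snd.mul_const (φ x))
  have r3 : ∀ k, (∫ x, Jn (ns k) l f x * φ x) - ∫ x, f x * φ x =
      l * ∫ x, JL (Φ (ns k)) φ x (Jn (ns k) l f x) := fun k =>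
    sol_weak (A.jk _) (L1E.int _) (L1E.meas _) (L1E.int f) (hJ1 _ l hl f) hφ.meas hM
  exact tendsto_nhds_unique ((r2.sub_const _).congr r3) (r1.const_mul l)

end Limit

section Taylor
variable {d : ℕ}

/-- Taylor estimates with constant `K`. -/
structure TK (φ : EE d → ℝ) (K : ℝ) : Prop where
  nn : 0 ≤ K
  bd : ∀ x, |φ x| ≤ K
  db : DB φ K
  t1 : ∀ x z, |φ (x + z) - φ x| ≤ K * ‖z‖
  t2 : ∀ x z, |φ (x + z) - φ x - ∑ i, z i * pd i φ x| ≤ K * ‖z‖ ^ 2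
  t3 : ∀ x z, |φ (x + z) - φ x - (∑ i, z i * pd i φ x)
    - (1 / 2) * ∑ i, ∑ j, z i * z j * pd2 i j φ x| ≤ K * ‖z‖ ^ 3

lemma fderiv_eq_sum (φ : EE d → ℝ) (x z : EE d) : fderiv ℝ φ x z = ∑ i, z i * pd i φ x := by
  have : z = ∑ i, z i • (Pi.single i (1 : ℝ) : EE d) := by
    ext j; simp [Finset.sum_apply, Pi.single_apply]
  conv_lhs => rw [this]
  simp [map_sum, pd]

lemma line_deriv {φ : EE d → ℝ} (h : TF φ) (x z : EE d) (t : ℝ) :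
    HasDerivAt (fun t : ℝ => φ (x + t • z)) (∑ i, z i * pd i φ (x + t • z)) t := by
  have hd : DifferentiableAt ℝ φ (x + t • z) :=
    (h.1.differentiable (by simp)).differentiableAt
  have hl : HasDerivAt (fun t : ℝ => x + t • z) z t := by
    simpa using ((hasDerivAt_id t).smul_const z).const_add x
  have := hd.hasFDerivAt.comp_hasDerivAt t hl
  rw [fderiv_eq_sum] at this
  exact this

lemma mv01 {g g' : ℝ → ℝ} {C : ℝ} (hg : ∀ t, HasDerivAt g (g' t) t)
    (hb : ∀ t, 0 ≤ t → t ≤ 1 → |g' t| ≤ C) : |g 1 - g 0| ≤ C := by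
  have := norm_image_sub_le_of_norm_deriv_le_segment_01' (f := g) (f' := g') (C := C)
    (fun t _ => (hg t).hasDerivWithinAt) (fun t ht => hb t ht.1 ht.2.le)
  simpa using this

lemma sum_le_dK {f : Fin d → ℝ} {z : EE d} {c : ℝ} (hf : ∀ i, |f i| ≤ c) :
    |∑ i, z i * f i| ≤ d * c * ‖z‖ := by
  calc |∑ i, z i * f i| ≤ ∑ i, |z i * f i| := Finset.abs_sum_le_sum_abs _ _
    _ ≤ ∑ _i : Fin d, ‖z‖ * c := Finset.sum_le_sum fun i _ => by
        rw [abs_mul]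
        exact mul_le_mul (norm_le_pi_norm z i) (hf i) (abs_nonneg _) (norm_nonneg _)
    _ = d * c * ‖z‖ := by simp; ring

lemma tf_t1 {φ : EE d → ℝ} (h : TF φ) : ∃ K, 0 ≤ K ∧ ∀ x z, |φ (x + z) - φ x| ≤ K * ‖z‖ := by
  obtain ⟨D, hD, hDB⟩ := h.db
  refine ⟨d * D, by positivity, fun x z => ?_⟩
  have := mv01 (line_deriv h x z) (C := d * D * ‖z‖)
    (fun t _ _ => sum_le_dK fun i => hDB.1 i _)
  simpa using this

lemma tf_t2 {φ : EE d → ℝ} (h : TF φ) : ∃ K, 0 ≤ K ∧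
    ∀ x z, |φ (x + z) - φ x - ∑ i, z i * pd i φ x| ≤ K * ‖z‖ ^ 2 := by
  choose K hK0 hK using fun i => tf_t1 (h.pd i)
  have hS : 0 ≤ ∑ i, K i := Finset.sum_nonneg fun i _ => hK0 i
  refine ⟨d * ∑ i, K i, by positivity, fun x z => ?_⟩
  have hg : ∀ t, HasDerivAt (fun t : ℝ => φ (x + t • z) - φ x - t * ∑ i, z i * pd i φ x)
      (∑ i, z i * (pd i φ (x + t • z) - pd i φ x)) t := by
    intro t
    have h1 := ((line_deriv h x z t).sub_const (φ x)).sub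
      ((hasDerivAt_id t).mul_const (∑ i, z i * pd i φ x))
    refine HasDerivAt.congr_deriv h1 ?_
    simp [mul_sub, Finset.sum_sub_distrib]
  have := mv01 hg (C := d * ((∑ i, K i) * ‖z‖) * ‖z‖) (fun t h0 h1 => sum_le_dK fun i => by
    refine (hK i x (t • z)).trans ?_
    have : ‖t • z‖ ≤ ‖z‖ := by
      rw [norm_smul, Real.norm_of_nonneg h0]
      nlinarith [norm_nonneg z]
    exact mul_le_mul (Finset.single_le_sum (fun i _ => hK0 i) (Finset.mem_univ i)) this
      (norm_nonneg _) hS)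
  simp at this
  calc _ ≤ _ := this
    _ = _ := by ring

lemma tf_t3 {φ : EE d → ℝ} (h : TF φ) : ∃ K, 0 ≤ K ∧
    ∀ x z, |φ (x + z) - φ x - (∑ i, z i * pd i φ x)
    - (1 / 2) * ∑ i, ∑ j, z i * z j * pd2 i j φ x| ≤ K * ‖z‖ ^ 3 := by
  choose K hK0 hK using fun i => tf_t2 (h.pd i)
  have hS : 0 ≤ ∑ i, K i := Finset.sum_nonneg fun i _ => hK0 i
  refine ⟨d * ∑ i, K i, by positivity, fun x z => ?_⟩
  have hg : ∀ t, HasDerivAt (fun t : ℝ => φ (x + t • z) - φ x - t * (∑ i, z i * pd i φ x)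
      - (1 / 2) * t ^ 2 * ∑ i, ∑ j, z i * z j * pd2 i j φ x)
      (∑ i, z i * (pd i φ (x + t • z) - pd i φ x - ∑ j, (t • z) j * pd j (pd i φ) x)) t := by
    intro t
    have h1 := (((line_deriv h x z t).sub_const (φ x)).sub
      ((hasDerivAt_id t).mul_const (∑ i, z i * pd i φ x))).sub
      ((((hasDerivAt_id t).pow 2).const_mul (1 / 2)).mul_const (∑ i, ∑ j, z i * z j * pd2 i j φ x))
    refine HasDerivAt.congr_deriv h1 ?_
    simp only [mul_sub, Finset.sum_sub_distrib, Finset.mul_sum, pd2]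
    congr 1
    · simp
    · rw [Finset.sum_comm]
      refine Finset.sum_congr rfl fun i _ => Finset.sum_congr rfl fun j _ => ?_
      simp; ring
  have := mv01 hg (C := d * ((∑ i, K i) * ‖z‖ ^ 2) * ‖z‖) (fun t h0 h1 => sum_le_dK fun i => by
    refine (hK i x (t • z)).trans ?_
    have : ‖t • z‖ ≤ ‖z‖ := by
      rw [norm_smul, Real.norm_of_nonneg h0]
      nlinarith [norm_nonneg z]
    exact mul_le_mul (Finset.single_le_sum (fun i _ => hK0 i) (Finset.mem_univ i))
      (pow_le_pow_left₀ (norm_nonneg _) this 2) (by positivity) hS)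
  simp at this
  calc _ ≤ _ := by convert this using 2; simp
    _ = _ := by ring

lemma tf_tk {φ : EE d → ℝ} (h : TF φ) : ∃ K, TK φ K := by
  obtain ⟨K0, h0, H0⟩ := h.bdd
  obtain ⟨K1, h1, H1⟩ := h.db
  obtain ⟨K2, h2, H2⟩ := tf_t1 h
  obtain ⟨K3, h3, H3⟩ := tf_t2 h
  obtain ⟨K4, h4, H4⟩ := tf_t3 h
  refine ⟨K0 + K1 + K2 + K3 + K4, by positivity, fun x => (H0 x).trans (by linarith),
    ⟨fun i x => (H1.1 i x).trans (by linarith), fun i j x => (H1.2 i j x).trans (by linarith)⟩,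
    fun x z => (H2 x z).trans ?_, fun x z => (H3 x z).trans ?_, fun x z => (H4 x z).trans ?_⟩
  all_goals gcongr; linarith

end Taylor

section Moments
variable {d : ℕ}

/-- measurable bounded sets, invariant under sign changes and permutations of coordinates. -/
structure SymSet (B : Set (EE d)) : Prop where
  meas : MeasurableSet B
  bdd : ∀ z ∈ B, ‖z‖ ≤ 1
  flip : ∀ k z, z ∈ B → Function.update z k (-(z k)) ∈ B
  perm : ∀ (σ : Equiv.Perm (Fin d)) z, z ∈ B → z ∘ σ ∈ B
  pos : 0 < volume B

lemma SymSet.int {B : Set (EE d)} (h : SymSet B) {f : EE d → ℝ} (hf : Continuous f) :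
    IntegrableOn f B := by
  refine (hf.locallyIntegrable.integrableOn_isCompact (isCompact_closedBall (0 : EE d) 1)).mono_set ?_
  intro z hz; simpa using h.bdd z hz

lemma SymSet.off {B : Set (EE d)} (h : SymSet B) {k l : Fin d} (hkl : k ≠ l) :
    ∫ z in B, z k * z l = 0 := by
  have mp : MeasurePreserving (fun z : EE d => fun i => (if i = k then (fun t : ℝ => -t) else id) (z i)) volume volume := by
    refine volume_preserving_pi fun i => ?_
    by_cases hi : i = k
    · simp only [hi, if_true]; exact Measure.measurePreserving_neg _
    · simp only [hi, if_false]; exact MeasurePreserving.id _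
  have e : (fun z : EE d => fun i => (if i = k then (fun t : ℝ => -t) else id) (z i)) = fun z => Function.update z k (-(z k)) := by
    funext z i
    by_cases hi : i = k
    · subst hi; simp
    · simp [hi]
  rw [e] at mp
  have inv : Function.Involutive (fun z : EE d => Function.update z k (-(z k))) := by
    intro z; simp
  have me : MeasurableEmbedding (fun z : EE d => Function.update z k (-(z k))) :=
    (MeasurableEquiv.ofInvolutive _ inv mp.measurable).measurableEmbedding
  have pre : (fun z : EE d => Function.update z k (-(z k))) ⁻¹' B = B := by
    ext z; constructor
    · intro hz; have := h.flip k _ hz; simpa using this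
    · intro hz; exact h.flip k z hz
  have := mp.setIntegral_preimage_emb me (fun z => z k * z l) B
  rw [pre] at this
  simp [Function.update_of_ne hkl.symm, integral_neg] at this
  linarith

lemma SymSet.diag {B : Set (EE d)} (h : SymSet B) (k l : Fin d) :
    ∫ z in B, z k * z k = ∫ z in B, z l * z l := by
  have mp := volume_measurePreserving_piCongrLeft (fun _ : Fin d => ℝ) (Equiv.swap k l)
  have e : ∀ z : EE d, MeasurableEquiv.piCongrLeft (fun _ : Fin d => ℝ) (Equiv.swap k l) z
      = z ∘ (Equiv.swap k l) := by
    intro z; funext i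
    have := MeasurableEquiv.piCongrLeft_apply_apply (β := fun _ : Fin d => ℝ) (Equiv.swap k l) z (Equiv.swap k l i)
    simpa using this
  have pre : (MeasurableEquiv.piCongrLeft (fun _ : Fin d => ℝ) (Equiv.swap k l)) ⁻¹' B = B := by
    ext z; rw [Set.mem_preimage, e]; constructor
    · intro hz; have := h.perm (Equiv.swap k l) _ hz
      have e2 : (z ∘ (Equiv.swap k l)) ∘ (Equiv.swap k l) = z := by funext i; simp
      rwa [e2] at this
    · intro hz; exact h.perm _ z hz
  have := mp.setIntegral_preimage_emb (MeasurableEquiv.measurableEmbedding _) (fun z => z k * z k) B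
  rw [pre] at this
  simp only [e] at this
  simpa using this.symm

lemma SymSet.moment {B : Set (EE d)} (h : SymSet B) : ∃ c : ℝ, 0 < c ∧
    ∀ k l, ∫ z in B, z k * z l = if k = l then c else 0 := by
  rcases Nat.eq_zero_or_pos d with hd | hd
  · subst hd; exact ⟨1, one_pos, fun k => k.elim0⟩
  let k0 : Fin d := ⟨0, hd⟩
  refine ⟨∫ z in B, z k0 * z k0, ?_, fun k l => ?_⟩
  · rw [setIntegral_pos_iff_support_of_nonneg_ae (Eventually.of_forall fun z => mul_self_nonneg _)
      (h.int (by fun_prop))]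
    have e : Function.support (fun z : EE d => z k0 * z k0) ∩ B = B \ {z | z k0 = 0} := by
      ext z; simp [and_comm]
    rw [e, measure_sdiff_null]
    · exact h.pos
    · have := Measure.addHaar_submodule (volume : Measure (EE d)) (LinearMap.ker (LinearMap.proj k0 : EE d →ₗ[ℝ] ℝ)) (by
        intro ht
        have : (Pi.single k0 (1:ℝ) : EE d) ∈ LinearMap.ker (LinearMap.proj k0 : EE d →ₗ[ℝ] ℝ) := by rw [ht]; trivial
        simp at this)
      exact this
  · split_ifs with hkl
    · subst hkl; exact h.diag _ _
    · exact h.off hkl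

lemma symSet_sup : SymSet (Metric.closedBall (0 : EE d) 1) where
  meas := measurableSet_closedBall
  bdd z hz := by simpa using hz
  flip k z hz := by
    simp only [mem_closedBall_zero_iff] at hz ⊢
    refine (pi_norm_le_iff_of_nonneg zero_le_one).2 fun i => ?_
    have := (pi_norm_le_iff_of_nonneg zero_le_one).1 hz i
    by_cases hi : i = k
    · subst hi; simpa using this
    · simpa [hi] using this
  perm σ z hz := by
    simp only [mem_closedBall_zero_iff] at hz ⊢
    refine (pi_norm_le_iff_of_nonneg zero_le_one).2 fun i => ?_
    exact (pi_norm_le_iff_of_nonneg zero_le_one).1 hz _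
  pos := Metric.measure_closedBall_pos _ _ one_pos

lemma symSet_euc : SymSet {z : EE d | ∑ i, z i ^ 2 ≤ 1} where
  meas := measurableSet_le (by fun_prop) (by fun_prop)
  bdd z hz := by
    refine (pi_norm_le_iff_of_nonneg zero_le_one).2 fun i => ?_
    have : z i ^ 2 ≤ 1 := (Finset.single_le_sum (f := fun i => z i ^ 2) (fun i _ => sq_nonneg _) (Finset.mem_univ i)).trans hz
    exact abs_le_one_iff_mul_self_le_one.2 (by nlinarith)
  flip k z hz := by
    have : ∑ i, Function.update z k (-(z k)) i ^ 2 = ∑ i, z i ^ 2 := by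
      refine Finset.sum_congr rfl fun i _ => ?_
      by_cases hi : i = k
      · subst hi; simp
      · simp [hi]
    simpa [this] using hz
  perm σ z hz := by
    have : ∑ i, (z ∘ σ) i ^ 2 = ∑ i, z i ^ 2 := Equiv.sum_comp σ (fun i => z i ^ 2)
    rw [Set.mem_ofPred_eq, this]; exact hz
  pos := by
    have ho : IsOpen {z : EE d | ∑ i, z i ^ 2 < 1} := isOpen_lt (by fun_prop) (by fun_prop)
    refine (ho.measure_pos volume ⟨0, by simp⟩).trans_le (measure_mono fun z hz => ?_)
    exact le_of_lt (Set.mem_ofPred_eq ▸ hz)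

end Moments

section Ellipsoid
variable {d : ℕ}
open scoped Matrix

/-- Ellipsoid attached to a positive matrix. -/
def Ell (M : Matrix (Fin d) (Fin d) ℝ) : Set (EE d) := {z | z ⬝ᵥ (M.adjugate *ᵥ z) ≤ M.det}

open scoped MatrixOrder in
lemma posDef_factor {M : Matrix (Fin d) (Fin d) ℝ} (hM : M.PosDef) :
    ∃ Q : Matrix (Fin d) (Fin d) ℝ, M = Q * Qᵀ ∧ Q.det ≠ 0 ∧ |Q.det| = Real.sqrt M.det := by
  obtain ⟨B, hB⟩ := CStarAlgebra.nonneg_iff_eq_star_mul_self.mp hM.posSemidef.nonneg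
  have e : star B = Bᵀ := by
    rw [Matrix.star_eq_conjTranspose]; ext i j; simp
  rw [e] at hB
  have hdet : M.det = B.det ^ 2 := by rw [hB]; simp [sq]
  have hp := hM.det_pos
  refine ⟨Bᵀ, by simpa using hB, ?_, ?_⟩
  · intro h0
    rw [Matrix.det_transpose] at h0
    rw [hdet, h0] at hp; simp at hp
  · rw [hdet, Matrix.det_transpose, Real.sqrt_sq_eq_abs]

lemma Ell_iff {M Q : Matrix (Fin d) (Fin d) ℝ} (hM : 0 < M.det) (hQ : M = Q * Qᵀ)
    (y : EE d) : Q *ᵥ y ∈ Ell M ↔ ∑ i, y i ^ 2 ≤ 1 := by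
  have hd : Q.det ≠ 0 := by
    intro h0; rw [hQ, Matrix.det_mul, h0] at hM; simp at hM
  have hu : IsUnit Q.det := isUnit_iff_ne_zero.2 hd
  have hut : IsUnit Qᵀ.det := by rwa [Matrix.det_transpose]
  have e : M.adjugate = M.det • M⁻¹ := by
    rw [Matrix.inv_def, smul_smul, Ring.inverse_eq_inv', mul_inv_cancel₀ hM.ne', one_smul]
  have e2 : Qᵀ * M⁻¹ * Q = 1 := by
    rw [hQ, Matrix.mul_inv_rev, ← mul_assoc, Matrix.mul_nonsing_inv _ hut, one_mul, Matrix.nonsing_inv_mul _ hu]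
  have e3 : (Q *ᵥ y) ⬝ᵥ (M.adjugate *ᵥ (Q *ᵥ y)) = M.det * ∑ i, y i ^ 2 := by
    rw [e, Matrix.smul_mulVec, dotProduct_smul, Matrix.mulVec_mulVec, smul_eq_mul]
    congr 1
    rw [← Matrix.vecMul_transpose, ← Matrix.dotProduct_mulVec, Matrix.mulVec_mulVec, ← mul_assoc, e2,
      Matrix.one_mulVec]
    simp [dotProduct, sq]
  rw [Ell, Set.mem_ofPred_eq, e3]
  constructor
  · intro h; by_contra! hc; nlinarith
  · intro h; nlinarith

lemma Ell_meas (M : Matrix (Fin d) (Fin d) ℝ) : MeasurableSet (Ell M) :=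
  measurableSet_le (by simp only [dotProduct, Matrix.mulVec]; fun_prop) measurable_const

lemma Ell_bdd {M : Matrix (Fin d) (Fin d) ℝ} (hM : M.PosDef) {z : EE d} (hz : z ∈ Ell M) (i : Fin d) :
    z i ^ 2 ≤ M i i := by
  obtain ⟨Q, hQ, hd, -⟩ := posDef_factor hM
  have hu : IsUnit Q.det := isUnit_iff_ne_zero.2 hd
  obtain ⟨y, rfl⟩ : ∃ y, Q *ᵥ y = z := ⟨Q⁻¹ *ᵥ z, by
    rw [Matrix.mulVec_mulVec, Matrix.mul_nonsing_inv _ hu, Matrix.one_mulVec]⟩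
  rw [Ell_iff hM.det_pos hQ] at hz
  have h1 := Finset.sum_mul_sq_le_sq_mul_sq Finset.univ (fun j => Q i j) y
  have h2 : M i i = ∑ j, Q i j ^ 2 := by
    rw [hQ, Matrix.mul_apply]; simp [sq]
  have h3 : 0 ≤ ∑ j, Q i j ^ 2 := Finset.sum_nonneg fun j _ => sq_nonneg _
  rw [h2]
  calc (Q *ᵥ y) i ^ 2 ≤ _ := h1
    _ ≤ (∑ j, Q i j ^ 2) * 1 := by gcongr
    _ = _ := mul_one _

lemma Ell_neg {M : Matrix (Fin d) (Fin d) ℝ} (z : EE d) : -z ∈ Ell M ↔ z ∈ Ell M := by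
  simp [Ell, Matrix.mulVec_neg]

lemma Ell_moment {c : ℝ}
    (hc : ∀ k l : Fin d, ∫ z in {z : EE d | ∑ i, z i ^ 2 ≤ 1}, z k * z l = if k = l then c else 0)
    {M : Matrix (Fin d) (Fin d) ℝ} (hM : M.PosDef) (i j : Fin d) :
    ∫ z in Ell M, z i * z j = c * Real.sqrt M.det * M i j := by
  obtain ⟨Q, hQ, hd, hab⟩ := posDef_factor hM
  have hmap := Real.map_matrix_volume_pi_eq_smul_volume_pi hd
  have hme : Measurable (Matrix.toLin' Q : EE d → EE d) := (LinearMap.continuous_of_finiteDimensional _).measurable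
  have hf : Measurable ((Ell M).indicator fun z : EE d => z i * z j) :=
    Measurable.indicator (by fun_prop) (Ell_meas M)
  have h1 : ∫ z, (Ell M).indicator (fun z : EE d => z i * z j) z ∂(Measure.map (Matrix.toLin' Q) volume)
      = ∫ y, (Ell M).indicator (fun z : EE d => z i * z j) (Matrix.toLin' Q y) :=
    integral_map hme.aemeasurable hf.aestronglyMeasurable
  have h2 : ∀ y, (Ell M).indicator (fun z : EE d => z i * z j) (Matrix.toLin' Q y)
      = {z : EE d | ∑ i, z i ^ 2 ≤ 1}.indicator (fun y => ∑ k, ∑ l, Q i k * Q j l * (y k * y l)) y := by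
    intro y
    rw [Matrix.toLin'_apply]
    by_cases hy : ∑ i, y i ^ 2 ≤ 1
    · rw [Set.indicator_of_mem ((Ell_iff hM.det_pos hQ y).2 hy), Set.indicator_of_mem (by exact hy)]
      simp only [Matrix.mulVec, dotProduct, Finset.sum_mul_sum]
      refine Finset.sum_congr rfl fun k _ => Finset.sum_congr rfl fun l _ => by ring
    · rw [Set.indicator_of_notMem (fun h => hy ((Ell_iff hM.det_pos hQ y).1 h)), Set.indicator_of_notMem (by exact hy)]
  have h3 : ∫ y in {z : EE d | ∑ i, z i ^ 2 ≤ 1}, (∑ k, ∑ l, Q i k * Q j l * (y k * y l)) = c * M i j := by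
    rw [integral_finsetSum _ fun k _ => symSet_euc.int (by fun_prop)]
    have : ∀ k, ∫ y in {z : EE d | ∑ i, z i ^ 2 ≤ 1}, (∑ l, Q i k * Q j l * (y k * y l)) = c * (Q i k * Q j k) := by
      intro k
      rw [integral_finsetSum _ fun l _ => symSet_euc.int (by fun_prop)]
      simp only [integral_const_mul, hc]
      simp; ring
    simp only [this, ← Finset.mul_sum]
    rw [hQ, Matrix.mul_apply]; simp
  rw [hmap, integral_smul_measure, integral_indicator (Ell_meas M)] at h1
  simp only [h2] at h1
  rw [integral_indicator symSet_euc.meas, h3] at h1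
  rw [ENNReal.toReal_ofReal (abs_nonneg _), abs_inv, hab, smul_eq_mul] at h1
  have hs : 0 < Real.sqrt M.det := Real.sqrt_pos.2 hM.det_pos
  field_simp at h1
  linarith

end Ellipsoid

section Level
variable {d : ℕ}

/-- data of the symmetric part of the kernel -/
structure Lev (χ : EE d → ℝ) (w : EE d → EE d → ℝ → ℝ) (A' : Fin d → Fin d → EE d → ℝ → ℝ)
    (P R K : ℝ) : Prop where
  tf : TF χ
  χnn : ∀ x, 0 ≤ χ x
  meas : Measurable fun p : EE d × EE d × ℝ => w p.1 p.2.1 p.2.2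
  supp : ∀ p z r, (P < ‖p‖ ∨ R < ‖z‖) → w p z r = 0
  zero : ∀ p z, w p z 0 = 0
  mono : ∀ p z, Monotone (w p z)
  lip : ∀ p z r s, |w p z r - w p z s| ≤ K * |r - s|
  even : ∀ p z r, w p (-z) r = w p z r
  mom : ∀ i j p r, ∫ z, w p z r * (z i * z j) = 2 * A' i j p r
  Rnn : 0 ≤ R
  Knn : 0 ≤ K

/-- symmetric part of the kernel -/
noncomputable def K1 (χ : EE d → ℝ) (w : EE d → EE d → ℝ → ℝ) (h : ℝ) (y x : EE d) (r : ℝ) : ℝ :=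
  (h ^ (d + 2))⁻¹ * ∫ p, χ ((1 / 2 : ℝ) • (x + y) - p) * w p (h⁻¹ • (y - x)) r

variable {χ : EE d → ℝ} {w : EE d → EE d → ℝ → ℝ} {A' : Fin d → Fin d → EE d → ℝ → ℝ} {P R K : ℝ}

lemma Lev.abs (H : Lev χ w A' P R K) (p z : EE d) (r : ℝ) : |w p z r| ≤ K * |r| := by
  simpa [H.zero] using H.lip p z r 0

lemma Lev.int1 (H : Lev χ w A' P R K) (m z : EE d) (r : ℝ) :
    Integrable (fun p => χ (m - p) * w p z r) := by
  have h1 : Integrable (fun p => χ (m - p)) := H.tf.integrable.comp_sub_left m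
  refine h1.mul_bdd (c := K * |r|) ?_ (Eventually.of_forall fun p => H.abs p z r)
  exact (H.meas.comp (measurable_id.prodMk (measurable_const (a := (z, r))))).aestronglyMeasurable

lemma Lev.K1_meas (H : Lev χ w A' P R K) (h : ℝ) :
    Measurable fun p : EE d × EE d × ℝ => K1 χ w h p.1 p.2.1 p.2.2 := by
  have h1 : Measurable fun t : (EE d × EE d × ℝ) × EE d =>
      χ ((1 / 2 : ℝ) • (t.1.2.1 + t.1.1) - t.2) * w t.2 (h⁻¹ • (t.1.1 - t.1.2.1)) t.1.2.2 := by
    refine (H.tf.meas.comp (by fun_prop)).mul ?_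
    exact H.meas.comp (by fun_prop : Measurable fun t : (EE d × EE d × ℝ) × EE d =>
      (t.2, h⁻¹ • (t.1.1 - t.1.2.1), t.1.2.2))
  exact (h1.stronglyMeasurable.integral_prod_right (ν := volume)).measurable.const_mul _

lemma Lev.K1_zero (H : Lev χ w A' P R K) (h : ℝ) (y x : EE d) : K1 χ w h y x 0 = 0 := by
  simp [K1, H.zero]

lemma Lev.K1_symm (H : Lev χ w A' P R K) (h : ℝ) (y x : EE d) (r : ℝ) :
    K1 χ w h y x r = K1 χ w h x y r := by
  have e : h⁻¹ • (y - x) = -(h⁻¹ • (x - y)) := by rw [← smul_neg, neg_sub]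
  simp only [K1, add_comm x y, e, H.even]

lemma Lev.K1_mono (H : Lev χ w A' P R K) {h : ℝ} (hh : 0 < h) (y x : EE d) :
    Monotone (K1 χ w h y x) := by
  intro r s hrs
  refine mul_le_mul_of_nonneg_left ?_ (by positivity)
  exact integral_mono (H.int1 _ _ _) (H.int1 _ _ _) fun p =>
    mul_le_mul_of_nonneg_left (H.mono _ _ hrs) (H.χnn _)

lemma Lev.K1_lip (H : Lev χ w A' P R K) {h : ℝ} (hh : 0 < h) (y x : EE d) (r s : ℝ) :
    |K1 χ w h y x r - K1 χ w h y x s| ≤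
      (Metric.closedBall (0 : EE d) (h * R)).indicator (fun _ => (h ^ (d + 2))⁻¹ * (K * ∫ p, χ p)) (y - x) * |r - s| := by
  by_cases hz : ‖y - x‖ ≤ h * R
  · rw [Set.indicator_of_mem (by simpa using hz), K1, K1, ← mul_sub, abs_mul, abs_of_pos (by positivity : 0 < (h ^ (d + 2))⁻¹),
      mul_assoc]
    refine mul_le_mul_of_nonneg_left ?_ (by positivity)
    rw [← integral_sub (H.int1 _ _ _) (H.int1 _ _ _)]
    set m := (1 / 2 : ℝ) • (x + y)
    have e : ∫ p, χ p = ∫ p, χ (m - p) := (integral_sub_left_eq_self χ volume m).symm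
    rw [e, ← integral_const_mul, ← integral_mul_const]
    refine abs_integral_le_integral_abs.trans (integral_mono_of_nonneg (Eventually.of_forall fun p => abs_nonneg _)
      (((H.tf.integrable.comp_sub_left m).const_mul K).mul_const _) (Eventually.of_forall fun p => ?_))
    dsimp only
    rw [← mul_sub, abs_mul, abs_of_nonneg (H.χnn _)]
    have := mul_le_mul_of_nonneg_left (H.lip p (h⁻¹ • (y - x)) r s) (H.χnn (m - p))
    linarith
  · have : R < ‖h⁻¹ • (y - x)‖ := by
      push Not at hz
      rw [norm_smul, norm_inv, Real.norm_of_nonneg hh.le, lt_inv_mul_iff₀ hh]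
      exact hz
    rw [Set.indicator_of_notMem (by simpa using hz)]
    simp [K1, H.supp _ _ _ (Or.inr this)]

/-- the box supporting the kernel -/
def bx (d : ℕ) (P R : ℝ) : Set (EE d × EE d) := Metric.closedBall 0 P ×ˢ Metric.closedBall 0 R

lemma bx_cpt (P R : ℝ) : IsCompact (bx d P R) := (isCompact_closedBall _ _).prod (isCompact_closedBall _ _)

/-- integration against the kernel -/
noncomputable def II (w : EE d → EE d → ℝ → ℝ) (r : ℝ) (G : EE d × EE d → ℝ) : ℝ :=
  ∫ q, w q.1 q.2 r * G q ∂((volume : Measure (EE d)).prod (volume : Measure (EE d)))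

lemma Lev.wmeas (H : Lev χ w A' P R K) (r : ℝ) : Measurable fun q : EE d × EE d => w q.1 q.2 r :=
  H.meas.comp (measurable_fst.prodMk (measurable_snd.prodMk measurable_const))

lemma Lev.off (H : Lev χ w A' P R K) (r : ℝ) {q : EE d × EE d} (hq : q ∉ bx d P R) : w q.1 q.2 r = 0 := by
  apply H.supp
  by_contra! hc
  exact hq ⟨by simpa using hc.1, by simpa using hc.2⟩

lemma Lev.II_int (H : Lev χ w A' P R K) (r : ℝ) {G : EE d × EE d → ℝ} (hG : Continuous G) :
    Integrable (fun q : EE d × EE d => w q.1 q.2 r * G q) (volume.prod volume) := by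
  have h1 : IntegrableOn G (bx d P R) (volume.prod volume) := hG.continuousOn.integrableOn_compact (bx_cpt P R)
  have h2 := (integrable_indicator_iff (bx_cpt P R).measurableSet).2 h1
  refine (h2.bdd_mul (H.wmeas r).aestronglyMeasurable
    (Eventually.of_forall fun q => H.abs q.1 q.2 r)).congr (Eventually.of_forall fun q => ?_)
  by_cases hq : q ∈ bx d P R
  · simp [hq]
  · simp [hq, H.off r hq]

lemma Lev.II_le (H : Lev χ w A' P R K) (r : ℝ) {G : EE d × EE d → ℝ} {c : ℝ}
    (hc : ∀ q ∈ bx d P R, |G q| ≤ c) :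
    |II w r G| ≤ K * |r| * c * ((volume : Measure (EE d)).prod (volume : Measure (EE d))).real (bx d P R) := by
  have e : II w r G = ∫ q in bx d P R, w q.1 q.2 r * G q ∂((volume : Measure (EE d)).prod (volume : Measure (EE d))) := by
    rw [II, setIntegral_eq_integral_of_forall_compl_eq_zero]
    intro q hq; rw [H.off r hq, zero_mul]
  rw [e]
  have hfin : ((volume : Measure (EE d)).prod (volume : Measure (EE d))) (bx d P R) < ⊤ :=
    (bx_cpt P R).measure_lt_top
  have hb : ∀ q ∈ bx d P R, ‖w q.1 q.2 r * G q‖ ≤ K * |r| * c := fun q hq => by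
    rw [Real.norm_eq_abs, abs_mul]
    exact mul_le_mul (H.abs _ _ _) (hc q hq) (abs_nonneg _) (mul_nonneg H.Knn (abs_nonneg _))
  exact norm_setIntegral_le_of_norm_le_const hfin hb

lemma Lev.II_prod (H : Lev χ w A' P R K) (r : ℝ) {g k : EE d → ℝ} (hg : Continuous g) (hk : Continuous k) :
    II w r (fun q => g q.1 * k q.2) = ∫ p, g p * ∫ z, w p z r * k z := by
  rw [II, integral_prod _ (H.II_int r (by fun_prop))]
  congr 1; funext p
  rw [← integral_const_mul]
  congr 1; funext z; ring

lemma Lev.II_odd (H : Lev χ w A' P R K) (r : ℝ) {g : EE d → ℝ} (hg : Continuous g) (i : Fin d) :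
    II w r (fun q => g q.1 * q.2 i) = 0 := by
  rw [H.II_prod r hg (k := fun z => z i) (by fun_prop)]
  have : ∀ p, ∫ z : EE d, w p z r * z i = 0 := by
    intro p
    have := integral_neg_eq_self (fun z : EE d => w p z r * z i) volume
    simp only [H.even, Pi.neg_apply, mul_neg, integral_neg] at this
    linarith
  simp [this]

lemma Lev.II_mom (H : Lev χ w A' P R K) (r : ℝ) {g : EE d → ℝ} (hg : Continuous g) (i j : Fin d) :
    II w r (fun q => g q.1 * (q.2 i * q.2 j)) = 2 * ∫ p, g p * A' i j p r := by
  rw [H.II_prod r hg (k := fun z => z i * z j) (by fun_prop)]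
  simp only [H.mom]
  rw [← integral_const_mul]
  congr 1; funext p; ring

lemma Lev.II_sub (H : Lev χ w A' P R K) (r : ℝ) {G G' : EE d × EE d → ℝ} (hG : Continuous G) (hG' : Continuous G') :
    II w r G - II w r G' = II w r (fun q => G q - G' q) := by
  simp only [II]
  rw [← integral_sub (H.II_int r hG) (H.II_int r hG')]
  congr 1; funext q; ring

lemma II_smul (r c : ℝ) (G : EE d × EE d → ℝ) : II w r (fun q => c * G q) = c * II w r G := by
  simp only [II]
  rw [← integral_const_mul]
  congr 1; funext q; ring

lemma Lev.II_add (H : Lev χ w A' P R K) (r : ℝ) {G G' : EE d × EE d → ℝ} (hG : Continuous G) (hG' : Continuous G') :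
    II w r (fun q => G q + G' q) = II w r G + II w r G' := by
  simp only [II]
  rw [← integral_add (H.II_int r hG) (H.II_int r hG')]
  congr 1; funext q; ring

lemma Lev.II_sum (H : Lev χ w A' P R K) (r : ℝ) {ι : Type*} (s : Finset ι) {G : ι → EE d × EE d → ℝ}
    (hG : ∀ i, Continuous (G i)) :
    II w r (fun q => ∑ i ∈ s, G i q) = ∑ i ∈ s, II w r (G i) := by
  simp only [II, Finset.mul_sum]
  rw [integral_finsetSum _ fun i _ => H.II_int r (hG i)]

lemma cov {h : ℝ} (hh : 0 < h) (x : EE d) (F : EE d → ℝ) : ∫ y, F y = h ^ d * ∫ z, F (x + h • z) := by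
  have h1 := Measure.integral_comp_smul (volume : Measure (EE d)) (fun y => F (x + y)) h
  rw [h1, integral_add_left_eq_self]
  simp only [Module.finrank_fintype_fun_eq_card, Fintype.card_fin, smul_eq_mul]
  rw [abs_of_pos (by positivity), ← mul_assoc, mul_inv_cancel₀ (by positivity), one_mul]

lemma Lev.JL_K1 (H : Lev χ w A' P R K) {h : ℝ} (hh : 0 < h) {φ : EE d → ℝ} (hφ : TF φ) (x : EE d) (r : ℝ) :
    JL (K1 χ w h) φ x r = (h ^ 2)⁻¹ * II w r (fun q => χ (x - q.1 + (h / 2) • q.2) * (φ (x + h • q.2) - φ x)) := by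
  have hφc := hφ.1.continuous
  have hχc := H.tf.1.continuous
  rw [JL, cov hh x, II]
  rw [integral_prod_symm _ (H.II_int r (by fun_prop)), ← integral_const_mul, ← integral_const_mul]
  congr 1; funext z
  have e1 : (1 / 2 : ℝ) • (x + (x + h • z)) = x + (h / 2) • z := by
    rw [← add_assoc, ← two_smul ℝ x, smul_add, smul_smul, smul_smul]; norm_num; congr 1; ring
  have e2 : h⁻¹ • (x + h • z - x) = z := by
    rw [add_sub_cancel_left, smul_smul, inv_mul_cancel₀ hh.ne', one_smul]
  rw [K1, e1, e2]
  have e3 : ∫ p, w p z r * (χ (x - p + (h / 2) • z) * (φ (x + h • z) - φ x))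
      = (∫ p, χ (x + (h / 2) • z - p) * w p z r) * (φ (x + h • z) - φ x) := by
    rw [← integral_mul_const]
    congr 1; funext p
    rw [show x - p + (h / 2) • z = x + (h / 2) • z - p by abel]; ring
  rw [e3]
  field_simp
  ring

lemma pd_cont {φ : EE d → ℝ} (hφ : TF φ) (i : Fin d) : Continuous (pd i φ) := (hφ.pd i).1.continuous

lemma Lev.cons1 (H : Lev χ w A' P R K) : ∃ C, 0 ≤ C ∧ ∀ h, 0 < h → h ≤ 1 → ∀ φ, TF φ → ∀ Kφ, TK φ Kφ → ∀ x r,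
    |JL (K1 χ w h) φ x r - ((∑ i, pd i φ x * ∑ j, ∫ p, pd j χ (x - p) * A' i j p r)
      + ∑ i, ∑ j, pd2 i j φ x * ∫ p, χ (x - p) * A' i j p r)| ≤ C * Kφ * h * |r| := by
  obtain ⟨L, hL⟩ := tf_tk H.tf
  have hL0 := hL.nn
  have hR := H.Rnn
  have hK := H.Knn
  set vol := ((volume : Measure (EE d)).prod (volume : Measure (EE d))).real (bx d P R)
  have hvol : 0 ≤ vol := measureReal_nonneg
  set C0 := L * R ^ 3 + d * L * R * (d * (d * R) * R + R ^ 3) + L * R ^ 3 with hC0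
  have hC00 : 0 ≤ C0 := by positivity
  refine ⟨K * C0 * vol, by positivity, fun h hh h1 φ hφ M hM x r => ?_⟩
  have hM0 := hM.nn
  have hχc := H.tf.1.continuous
  have hφc := hφ.1.continuous
  have hpd := pd_cont H.tf
  let G : EE d × EE d → ℝ := fun q => χ (x - q.1 + (h / 2) • q.2) * (φ (x + h • q.2) - φ x)
  let Ga : EE d × EE d → ℝ := fun q => ∑ i, pd i φ x * (χ (x - q.1) * q.2 i)
  let Gb : EE d × EE d → ℝ := fun q => ∑ i, pd i φ x * ∑ j, pd j χ (x - q.1) * (q.2 i * q.2 j)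
  let Gc : EE d × EE d → ℝ := fun q => ∑ i, ∑ j, pd2 i j φ x * (χ (x - q.1) * (q.2 i * q.2 j))
  let G0 : EE d × EE d → ℝ := fun q => h * Ga q + h ^ 2 / 2 * (Gb q + Gc q)
  have cG : Continuous G := by fun_prop
  have cGa : Continuous Ga := by fun_prop
  have cGb : Continuous Gb := by fun_prop
  have cGc : Continuous Gc := by fun_prop
  have ia : II w r Ga = 0 := by
    rw [H.II_sum r _ (fun i => by fun_prop)]
    refine Finset.sum_eq_zero fun i _ => ?_
    rw [II_smul, H.II_odd r (g := fun p => χ (x - p)) (by fun_prop), mul_zero]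
  have ib : II w r Gb = 2 * ∑ i, pd i φ x * ∑ j, ∫ p, pd j χ (x - p) * A' i j p r := by
    rw [H.II_sum r _ (fun i => by fun_prop), Finset.mul_sum]
    refine Finset.sum_congr rfl fun i _ => ?_
    rw [II_smul, H.II_sum r _ (fun i => by fun_prop), Finset.mul_sum, Finset.mul_sum, Finset.mul_sum]
    refine Finset.sum_congr rfl fun j _ => ?_
    rw [H.II_mom r (g := fun p => pd j χ (x - p)) (by fun_prop)]; ring
  have ic : II w r Gc = 2 * ∑ i, ∑ j, pd2 i j φ x * ∫ p, χ (x - p) * A' i j p r := by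
    rw [H.II_sum r _ (fun i => by fun_prop), Finset.mul_sum]
    refine Finset.sum_congr rfl fun i _ => ?_
    rw [H.II_sum r _ (fun i => by fun_prop), Finset.mul_sum]
    refine Finset.sum_congr rfl fun j _ => ?_
    rw [II_smul, H.II_mom r (g := fun p => χ (x - p)) (by fun_prop)]; ring
  have i0 : II w r G0 = h ^ 2 * ((∑ i, pd i φ x * ∑ j, ∫ p, pd j χ (x - p) * A' i j p r)
      + ∑ i, ∑ j, pd2 i j φ x * ∫ p, χ (x - p) * A' i j p r) := by
    rw [H.II_add r (G := fun q => h * Ga q) (by fun_prop) (by fun_prop), II_smul, II_smul, H.II_add r cGb cGc, ia, ib, ic]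
    ring
  rw [H.JL_K1 hh hφ]
  have key : |II w r G - II w r G0| ≤ K * |r| * (C0 * M * h ^ 3) * vol := by
    rw [H.II_sub r cG (by fun_prop)]
    refine H.II_le r fun q hq => ?_
    have hz : ‖q.2‖ ≤ R := by simpa using hq.2
    set z := q.2
    set m := x - q.1
    have hz0 := norm_nonneg z
    set a1 := ∑ j, z j * pd j χ m with ha1
    set b1 := ∑ i, z i * pd i φ x with hb1
    set b2 := ∑ i, ∑ j, z i * z j * pd2 i j φ x with hb2
    have na1 : |a1| ≤ d * L * R := (sum_le_dK fun j => hL.db.1 j m).trans (by gcongr)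
    have nb2 : |b2| ≤ d * (d * M * R) * R := by
      have : b2 = ∑ i, z i * ∑ j, z j * pd2 i j φ x := by
        rw [hb2]; refine Finset.sum_congr rfl fun i _ => ?_
        rw [Finset.mul_sum]; refine Finset.sum_congr rfl fun j _ => by ring
      rw [this]
      refine (sum_le_dK (c := d * M * R) fun i => (sum_le_dK fun j => hM.db.2 i j x).trans (by gcongr)).trans (by gcongr)
    have n1 : |χ (m + (h / 2) • z) - χ m - h / 2 * a1| ≤ L * R ^ 2 * h ^ 2 := by
      have := hL.t2 m ((h / 2) • z)
      have e : ∑ i, ((h / 2) • z) i * pd i χ m = h / 2 * a1 := by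
        rw [ha1, Finset.mul_sum]; refine Finset.sum_congr rfl fun i _ => by simp; ring
      rw [e] at this
      refine this.trans ?_
      have : ‖(h / 2) • z‖ ≤ R * h := by
        rw [norm_smul, Real.norm_of_nonneg (by positivity)]; nlinarith
      calc L * ‖(h / 2) • z‖ ^ 2 ≤ L * (R * h) ^ 2 := by gcongr
        _ = _ := by ring
    have nz : ‖h • z‖ ≤ R * h := by
      rw [norm_smul, Real.norm_of_nonneg hh.le]; nlinarith
    have n2 : |φ (x + h • z) - φ x| ≤ M * R * h := by
      refine (hM.t1 x (h • z)).trans ?_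
      calc M * ‖h • z‖ ≤ M * (R * h) := by gcongr
        _ = _ := by ring
    have n3 : |φ (x + h • z) - φ x - h * b1 - h ^ 2 / 2 * b2| ≤ M * R ^ 3 * h ^ 3 := by
      have := hM.t3 x (h • z)
      have e : ∑ i, (h • z) i * pd i φ x = h * b1 := by
        rw [hb1, Finset.mul_sum]; refine Finset.sum_congr rfl fun i _ => by simp; ring
      have e' : (1 / 2) * ∑ i, ∑ j, (h • z) i * (h • z) j * pd2 i j φ x = h ^ 2 / 2 * b2 := by
        rw [hb2, Finset.mul_sum, Finset.mul_sum]; refine Finset.sum_congr rfl fun i _ => ?_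
        rw [Finset.mul_sum, Finset.mul_sum]; refine Finset.sum_congr rfl fun j _ => by simp; ring
      rw [e, e'] at this
      refine this.trans ?_
      calc M * ‖h • z‖ ^ 3 ≤ M * (R * h) ^ 3 := by gcongr
        _ = _ := by ring
    have eGa : Ga q = χ m * b1 := by
      simp only [Ga, hb1, Finset.mul_sum]; refine Finset.sum_congr rfl fun i _ => by ring
    have eGb : Gb q = a1 * b1 := by
      simp only [Gb, hb1, ha1, Finset.mul_sum, Finset.sum_mul]
      refine Finset.sum_congr rfl fun i _ => Finset.sum_congr rfl fun j _ => ?_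
      ring
    have eGc : Gc q = χ m * b2 := by
      simp only [Gc, hb2, Finset.mul_sum]
      refine Finset.sum_congr rfl fun i _ => Finset.sum_congr rfl fun j _ => ?_
      ring
    have eq : G q - G0 q = (χ (m + (h / 2) • z) - χ m - h / 2 * a1) * (φ (x + h • z) - φ x)
        + h / 2 * a1 * (h ^ 2 / 2 * b2 + (φ (x + h • z) - φ x - h * b1 - h ^ 2 / 2 * b2))
        + χ m * (φ (x + h • z) - φ x - h * b1 - h ^ 2 / 2 * b2) := by
      simp only [G, G0, eGa, eGb, eGc]; ring
    rw [eq]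
    have k1 : |(χ (m + (h / 2) • z) - χ m - h / 2 * a1) * (φ (x + h • z) - φ x)| ≤ (L * R ^ 2 * h ^ 2) * (M * R * h) := by
      rw [abs_mul]; exact mul_le_mul n1 n2 (abs_nonneg _) (by positivity)
    have k3 : |χ m * (φ (x + h • z) - φ x - h * b1 - h ^ 2 / 2 * b2)| ≤ L * (M * R ^ 3 * h ^ 3) := by
      rw [abs_mul]; exact mul_le_mul (hL.bd m) n3 (abs_nonneg _) hL0
    have k2 : |h / 2 * a1 * (h ^ 2 / 2 * b2 + (φ (x + h • z) - φ x - h * b1 - h ^ 2 / 2 * b2))|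
        ≤ (h * (d * L * R)) * (h ^ 2 * (d * (d * M * R) * R) + M * R ^ 3 * h ^ 3) := by
      rw [abs_mul]
      refine mul_le_mul ?_ ((abs_add_le _ _).trans (add_le_add ?_ n3)) (abs_nonneg _) (by positivity)
      · rw [abs_mul, abs_of_pos (by positivity)]
        refine mul_le_mul (by linarith) na1 (abs_nonneg _) hh.le
      · rw [abs_mul, abs_of_pos (by positivity)]
        refine mul_le_mul (by nlinarith) nb2 (abs_nonneg _) (by positivity)
    refine (abs_add_three _ _ _).trans ((add_le_add_three k1 k2 k3).trans ?_)
    have : M * R ^ 3 * h ^ 3 ≤ M * R ^ 3 * h ^ 2 := by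
      have : h ^ 3 ≤ h ^ 2 := pow_le_pow_of_le_one hh.le h1 (by norm_num)
      gcongr
    calc _ ≤ (L * R ^ 2 * h ^ 2) * (M * R * h) + (h * (d * L * R)) * (h ^ 2 * (d * (d * M * R) * R) + M * R ^ 3 * h ^ 2)
          + L * (M * R ^ 3 * h ^ 3) := by gcongr
      _ = _ := by rw [hC0]; ring
  rw [i0] at key
  have e5 : (h ^ 2)⁻¹ * II w r G - ((∑ i, pd i φ x * ∑ j, ∫ p, pd j χ (x - p) * A' i j p r)
      + ∑ i, ∑ j, pd2 i j φ x * ∫ p, χ (x - p) * A' i j p r) = (h ^ 2)⁻¹ * (II w r G - h ^ 2 * ((∑ i, pd i φ x * ∑ j, ∫ p, pd j χ (x - p) * A' i j p r)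
      + ∑ i, ∑ j, pd2 i j φ x * ∫ p, χ (x - p) * A' i j p r)) := by
    rw [mul_sub, ← mul_assoc _ (h ^ 2), inv_mul_cancel₀ (by positivity), one_mul]
  change |(h ^ 2)⁻¹ * II w r G - _| ≤ _
  rw [e5, abs_mul, abs_of_pos (by positivity)]
  calc (h ^ 2)⁻¹ * _ ≤ (h ^ 2)⁻¹ * (K * |r| * (C0 * M * h ^ 3) * vol) := by gcongr
    _ = (h ^ 2)⁻¹ * h ^ 2 * (K * C0 * vol * M * h * |r|) := by ring
    _ = _ := by rw [inv_mul_cancel₀ (by positivity), one_mul]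

end Level

section Drift
variable {d : ℕ}

/-- isotropic part with drift -/
noncomputable def K2 (κ c : ℝ) (V : Fin d → EE d → ℝ → ℝ) (h : ℝ) (y x : EE d) (r : ℝ) : ℝ :=
  (Metric.closedBall (0 : EE d) h).indicator
    (fun ζ => (h ^ (d + 2))⁻¹ * (κ * r + c⁻¹ * ∑ i, ζ i * V i x r)) (y - x)

/-- admissible drifts -/
structure Dr (V : Fin d → EE d → ℝ → ℝ) (Λ : ℝ) : Prop where
  meas : ∀ i, Measurable fun p : EE d × ℝ => V i p.1 p.2
  zero : ∀ i x, V i x 0 = 0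
  lip : ∀ i x r s, |V i x r - V i x s| ≤ Λ * |r - s|
  nn : 0 ≤ Λ

variable {V : Fin d → EE d → ℝ → ℝ} {Λ κ c : ℝ}

lemma Dr.abs (H : Dr V Λ) (i : Fin d) (x : EE d) (r : ℝ) : |V i x r| ≤ Λ * |r| := by
  simpa [H.zero] using H.lip i x r 0

lemma Dr.K2_meas (H : Dr V Λ) (h : ℝ) :
    Measurable fun p : EE d × EE d × ℝ => K2 κ c V h p.1 p.2.1 p.2.2 := by
  have e : (fun p : EE d × EE d × ℝ => K2 κ c V h p.1 p.2.1 p.2.2) =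
      {p : EE d × EE d × ℝ | p.1 - p.2.1 ∈ Metric.closedBall (0 : EE d) h}.indicator
        (fun p => (h ^ (d + 2))⁻¹ * (κ * p.2.2 + c⁻¹ * ∑ i, (p.1 - p.2.1) i * V i p.2.1 p.2.2)) := by
    funext p; rfl
  rw [e]
  have hV : ∀ i, Measurable fun p : EE d × EE d × ℝ => V i p.2.1 p.2.2 := fun i =>
    (H.meas i).comp measurable_snd
  have hsub : Measurable fun p : EE d × EE d × ℝ => p.1 - p.2.1 :=
    measurable_fst.sub (measurable_fst.comp measurable_snd)
  have hz : ∀ i, Measurable fun p : EE d × EE d × ℝ => (p.1 - p.2.1) i := fun i =>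
    (measurable_pi_apply i).comp hsub
  refine Measurable.indicator ?_ (hsub measurableSet_closedBall)
  exact (((measurable_snd.comp measurable_snd).const_mul κ).add
    ((Finset.measurable_sum _ fun i _ => (hz i).mul (hV i)).const_mul _)).const_mul _

lemma Dr.K2_diff (_ : Dr V Λ) (h : ℝ) (y x : EE d) (r s : ℝ) :
    K2 κ c V h y x r - K2 κ c V h y x s = (Metric.closedBall (0 : EE d) h).indicator
    (fun ζ => (h ^ (d + 2))⁻¹ * (κ * (r - s) + c⁻¹ * ∑ i, ζ i * (V i x r - V i x s))) (y - x) := by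
  by_cases hz : y - x ∈ Metric.closedBall (0 : EE d) h
  · simp only [K2, Set.indicator_of_mem hz, mul_sub, Finset.sum_sub_distrib]; ring
  · simp only [K2, Set.indicator_of_notMem hz]; ring

lemma Dr.K2_mono (H : Dr V Λ) {h : ℝ} (hh : 0 < h) (hc : 0 < c) (hs : c⁻¹ * (d * Λ * h) ≤ κ) (y x : EE d) :
    Monotone (K2 κ c V h y x) := by
  intro s r hrs
  rw [← sub_nonneg, H.K2_diff]
  refine Set.indicator_nonneg (fun ζ hζ => ?_) _
  have hζ' : ‖ζ‖ ≤ h := by simpa using hζ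
  have h0 : 0 ≤ r - s := sub_nonneg.2 hrs
  have hn := H.nn
  have h1 : |∑ i, ζ i * (V i x r - V i x s)| ≤ d * (Λ * (r - s)) * h :=
    (sum_le_dK fun i => (H.lip i x r s).trans_eq (by rw [abs_of_nonneg h0])).trans (by gcongr)
  have h2 := (abs_le.1 h1).1
  refine mul_nonneg (by positivity) ?_
  have h3 : c⁻¹ * -(d * (Λ * (r - s)) * h) ≤ c⁻¹ * ∑ i, ζ i * (V i x r - V i x s) :=
    mul_le_mul_of_nonneg_left h2 (by positivity)
  have h4 := mul_le_mul_of_nonneg_right hs h0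
  nlinarith

lemma Dr.K2_lip (H : Dr V Λ) {h : ℝ} (hh : 0 < h) (hc : 0 < c) (hκ : 0 ≤ κ) (y x : EE d) (r s : ℝ) :
    |K2 κ c V h y x r - K2 κ c V h y x s| ≤ (Metric.closedBall (0 : EE d) h).indicator
      (fun _ => (h ^ (d + 2))⁻¹ * (κ + c⁻¹ * (d * Λ * h))) (y - x) * |r - s| := by
  rw [H.K2_diff]
  have hn := H.nn
  by_cases hz : y - x ∈ Metric.closedBall (0 : EE d) h
  · rw [Set.indicator_of_mem hz, Set.indicator_of_mem hz, abs_mul, abs_of_pos (by positivity : 0 < (h ^ (d + 2))⁻¹), mul_assoc]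
    refine mul_le_mul_of_nonneg_left ?_ (by positivity)
    have hζ' : ‖y - x‖ ≤ h := by simpa using hz
    have h1 : |∑ i, (y - x) i * (V i x r - V i x s)| ≤ d * (Λ * |r - s|) * h :=
      (sum_le_dK fun i => H.lip i x r s).trans (by gcongr)
    calc _ ≤ |κ * (r - s)| + |c⁻¹ * ∑ i, (y - x) i * (V i x r - V i x s)| := abs_add_le _ _
      _ = κ * |r - s| + c⁻¹ * |∑ i, (y - x) i * (V i x r - V i x s)| := by
        rw [abs_mul, abs_mul, abs_of_nonneg hκ, abs_of_pos (by positivity : 0 < c⁻¹)]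
      _ ≤ κ * |r - s| + c⁻¹ * (d * (Λ * |r - s|) * h) := by gcongr
      _ = _ := by ring
  · simp [Set.indicator_of_notMem hz]

/-- the full kernel -/
noncomputable def KK (χ : EE d → ℝ) (w : EE d → EE d → ℝ → ℝ) (κ c : ℝ) (V : Fin d → EE d → ℝ → ℝ) (h : ℝ)
    (y x : EE d) (r : ℝ) : ℝ := K1 χ w h y x r + K2 κ c V h y x r

variable {χ : EE d → ℝ} {w : EE d → EE d → ℝ → ℝ} {A' : Fin d → Fin d → EE d → ℝ → ℝ} {P R K : ℝ}

/-- dominating function -/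
noncomputable def KQ (χ : EE d → ℝ) (κ c K R Λ h : ℝ) (z : EE d) : ℝ :=
  (Metric.closedBall (0 : EE d) (h * R)).indicator (fun _ => (h ^ (d + 2))⁻¹ * (K * ∫ p, χ p)) z
  + (Metric.closedBall (0 : EE d) h).indicator
      (fun _ => (h ^ (d + 2))⁻¹ * (κ + c⁻¹ * (d * Λ * h))) z

lemma KK_jump (H : Lev χ w A' P R K) (HV : Dr V Λ) {h : ℝ} (hh : 0 < h) (hc : 0 < c) (hκ : 0 ≤ κ)
    (hs : c⁻¹ * (d * Λ * h) ≤ κ) : JumpK (KK χ w κ c V h) (KQ χ κ c K R Λ h) := by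
  have hn := HV.nn
  have hK := H.Knn
  have hi : 0 ≤ ∫ p, χ p := integral_nonneg H.χnn
  have n1 : 0 ≤ (h ^ (d + 2))⁻¹ * (K * ∫ p, χ p) := by positivity
  have n2 : 0 ≤ (h ^ (d + 2))⁻¹ * (κ + c⁻¹ * (d * Λ * h)) := by positivity
  refine ⟨(H.K1_meas h).add (HV.K2_meas h), fun y x => ?_, fun y x => ?_, fun y x r s => ?_, ?_, ?_, fun z => ?_, ?_⟩
  · simp [KK, H.K1_zero, K2, HV.zero]
  · exact (H.K1_mono hh y x).add (HV.K2_mono hh hc hs y x)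
  · have e : KK χ w κ c V h y x r - KK χ w κ c V h y x s = (K1 χ w h y x r - K1 χ w h y x s)
      + (K2 κ c V h y x r - K2 κ c V h y x s) := by simp only [KK]; ring
    rw [e, KQ, add_mul]
    exact (abs_add_le _ _).trans (add_le_add (H.K1_lip hh y x r s) (HV.K2_lip hh hc hκ y x r s))
  · exact (measurable_const.indicator measurableSet_closedBall).add (measurable_const.indicator measurableSet_closedBall)
  · refine Integrable.add ?_ ?_
    all_goals
      refine (integrable_indicator_iff measurableSet_closedBall).2 ?_
      exact integrableOn_const measure_closedBall_lt_top.ne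
  · exact add_nonneg (Set.indicator_nonneg (fun _ _ => n1) _) (Set.indicator_nonneg (fun _ _ => n2) _)
  · exact ⟨_, fun z => add_le_add (Set.indicator_le_self' (fun _ _ => n1) z) (Set.indicator_le_self' (fun _ _ => n2) z)⟩

lemma JL_K2 {h : ℝ} (hh : 0 < h) (φ : EE d → ℝ) (x : EE d) (r : ℝ) :
    JL (K2 κ c V h) φ x r = (h ^ 2)⁻¹ * ∫ z in Metric.closedBall (0 : EE d) 1,
      (κ * r + h * c⁻¹ * ∑ i, z i * V i x r) * (φ (x + h • z) - φ x) := by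
  rw [JL, cov hh x, ← integral_indicator measurableSet_closedBall, ← integral_const_mul, ← integral_const_mul]
  congr 1; funext z
  rw [K2, add_sub_cancel_left]
  have e : h • z ∈ Metric.closedBall (0 : EE d) h ↔ z ∈ Metric.closedBall (0 : EE d) 1 := by
    simp only [mem_closedBall_zero_iff, norm_smul, Real.norm_of_nonneg hh.le]
    exact mul_le_iff_le_one_right hh
  by_cases hz : z ∈ Metric.closedBall (0 : EE d) 1
  · rw [Set.indicator_of_mem hz, Set.indicator_of_mem (e.2 hz)]
    have : ∑ i, (h • z) i * V i x r = h * ∑ i, z i * V i x r := by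
      rw [Finset.mul_sum]; refine Finset.sum_congr rfl fun i _ => by simp; ring
    rw [this, pow_add]
    field_simp
  · rw [Set.indicator_of_notMem hz, Set.indicator_of_notMem (fun h' => hz (e.1 h'))]; simp

lemma ball_odd (i : Fin d) : ∫ z in Metric.closedBall (0 : EE d) 1, z i = 0 := by
  rw [← integral_indicator measurableSet_closedBall]
  have := integral_neg_eq_self ((Metric.closedBall (0 : EE d) 1).indicator fun z => z i) volume
  have e : ∀ z : EE d, (Metric.closedBall (0 : EE d) 1).indicator (fun z => z i) (-z)
      = -(Metric.closedBall (0 : EE d) 1).indicator (fun z => z i) z := by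
    intro z
    by_cases hz : ‖z‖ ≤ 1
    · rw [Set.indicator_of_mem (by simpa using hz), Set.indicator_of_mem (by simpa using hz)]; rfl
    · rw [Set.indicator_of_notMem (by simpa using hz), Set.indicator_of_notMem (by simpa using hz)]; simp
  simp only [e, integral_neg] at this
  linarith

lemma Dr.cons2 (H : Dr V Λ) (hc : 0 < c) (hκ : 0 ≤ κ)
    (hmom : ∀ k l : Fin d, ∫ z in Metric.closedBall (0 : EE d) 1, z k * z l = if k = l then c else 0) :
    ∃ C, 0 ≤ C ∧ ∀ h, 0 < h → ∀ φ, TF φ → ∀ Kφ, TK φ Kφ → ∀ x r,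
    |JL (K2 κ c V h) φ x r - (κ * c / 2 * r * (∑ i, pd2 i i φ x) + ∑ i, V i x r * pd i φ x)| ≤ C * Kφ * h * |r| := by
  set vol := (volume : Measure (EE d)).real (Metric.closedBall 0 1)
  have hvol : 0 ≤ vol := measureReal_nonneg
  have hn := H.nn
  refine ⟨(κ + c⁻¹ * (d * Λ)) * vol, by positivity, fun h hh φ hφ M hM x r => ?_⟩
  have hM0 := hM.nn
  have hφc := hφ.1.continuous
  rw [JL_K2 hh]
  set s : EE d → ℝ := fun z => ∑ i, z i * V i x r with hs
  set b1 : EE d → ℝ := fun z => ∑ i, z i * pd i φ x with hb1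
  set b2 : EE d → ℝ := fun z => ∑ i, ∑ j, z i * z j * pd2 i j φ x with hb2
  have cs : Continuous s := by fun_prop
  have cb1 : Continuous b1 := by fun_prop
  have cb2 : Continuous b2 := by fun_prop
  have SI : ∀ {f : EE d → ℝ}, Continuous f → IntegrableOn f (Metric.closedBall 0 1) := fun hf => symSet_sup.int hf
  have i1 : ∫ z in Metric.closedBall (0 : EE d) 1, b1 z = 0 := by
    rw [integral_finsetSum _ fun k _ => SI (by fun_prop)]
    simp [integral_mul_const, ball_odd]
  have i2 : ∫ z in Metric.closedBall (0 : EE d) 1, b2 z = c * ∑ i, pd2 i i φ x := by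
    rw [integral_finsetSum _ fun k _ => SI (by fun_prop), Finset.mul_sum]
    refine Finset.sum_congr rfl fun i _ => ?_
    rw [integral_finsetSum _ fun k _ => SI (by fun_prop)]
    simp [integral_mul_const, hmom]
  have i3 : ∫ z in Metric.closedBall (0 : EE d) 1, s z * b1 z = c * ∑ i, V i x r * pd i φ x := by
    have : ∀ z, s z * b1 z = ∑ i, ∑ j, (z i * z j) * (V i x r * pd j φ x) := by
      intro z; simp only [hs, hb1, Finset.sum_mul_sum]
      refine Finset.sum_congr rfl fun i _ => Finset.sum_congr rfl fun j _ => by ring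
    simp only [this]
    rw [integral_finsetSum _ fun k _ => SI (by fun_prop), Finset.mul_sum]
    refine Finset.sum_congr rfl fun i _ => ?_
    rw [integral_finsetSum _ fun k _ => SI (by fun_prop)]
    simp [integral_mul_const, hmom]
  have i0 : ∫ z in Metric.closedBall (0 : EE d) 1, (κ * r * h * b1 z + (κ * r * h ^ 2 / 2 * b2 z + h ^ 2 * c⁻¹ * (s z * b1 z)))
      = h ^ 2 * (κ * c / 2 * r * (∑ i, pd2 i i φ x) + ∑ i, V i x r * pd i φ x) := by
    rw [integral_add (SI (by fun_prop)) (SI (by fun_prop)), integral_add (SI (by fun_prop)) (SI (by fun_prop)),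
      integral_const_mul, integral_const_mul, integral_const_mul, i1, i2, i3]
    field_simp
    ring
  have key : |(∫ z in Metric.closedBall (0 : EE d) 1, (κ * r + h * c⁻¹ * s z) * (φ (x + h • z) - φ x))
      - ∫ z in Metric.closedBall (0 : EE d) 1, (κ * r * h * b1 z + (κ * r * h ^ 2 / 2 * b2 z + h ^ 2 * c⁻¹ * (s z * b1 z)))|
      ≤ ((κ + c⁻¹ * (d * Λ)) * M * h ^ 3 * |r|) * vol := by
    rw [← integral_sub (SI (by fun_prop)) (SI (by fun_prop))]
    have hfin : (volume : Measure (EE d)) (Metric.closedBall 0 1) < ⊤ := measure_closedBall_lt_top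
    rw [← Real.norm_eq_abs]
    have hb : ∀ z ∈ Metric.closedBall (0 : EE d) 1, ‖(κ * r + h * c⁻¹ * s z) * (φ (x + h • z) - φ x) -
        (κ * r * h * b1 z + (κ * r * h ^ 2 / 2 * b2 z + h ^ 2 * c⁻¹ * (s z * b1 z)))‖ ≤ (κ + c⁻¹ * (d * Λ)) * M * h ^ 3 * |r| := by
      intro z hz
      have hz1 : ‖z‖ ≤ 1 := by simpa using hz
      have e1 : ∑ i, (h • z) i * pd i φ x = h * b1 z := by
        rw [hb1, Finset.mul_sum]; refine Finset.sum_congr rfl fun i _ => by simp; ring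
      have e2 : (1 / 2) * ∑ i, ∑ j, (h • z) i * (h • z) j * pd2 i j φ x = h ^ 2 / 2 * b2 z := by
        rw [hb2, Finset.mul_sum, Finset.mul_sum]; refine Finset.sum_congr rfl fun i _ => ?_
        rw [Finset.mul_sum, Finset.mul_sum]; refine Finset.sum_congr rfl fun j _ => by simp; ring
      have nz : ‖h • z‖ ≤ h := by
        rw [norm_smul, Real.norm_of_nonneg hh.le]; nlinarith
      have n2 := hM.t2 x (h • z)
      have n3 := hM.t3 x (h • z)
      rw [e1] at n2; rw [e1, e2] at n3
      have n2' : |φ (x + h • z) - φ x - h * b1 z| ≤ M * h ^ 2 := n2.trans (by gcongr)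
      have n3' : |φ (x + h • z) - φ x - h * b1 z - h ^ 2 / 2 * b2 z| ≤ M * h ^ 3 := n3.trans (by gcongr)
      have ns : |s z| ≤ d * (Λ * |r|) := by
        refine (sum_le_dK fun i => H.abs i x r).trans ?_
        exact mul_le_of_le_one_right (by positivity) hz1
      have eq : (κ * r + h * c⁻¹ * s z) * (φ (x + h • z) - φ x) -
        (κ * r * h * b1 z + (κ * r * h ^ 2 / 2 * b2 z + h ^ 2 * c⁻¹ * (s z * b1 z)))
        = κ * r * (φ (x + h • z) - φ x - h * b1 z - h ^ 2 / 2 * b2 z)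
          + h * c⁻¹ * (s z * (φ (x + h • z) - φ x - h * b1 z)) := by ring
      rw [eq, Real.norm_eq_abs]
      refine (abs_add_le _ _).trans ?_
      rw [abs_mul, abs_mul, abs_mul (h * c⁻¹), abs_mul (s z), abs_of_nonneg hκ, abs_of_pos (by positivity : 0 < h * c⁻¹)]
      calc _ ≤ κ * |r| * (M * h ^ 3) + h * c⁻¹ * (d * (Λ * |r|) * (M * h ^ 2)) := by gcongr
        _ = _ := by ring
    exact norm_setIntegral_le_of_norm_le_const hfin hb
  rw [i0] at key
  set I := ∫ z in Metric.closedBall (0 : EE d) 1, (κ * r + h * c⁻¹ * s z) * (φ (x + h • z) - φ x)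
  set T := κ * c / 2 * r * (∑ i, pd2 i i φ x) + ∑ i, V i x r * pd i φ x
  have e5 : (h ^ 2)⁻¹ * I - T = (h ^ 2)⁻¹ * (I - h ^ 2 * T) := by
    rw [mul_sub, ← mul_assoc _ (h ^ 2), inv_mul_cancel₀ (by positivity), one_mul]
  rw [e5, abs_mul, abs_of_pos (by positivity)]
  calc (h ^ 2)⁻¹ * _ ≤ (h ^ 2)⁻¹ * (((κ + c⁻¹ * (d * Λ)) * M * h ^ 3 * |r|) * vol) := by gcongr
    _ = (h ^ 2)⁻¹ * h ^ 2 * ((κ + c⁻¹ * (d * Λ)) * vol * M * h * |r|) := by ring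
    _ = _ := by rw [inv_mul_cancel₀ (by positivity), one_mul]

lemma aux_add {X1 X2 Y1 Y2 C1 C2 M h r : ℝ} (k1 : |X1 - Y1| ≤ C1 * M * h * r) (k2 : |X2 - Y2| ≤ C2 * M * h * r) :
    |X1 + X2 - (Y1 + Y2)| ≤ (C1 + C2) * M * h * r := by
  rw [add_sub_add_comm]
  exact (abs_add_le _ _).trans ((add_le_add k1 k2).trans_eq (by ring))

lemma slice1 {F : EE d → EE d → ℝ → ℝ} (hF : Measurable fun p : EE d × EE d × ℝ => F p.1 p.2.1 p.2.2)
    (x : EE d) (r : ℝ) : Measurable fun y => F y x r :=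
  hF.comp (measurable_id.prodMk (measurable_const (a := (x, r))))

lemma K2_int1 (HV : Dr V Λ) (hc : 0 < c) (hκ : 0 < κ) {h : ℝ} (hh : 0 < h) (x : EE d) (r : ℝ) :
    Integrable fun y => K2 κ c V h y x r := by
  have m2 : Measurable fun y => K2 κ c V h y x r := slice1 (HV.K2_meas h) x r
  have this : Integrable ((Metric.closedBall (0 : EE d) h).indicator
      (fun _ => (h ^ (d + 2))⁻¹ * (κ + c⁻¹ * (d * Λ * h)))) :=
    (integrable_indicator_iff measurableSet_closedBall).2 (integrableOn_const measure_closedBall_lt_top.ne)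
  refine ((this.comp_sub_right x).mul_const |r|).mono' m2.aestronglyMeasurable (Eventually.of_forall fun y => ?_)
  have h1 := HV.K2_lip hh hc hκ.le y x r 0
  have z0 : K2 κ c V h y x 0 = 0 := by simp [K2, HV.zero]
  rw [z0] at h1
  simp only [sub_zero] at h1
  rw [Real.norm_eq_abs]
  exact h1

lemma JL_add {Φ1 Φ2 : EE d → EE d → ℝ → ℝ} {φ : EE d → ℝ} (hφ : Measurable φ) {M : ℝ} (hM : ∀ y, |φ y| ≤ M)
    (x : EE d) (r : ℝ) (I1 : Integrable fun y => Φ1 y x r + Φ2 y x r) (I2 : Integrable fun y => Φ2 y x r) :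
    JL (fun y x r => Φ1 y x r + Φ2 y x r) φ x r = JL Φ1 φ x r + JL Φ2 φ x r := by
  have mf : Measurable fun y : EE d => φ y - φ x := hφ.sub_const _
  have bf : ∀ y, ‖φ y - φ x‖ ≤ M + M := fun y => (norm_sub_le _ _).trans (add_le_add (hM y) (hM x))
  have I3 : Integrable fun y => Φ1 y x r := by
    refine (I1.sub I2).congr (Eventually.of_forall fun y => ?_)
    simp
  simp only [JL]
  rw [← integral_add (I3.mul_bdd mf.aestronglyMeasurable (Eventually.of_forall bf))
      (I2.mul_bdd mf.aestronglyMeasurable (Eventually.of_forall bf))]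
  congr 1; funext y; ring

lemma JL_KK (H : Lev χ w A' P R K) (HV : Dr V Λ) (hc : 0 < c) (hκ : 0 < κ) {h : ℝ} (hh : 0 < h)
    (hs : c⁻¹ * (d * Λ * h) ≤ κ) {φ : EE d → ℝ} (hφ : TF φ) {M : ℝ} (hM : TK φ M) (x : EE d) (r : ℝ) :
    JL (KK χ w κ c V h) φ x r = JL (K1 χ w h) φ x r + JL (K2 κ c V h) φ x r :=
  JL_add (Φ1 := K1 χ w h) (Φ2 := K2 κ c V h) hφ.meas hM.bd x r ((KK_jump H HV hh hc hκ.le hs).int1 x r) (K2_int1 HV hc hκ hh x r)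

/-- consistency of the full kernel -/
lemma KK_cons (H : Lev χ w A' P R K) (HV : Dr V Λ) (hc : 0 < c) (hκ : 0 < κ)
    (hmom : ∀ k l : Fin d, ∫ z in Metric.closedBall (0 : EE d) 1, z k * z l = if k = l then c else 0) :
    ∃ C, 0 ≤ C ∧ ∀ h, 0 < h → h ≤ 1 → c⁻¹ * (d * Λ * h) ≤ κ → ∀ φ, TF φ → ∀ Kφ, TK φ Kφ → ∀ x r,
    |JL (KK χ w κ c V h) φ x r - (((∑ i, pd i φ x * ∑ j, ∫ p, pd j χ (x - p) * A' i j p r)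
      + ∑ i, ∑ j, pd2 i j φ x * ∫ p, χ (x - p) * A' i j p r)
      + (κ * c / 2 * r * (∑ i, pd2 i i φ x) + ∑ i, V i x r * pd i φ x))| ≤ C * Kφ * h * |r| := by
  obtain ⟨C1, h1, H1⟩ := H.cons1
  obtain ⟨C2, h2, H2⟩ := HV.cons2 hc hκ.le hmom
  refine ⟨C1 + C2, by positivity, fun h hh hh1 hs φ hφ M hM x r => ?_⟩
  have k1 := H1 h hh hh1 φ hφ M hM x r
  have k2 := H2 h hh φ hφ M hM x r
  rw [JL_KK H HV hc hκ hh hs hφ hM x r]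
  generalize JL (K1 χ w h) φ x r = X1 at k1 ⊢
  generalize JL (K2 κ c V h) φ x r = X2 at k2 ⊢
  exact aux_add k1 k2

end Drift

section Energy
variable {d : ℕ}

/-- indicator of a ball -/
noncomputable def iB (d : ℕ) (h : ℝ) (z : EE d) : ℝ :=
  (Metric.closedBall (0 : EE d) h).indicator (fun _ => (1 : ℝ)) z

lemma iB_meas (h : ℝ) : Measurable (iB d h) := measurable_const.indicator measurableSet_closedBall

lemma iB_int (h : ℝ) : Integrable (iB d h) :=
  (integrable_indicator_iff measurableSet_closedBall).2 (integrableOn_const measure_closedBall_lt_top.ne)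

lemma iB_neg (h : ℝ) (z : EE d) : iB d h (-z) = iB d h z := by
  simp [iB, Set.indicator]

lemma iB_nn (h : ℝ) (z : EE d) : 0 ≤ iB d h z := Set.indicator_nonneg (fun _ _ => zero_le_one) _

lemma iB_S {v : EE d → ℝ} (hv : Integrable v) (h : ℝ) :
    Integrable (fun p : EE d × EE d => iB d h (p.1 - p.2) * v p.2) (volume.prod volume) := by
  have := Integrable.convolution_integrand (ContinuousLinearMap.mul ℝ ℝ) hv (iB_int (d := d) h)
  refine this.congr (Eventually.of_forall fun p => ?_)
  simp [mul_comm]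

lemma iB_S_val {v : EE d → ℝ} (hv : Integrable v) (h : ℝ) :
    ∫ p : EE d × EE d, iB d h (p.1 - p.2) * v p.2 ∂(volume.prod volume) =
      (volume : Measure (EE d)).real (Metric.closedBall 0 h) * ∫ x, v x := by
  rw [integral_prod_symm _ (iB_S hv h)]
  have : ∀ x : EE d, ∫ y, iB d h (y - x) * v x = (volume : Measure (EE d)).real (Metric.closedBall 0 h) * v x := by
    intro x
    rw [integral_mul_const, integral_sub_right_eq_self (iB d h) x]
    congr 1
    simp only [iB]
    rw [integral_indicator measurableSet_closedBall]
    simp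
  simp only [this, integral_const_mul]

lemma EN_eq {u : EE d → ℝ} (hu : Integrable u) (hm : Measurable u) {M : ℝ}
    (hM : ∀ x, |u x| ≤ M) (h : ℝ) :
    Integrable (fun p : EE d × EE d => iB d h (p.1 - p.2) * (u p.1 - u p.2) ^ 2) (volume.prod volume) ∧
    ∫ p : EE d × EE d, iB d h (p.1 - p.2) * (u p.1 - u p.2) ^ 2 ∂(volume.prod volume) = (EN h u).toReal := by
  have S := iB_S (int_sq hu hM) h
  have mE : Measurable (fun p : EE d × EE d => iB d h (p.1 - p.2) * (u p.1 - u p.2) ^ 2) :=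
    ((iB_meas h).comp (measurable_fst.sub measurable_snd)).mul
      (((hm.comp measurable_fst).sub (hm.comp measurable_snd)).pow_const 2)
  have I : Integrable (fun p : EE d × EE d => iB d h (p.1 - p.2) * (u p.1 - u p.2) ^ 2) (volume.prod volume) := by
    refine ((S.add S.swap).const_mul 2).mono' mE.aestronglyMeasurable (Eventually.of_forall fun p => ?_)
    have e : iB d h (p.2 - p.1) = iB d h (p.1 - p.2) := by rw [← iB_neg, neg_sub]
    have n := iB_nn h (p.1 - p.2)
    rw [Real.norm_of_nonneg (by positivity)]
    simp only [Pi.add_apply, Function.comp, Prod.fst_swap, Prod.snd_swap, e]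
    nlinarith [mul_nonneg n (sq_nonneg (u p.1 + u p.2))]
  refine ⟨I, ?_⟩
  rw [integral_prod_symm _ I]
  have IE := I.integral_prod_right
  have key : ∀ x : EE d, ∫ y, iB d h (y - x) * (u y - u x) ^ 2 = ∫ ζ, iB d h ζ * (u (x + ζ) - u x) ^ 2 := by
    intro x
    rw [← integral_sub_right_eq_self (fun ζ => iB d h ζ * (u (x + ζ) - u x) ^ 2) x]
    simp
  have n0 : ∀ p : EE d × EE d, 0 ≤ iB d h p.2 * (u (p.1 + p.2) - u p.1) ^ 2 := fun p =>
    mul_nonneg (iB_nn _ _) (sq_nonneg _)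
  have m2 : Measurable (fun p : EE d × EE d => iB d h p.2 * (u (p.1 + p.2) - u p.1) ^ 2) :=
    ((iB_meas h).comp measurable_snd).mul
      (((hm.comp (measurable_fst.add measurable_snd)).sub (hm.comp measurable_fst)).pow_const 2)
  have e1 : ∫ x : EE d, ∫ y, iB d h (y - x) * (u y - u x) ^ 2 = 
      (∫⁻ x : EE d, ∫⁻ ζ, ENNReal.ofReal (iB d h ζ * (u (x + ζ) - u x) ^ 2)).toReal := by
    rw [integral_eq_lintegral_of_nonneg_ae (Eventually.of_forall fun x => integral_nonneg fun y => mul_nonneg (iB_nn _ _) (sq_nonneg _))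
      IE.aestronglyMeasurable]
    congr 1
    refine lintegral_congr_ae ?_
    filter_upwards [I.prod_left_ae] with x hx
    have hx' : Integrable fun ζ => iB d h ζ * (u (x + ζ) - u x) ^ 2 := by
      have := hx.comp_add_left x
      simpa using this
    rw [key, ofReal_integral_eq_lintegral_ofReal hx' (Eventually.of_forall fun ζ => n0 (x, ζ))]
  have e2 : ∫⁻ x : EE d, ∫⁻ ζ, ENNReal.ofReal (iB d h ζ * (u (x + ζ) - u x) ^ 2) = EN h u := by
    rw [lintegral_lintegral_swap m2.ennreal_ofReal.aemeasurable, EN, ← lintegral_indicator measurableSet_closedBall]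
    congr 1; funext ζ
    by_cases hζ : ζ ∈ Metric.closedBall (0 : EE d) h
    · rw [Set.indicator_of_mem hζ]; simp [iB, Set.indicator_of_mem hζ, GG]
    · rw [Set.indicator_of_notMem hζ]; simp [iB, Set.indicator_of_notMem hζ]
  rw [e1, e2]

lemma energy_gen {Φ : EE d → EE d → ℝ → ℝ} {q : EE d → ℝ} (J : JumpK Φ q) {h α β : ℝ}
    (hpt : ∀ y x ux uy, Φ y x ux * (uy - ux) + Φ x y uy * (ux - uy) ≤
      iB d h (y - x) * (-(2 * α) * (uy - ux) ^ 2 + β * (ux ^ 2 + uy ^ 2)))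
    {u : EE d → ℝ} (hu : Integrable u) (hm : Measurable u) {M : ℝ} (hM : ∀ x, |u x| ≤ M) :
    α * (EN h u).toReal + ∫ x, JL Φ u x (u x) ≤
      β * ((volume : Measure (EE d)).real (Metric.closedBall 0 h) * ∫ x, u x ^ 2) := by
  have hM0 : 0 ≤ M := (abs_nonneg _).trans (hM 0)
  set T : EE d × EE d → ℝ := fun p => Φ p.1 p.2 (u p.2) * (u p.1 - u p.2) with hT
  have iT : Integrable T (volume.prod volume) := by
    refine J.int_of_le hu ((J.measH hm).mul ((hm.comp measurable_fst).sub
      (hm.comp measurable_snd))) (M + M) fun y x => ?_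
    simp only [hT]
    rw [abs_mul, mul_comm]
    exact mul_le_mul ((abs_sub _ _).trans (add_le_add (hM _) (hM _))) (J.absle _ _ _)
      (abs_nonneg _) (by positivity)
  have e1 : ∫ x, JL Φ u x (u x) = ∫ p, T p ∂(volume.prod volume) := by
    rw [integral_prod_symm _ iT]; rfl
  have e2 : ∫ p, T p.swap ∂(volume.prod volume) = ∫ p, T p ∂(volume.prod volume) := integral_prod_swap T
  have S := iB_S (int_sq hu hM) h
  have sv := iB_S_val (int_sq hu hM) h
  obtain ⟨iE, eE⟩ := EN_eq hu hm hM h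
  set Sf : EE d × EE d → ℝ := fun p => iB d h (p.1 - p.2) * u p.2 ^ 2 with hS
  have sv2 : ∫ p, Sf p.swap ∂(volume.prod volume) = ∫ p, Sf p ∂(volume.prod volume) := integral_prod_swap Sf
  have iS2 : Integrable (fun p => Sf p.swap) (volume.prod volume) := S.swap
  have iT2 : Integrable (fun p => T p.swap) (volume.prod volume) := iT.swap
  have iSS : Integrable (fun p => β * (Sf p + Sf p.swap)) (volume.prod volume) := (S.add iS2).const_mul β
  have main : ∫ p, (T p + T p.swap) ∂(volume.prod volume) ≤
      ∫ p, (-(2 * α) * (iB d h (p.1 - p.2) * (u p.1 - u p.2) ^ 2) + β * (Sf p + Sf p.swap)) ∂(volume.prod volume) := by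
    refine integral_mono (iT.add iT2) ((iE.const_mul _).add ((S.add iS2).const_mul β)) fun p => ?_
    have := hpt p.1 p.2 (u p.2) (u p.1)
    have e : iB d h (p.2 - p.1) = iB d h (p.1 - p.2) := by rw [← iB_neg, neg_sub]
    simp only [hT, hS, Prod.fst_swap, Prod.snd_swap, e]
    linarith
  rw [integral_add iT iT2, integral_add (iE.const_mul _) iSS, integral_const_mul,
    integral_const_mul, integral_add S iS2, sv2, e2, sv, eE] at main
  rw [e1]
  linarith

variable {V : Fin d → EE d → ℝ → ℝ} {Λ κ c : ℝ}
variable {χ : EE d → ℝ} {w : EE d → EE d → ℝ → ℝ} {A' : Fin d → Fin d → EE d → ℝ → ℝ} {P R K : ℝ}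

lemma KK_pt (H : Lev χ w A' P R K) {h Vb : ℝ} (hh : 0 < h) (hκ : 0 < κ) (hVb : 0 ≤ Vb)
    (hV : ∀ i x r, |V i x r| ≤ Vb * |r|) (y x : EE d) (ux uy : ℝ) :
    KK χ w κ c V h y x ux * (uy - ux) + KK χ w κ c V h x y uy * (ux - uy) ≤
      iB d h (y - x) * (-(2 * (κ / 4 * (h ^ (d + 2))⁻¹)) * (uy - ux) ^ 2
        + ((h ^ (d + 2))⁻¹ * h ^ 2 * ((c⁻¹ * d * Vb) ^ 2 / κ)) * (ux ^ 2 + uy ^ 2)) := by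
  have p1 : K1 χ w h y x ux * (uy - ux) + K1 χ w h x y uy * (ux - uy) ≤ 0 := by
    rw [H.K1_symm h x y]
    rcases le_total ux uy with h0 | h0
    · have := H.K1_mono hh y x h0
      nlinarith
    · have := H.K1_mono hh y x h0
      nlinarith
  have p2 : K2 κ c V h y x ux * (uy - ux) + K2 κ c V h x y uy * (ux - uy) ≤
      iB d h (y - x) * (-(2 * (κ / 4 * (h ^ (d + 2))⁻¹)) * (uy - ux) ^ 2
        + ((h ^ (d + 2))⁻¹ * h ^ 2 * ((c⁻¹ * d * Vb) ^ 2 / κ)) * (ux ^ 2 + uy ^ 2)) := by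
    have hi : x - y ∈ Metric.closedBall (0 : EE d) h ↔ y - x ∈ Metric.closedBall (0 : EE d) h := by
      simp [norm_sub_rev]
    by_cases hz : y - x ∈ Metric.closedBall (0 : EE d) h
    · have hζ : ‖y - x‖ ≤ h := by simpa using hz
      have hζ2 : ‖x - y‖ ≤ h := by rwa [norm_sub_rev]
      rw [K2, K2, iB, Set.indicator_of_mem hz, Set.indicator_of_mem (hi.2 hz), Set.indicator_of_mem hz, one_mul]
      have s1 : |∑ i, (y - x) i * V i x ux| ≤ d * (Vb * |ux|) * h :=
        (sum_le_dK fun i => hV i x ux).trans (by gcongr)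
      have s2 : |∑ i, (x - y) i * V i y uy| ≤ d * (Vb * |uy|) * h :=
        (sum_le_dK fun i => hV i y uy).trans (by gcongr)
      set a1 := ∑ i, (y - x) i * V i x ux
      set a2 := ∑ i, (x - y) i * V i y uy
      have t1 : (c⁻¹ * a1) ^ 2 ≤ h ^ 2 * (c⁻¹ * d * Vb) ^ 2 * ux ^ 2 := by
        have : |a1| ^ 2 ≤ (d * (Vb * |ux|) * h) ^ 2 := pow_le_pow_left₀ (abs_nonneg _) s1 2
        rw [sq_abs] at this
        have := mul_le_mul_of_nonneg_left this (sq_nonneg c⁻¹)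
        calc _ = c⁻¹ ^ 2 * a1 ^ 2 := by ring
          _ ≤ _ := this
          _ = h ^ 2 * (c⁻¹ * d * Vb) ^ 2 * |ux| ^ 2 := by ring
          _ = _ := by rw [sq_abs]
      have t2 : (c⁻¹ * a2) ^ 2 ≤ h ^ 2 * (c⁻¹ * d * Vb) ^ 2 * uy ^ 2 := by
        have : |a2| ^ 2 ≤ (d * (Vb * |uy|) * h) ^ 2 := pow_le_pow_left₀ (abs_nonneg _) s2 2
        rw [sq_abs] at this
        have := mul_le_mul_of_nonneg_left this (sq_nonneg c⁻¹)
        calc _ = c⁻¹ ^ 2 * a2 ^ 2 := by ring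
          _ ≤ _ := this
          _ = h ^ 2 * (c⁻¹ * d * Vb) ^ 2 * |uy| ^ 2 := by ring
          _ = _ := by rw [sq_abs]
      set D := h ^ 2 * (c⁻¹ * d * Vb) ^ 2 with hD
      set b1 := c⁻¹ * a1
      set b2 := c⁻¹ * a2
      set Hh := (h ^ (d + 2))⁻¹
      have hH : 0 ≤ Hh := by positivity
      have q : (uy - ux) * (b1 - b2) ≤ κ / 2 * (uy - ux) ^ 2 + κ⁻¹ * (b1 ^ 2 + b2 ^ 2) := by
        have q1 : 0 ≤ κ⁻¹ * (κ * (uy - ux) - (b1 - b2)) ^ 2 := by positivity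
        have q2 : 0 ≤ κ⁻¹ * (b1 + b2) ^ 2 := by positivity
        have q3 : κ⁻¹ * κ = 1 := inv_mul_cancel₀ hκ.ne'
        have q4 : κ⁻¹ * (κ * (uy - ux) - (b1 - b2)) ^ 2 = (κ⁻¹ * κ) * (κ * (uy - ux) ^ 2)
          - 2 * (κ⁻¹ * κ) * ((uy - ux) * (b1 - b2)) + κ⁻¹ * (b1 - b2) ^ 2 := by ring
        rw [q4, q3] at q1
        nlinarith
      have q5 : κ⁻¹ * (b1 ^ 2 + b2 ^ 2) ≤ κ⁻¹ * (D * ux ^ 2 + D * uy ^ 2) := by gcongr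
      have q6 : (κ * ux + b1) * (uy - ux) + (κ * uy + b2) * (ux - uy) ≤
         -(κ / 2) * (uy - ux) ^ 2 + κ⁻¹ * (D * ux ^ 2 + D * uy ^ 2) := by nlinarith
      calc _ = Hh * ((κ * ux + b1) * (uy - ux) + (κ * uy + b2) * (ux - uy)) := by ring
        _ ≤ Hh * (-(κ / 2) * (uy - ux) ^ 2 + κ⁻¹ * (D * ux ^ 2 + D * uy ^ 2)) := by gcongr
        _ = _ := by rw [hD, div_eq_mul_inv _ κ]; ring
    · rw [K2, K2, iB, Set.indicator_of_notMem hz, Set.indicator_of_notMem (fun h' => hz (hi.1 h')), Set.indicator_of_notMem hz]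
      simp
  simp only [KK]
  linarith

lemma KK_energy (H : Lev χ w A' P R K) (HV : Dr V Λ) {h Vb : ℝ} (hh : 0 < h) (hc : 0 < c) (hκ : 0 < κ) (hVb : 0 ≤ Vb)
    (hs : c⁻¹ * (d * Λ * h) ≤ κ) (hV : ∀ i x r, |V i x r| ≤ Vb * |r|)
    {u : EE d → ℝ} (hu : Integrable u) (hm : Measurable u) {M : ℝ} (hM : ∀ x, |u x| ≤ M) :
    κ / 4 * (h ^ (d + 2))⁻¹ * (EN h u).toReal + ∫ x, JL (KK χ w κ c V h) u x (u x) ≤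
      ((c⁻¹ * d * Vb) ^ 2 / κ * (volume : Measure (EE d)).real (Metric.closedBall 0 1)) * ∫ x, u x ^ 2 := by
  refine (energy_gen (KK_jump H HV hh hc hκ.le hs) (KK_pt H hh hκ hVb hV) hu hm hM).trans_eq ?_
  have e : (volume : Measure (EE d)).real (Metric.closedBall 0 h) =
      h ^ d * (volume : Measure (EE d)).real (Metric.closedBall 0 1) := by
    rw [Measure.addHaar_real_closedBall _ _ hh.le, Measure.addHaar_real_closedBall _ _ zero_le_one]
    simp
  have e2 : (h ^ (d + 2))⁻¹ * h ^ 2 * h ^ d = 1 := by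
    rw [mul_assoc, ← pow_add, add_comm 2 d, inv_mul_cancel₀ (by positivity)]
  rw [e]
  linear_combination ((c⁻¹ * d * Vb) ^ 2 / κ * (volume : Measure (EE d)).real (Metric.closedBall 0 1) * ∫ x, u x ^ 2) * e2

end Energy

section Density
variable {d : ℕ}

/-- truncation -/
noncomputable def clip (N r : ℝ) : ℝ := max (-N) (min N r)

lemma clip_mono (N : ℝ) : Monotone (clip N) := fun _ _ h => max_le_max le_rfl (min_le_min le_rfl h)

lemma clip_cont (N : ℝ) : Continuous (clip N) := by unfold clip; fun_prop

lemma clip_lip (N r s : ℝ) : |clip N r - clip N s| ≤ |r - s| := by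
  unfold clip
  refine (abs_max_sub_max_le_max _ _ _ _).trans ?_
  simp only [sub_self, abs_zero, abs_nonneg, sup_of_le_right]
  refine (abs_min_sub_min_le_max _ _ _ _).trans ?_
  simp

lemma clip_zero {N : ℝ} (hN : 0 ≤ N) : clip N 0 = 0 := by simp [clip, hN]

lemma clip_abs {N : ℝ} (hN : 0 ≤ N) (r : ℝ) : |clip N r| ≤ |r| := by
  simpa [clip_zero hN] using clip_lip N r 0

lemma clip_le {N : ℝ} (hN : 0 ≤ N) (r : ℝ) : |clip N r| ≤ N :=
  abs_le.2 ⟨le_max_left _ _, max_le (by linarith) (min_le_left _ _)⟩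

lemma clip_id {N r : ℝ} (h : |r| ≤ N) : clip N r = r := by
  have := abs_le.1 h
  rw [clip, min_eq_right this.2, max_eq_right this.1]

lemma lev_of_density {χ : EE d → ℝ} (hχ : TF χ) (hχ0 : ∀ x, 0 ≤ χ x) {g : EE d → ℝ → EE d → ℝ}
    {P R G N : ℝ} (hR : 0 ≤ R) (hG : 0 ≤ G) (hN : 0 ≤ N)
    (hm : Measurable fun p : EE d × ℝ × EE d => g p.1 p.2.1 p.2.2)
    (h0 : ∀ p s z, 0 ≤ g p s z) (h1 : ∀ p s z, g p s z ≤ G)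
    (hs : ∀ p s z, (P < ‖p‖ ∨ R < ‖z‖) → g p s z = 0) (he : ∀ p s z, g p s (-z) = g p s z)
    {B A' : Fin d → Fin d → EE d → ℝ → ℝ} (hB : ∀ i j p s, ∫ z, g p s z * (z i * z j) = 2 * B i j p s)
    (hA : ∀ i j p r, A' i j p r = ∫ s in (0 : ℝ)..clip N r, B i j p s) :
    Lev χ (fun p z r => ∫ s in (0 : ℝ)..clip N r, g p s z) A' P R G := by
  have e : ∀ p z r, ∫ s in (0 : ℝ)..r, g p s z = r * ∫ t in Set.Ioc (0 : ℝ) 1, g p (r * t) z := by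
    intro p z r
    rw [← intervalIntegral.integral_of_le zero_le_one, intervalIntegral.mul_integral_comp_mul_left (f := fun s => g p s z)]
    simp
  have eB : ∀ i j p r, ∫ s in (0 : ℝ)..r, B i j p s = r * ∫ t in Set.Ioc (0 : ℝ) 1, B i j p (r * t) := by
    intro i j p r
    rw [← intervalIntegral.integral_of_le zero_le_one, intervalIntegral.mul_integral_comp_mul_left (f := fun s => B i j p s)]
    simp
  have II : ∀ p z r s, IntervalIntegrable (fun s => g p s z) volume r s := by
    intro p z r s
    have hmm : Measurable fun s => g p s z :=
      hm.comp (measurable_const.prodMk (measurable_id.prodMk measurable_const))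
    refine (intervalIntegrable_const (c := G)).mono_fun hmm.aestronglyMeasurable (Eventually.of_forall fun t => ?_)
    dsimp only
    rw [Real.norm_of_nonneg (h0 _ _ _), Real.norm_of_nonneg hG]
    exact h1 _ _ _
  have D : ∀ p z r s, (∫ t in (0 : ℝ)..r, g p t z) - ∫ t in (0 : ℝ)..s, g p t z = ∫ t in s..r, g p t z :=
    fun p z r s => intervalIntegral.integral_interval_sub_left (II p z _ _) (II p z _ _)
  refine ⟨hχ, hχ0, ?_, fun p z r h => ?_, fun p z => ?_, fun p z r s h => ?_, fun p z r s => ?_, fun p z r => ?_,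
    fun i j p r => ?_, hR, hG⟩
  · simp only [e]
    refine Measurable.mul ((clip_cont N).measurable.comp (measurable_snd.comp measurable_snd)) ?_
    have h2 : Measurable fun q : (EE d × EE d × ℝ) × ℝ => g q.1.1 (clip N q.1.2.2 * q.2) q.1.2.1 := by
      have hc := (clip_cont N).measurable
      exact hm.comp (by fun_prop : Measurable fun q : (EE d × EE d × ℝ) × ℝ => (q.1.1, clip N q.1.2.2 * q.2, q.1.2.1))
    exact (h2.stronglyMeasurable.integral_prod_right (ν := volume.restrict (Set.Ioc (0 : ℝ) 1))).measurable
  · simp [hs p _ z h]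
  · simp [clip_zero hN]
  · have := D p z (clip N s) (clip N r)
    have h3 : 0 ≤ ∫ t in clip N r..clip N s, g p t z :=
      intervalIntegral.integral_nonneg (clip_mono N h) fun t _ => h0 _ _ _
    linarith
  · rw [D]
    have hb : ∀ t ∈ Set.uIoc (clip N s) (clip N r), ‖g p t z‖ ≤ G := fun t _ => by
      rw [Real.norm_of_nonneg (h0 _ _ _)]; exact h1 _ _ _
    exact (intervalIntegral.norm_integral_le_of_norm_le_const hb).trans
      (mul_le_mul_of_nonneg_left (clip_lip N r s) hG)
  · simp [he]
  · rw [hA, eB]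
    simp only [e]
    set r' := clip N r
    have mm : Measurable fun q : EE d × ℝ => g p (r' * q.2) q.1 * (q.1 i * q.1 j) := by
      refine Measurable.mul (hm.comp (by fun_prop : Measurable fun q : EE d × ℝ => (p, r' * q.2, q.1))) ?_
      exact ((measurable_pi_apply i).comp measurable_fst).mul ((measurable_pi_apply j).comp measurable_fst)
    have IP : Integrable (fun q : EE d × ℝ => g p (r' * q.2) q.1 * (q.1 i * q.1 j))
        (volume.prod (volume.restrict (Set.Ioc (0 : ℝ) 1))) := by
      have k1 : Integrable ((Metric.closedBall (0 : EE d) R).indicator fun _ => G * (R * R)) :=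
        (integrable_indicator_iff measurableSet_closedBall).2 (integrableOn_const measure_closedBall_lt_top.ne)
      have k2 : Integrable (fun _ : ℝ => (1 : ℝ)) (volume.restrict (Set.Ioc (0 : ℝ) 1)) := integrable_const 1
      refine (k1.mul_prod k2).mono' mm.aestronglyMeasurable (Eventually.of_forall fun q => ?_)
      by_cases hq : ‖q.1‖ ≤ R
      · rw [Set.indicator_of_mem (by simpa using hq), mul_one, Real.norm_eq_abs, abs_mul, abs_of_nonneg (h0 _ _ _), abs_mul]
        have c1 : |q.1 i| ≤ R := (norm_le_pi_norm q.1 i).trans hq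
        have c2 : |q.1 j| ≤ R := (norm_le_pi_norm q.1 j).trans hq
        have := h1 p (r' * q.2) q.1
        gcongr
      · rw [hs _ _ _ (Or.inr (not_le.1 hq)), Set.indicator_of_notMem (by simpa using hq)]; simp
    have sw := integral_integral_swap (f := fun z t => g p (r' * t) z * (z i * z j)) IP
    simp only [hB] at sw
    rw [integral_const_mul] at sw
    have : ∀ z : EE d, (r' * ∫ t in Set.Ioc (0 : ℝ) 1, g p (r' * t) z) * (z i * z j)
        = r' * ∫ t in Set.Ioc (0 : ℝ) 1, g p (r' * t) z * (z i * z j) := by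
      intro z; rw [integral_mul_const]; ring
    simp only [this]
    rw [integral_const_mul, sw]; ring

end Density

section Coeff
variable {d : ℕ}

/-- the standing hypotheses -/
structure Hyp (a : Fin d → Fin d → EE d → ℝ → ℝ) (b : Fin d → EE d → ℝ → ℝ) (γ Q : ℝ) : Prop where
  smooth : ∀ i j, ContDiff ℝ 2 (fun p : EE d × ℝ => a i j p.1 p.2)
  abd : ∀ i j x r, |a i j x r| ≤ Q
  axbd : ∀ i j x r, ‖fderiv ℝ (fun y => a i j y r) x‖ ≤ Q
  symm : ∀ i j x r, a i j x r = a j i x r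
  γpos : 0 < γ
  ell : ∀ (x ξ : EE d) (r : ℝ),
      γ * ∑ i, ξ i ^ 2 ≤ ∑ i, ∑ j, (a i j x r + r * deriv (fun s => a i j x s) r) * ξ i * ξ j
  bsmooth : ∀ i, ContDiff ℝ 1 (fun p : EE d × ℝ => b i p.1 p.2)
  bbd : ∀ i x r, |b i x r| ≤ Q
  Qnn : 0 ≤ Q

variable {a : Fin d → Fin d → EE d → ℝ → ℝ} {b : Fin d → EE d → ℝ → ℝ} {γ Q : ℝ}

/-- the matrix of the symmetric part -/
noncomputable def MM (a : Fin d → Fin d → EE d → ℝ → ℝ) (γ : ℝ) (p : EE d) (s : ℝ) : Matrix (Fin d) (Fin d) ℝ :=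
  Matrix.of fun i j => a i j p s + s * deriv (fun t => a i j p t) s - if i = j then γ / 2 else 0

lemma Hyp.diff_r (H : Hyp a b γ Q) (i j : Fin d) (p : EE d) (s : ℝ) :
    HasDerivAt (fun t => a i j p t) (fderiv ℝ (fun p : EE d × ℝ => a i j p.1 p.2) (p, s) (0, 1)) s := by
  have h1 : HasFDerivAt (fun p : EE d × ℝ => a i j p.1 p.2) (fderiv ℝ (fun p : EE d × ℝ => a i j p.1 p.2) (p, s)) (p, s) :=
    ((H.smooth i j).differentiable (by simp) (p, s)).hasFDerivAt
  have h2 : HasDerivAt (fun t : ℝ => ((p, t) : EE d × ℝ)) (0, 1) s := (hasDerivAt_const s p).prodMk (hasDerivAt_id s)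
  exact h1.comp_hasDerivAt s h2

lemma Hyp.deriv_cont (H : Hyp a b γ Q) (i j : Fin d) :
    Continuous fun q : EE d × ℝ => deriv (fun t => a i j q.1 t) q.2 := by
  have e : (fun q : EE d × ℝ => deriv (fun t => a i j q.1 t) q.2) =
      fun q => fderiv ℝ (fun p : EE d × ℝ => a i j p.1 p.2) q (0, 1) := by
    funext q; exact (H.diff_r i j q.1 q.2).deriv
  rw [e]
  exact ((H.smooth i j).continuous_fderiv (by simp)).clm_apply continuous_const

lemma Hyp.a_cont (H : Hyp a b γ Q) (i j : Fin d) : Continuous fun q : EE d × ℝ => a i j q.1 q.2 :=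
  (H.smooth i j).continuous

lemma Hyp.b_cont (H : Hyp a b γ Q) (i : Fin d) : Continuous fun q : EE d × ℝ => b i q.1 q.2 :=
  (H.bsmooth i).continuous

lemma Hyp.MM_cont (H : Hyp a b γ Q) : Continuous fun q : EE d × ℝ => MM a γ q.1 q.2 := by
  refine continuous_matrix fun i j => ?_
  simp only [MM, Matrix.of_apply]
  exact ((H.a_cont i j).add (continuous_snd.mul (H.deriv_cont i j))).sub continuous_const

lemma Hyp.MM_pos (H : Hyp a b γ Q) (p : EE d) (s : ℝ) : (MM a γ p s).PosDef := by
  refine Matrix.PosDef.of_dotProduct_mulVec_pos ?_ fun ξ hξ => ?_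
  · ext i j
    have : (fun t => a j i p t) = fun t => a i j p t := funext fun t => H.symm j i p t
    simp only [MM, Matrix.conjTranspose_apply, Matrix.of_apply, star_trivial, this, H.symm j i p s, eq_comm (a := j)]
  · have h1 := H.ell p ξ s
    have h2 : 0 < ∑ i, ξ i ^ 2 := by
      obtain ⟨i, hi⟩ := Function.ne_iff.1 hξ
      exact Finset.sum_pos' (fun i _ => sq_nonneg _) ⟨i, Finset.mem_univ i, by have : ξ i ≠ 0 := hi; positivity⟩
    have e : star ξ ⬝ᵥ (MM a γ p s).mulVec ξ =
        (∑ i, ∑ j, (a i j p s + s * deriv (fun t => a i j p t) s) * ξ i * ξ j) - γ / 2 * ∑ i, ξ i ^ 2 := by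
      simp only [dotProduct, Matrix.mulVec, MM, Matrix.of_apply, star_trivial, Finset.mul_sum]
      rw [← Finset.sum_sub_distrib]
      refine Finset.sum_congr rfl fun i _ => ?_
      have : γ / 2 * ξ i ^ 2 = ∑ j, (if i = j then γ / 2 else 0) * ξ i * ξ j := by
        simp [Finset.sum_ite_eq]; ring
      rw [this, ← Finset.sum_sub_distrib]
      refine Finset.sum_congr rfl fun j _ => by ring
    rw [e]
    have := mul_pos H.γpos h2
    nlinarith

/-- the jump density -/
noncomputable def gd (a : Fin d → Fin d → EE d → ℝ → ℝ) (γ c1 N : ℝ) (χN : EE d → ℝ) (p : EE d) (s : ℝ) (z : EE d) : ℝ :=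
  χN p * (2 / c1 * (Real.sqrt (MM a γ p (clip N s)).det)⁻¹ * (Ell (MM a γ p (clip N s))).indicator (fun _ => 1) z)

/-- the truncated coefficients -/
noncomputable def At (a : Fin d → Fin d → EE d → ℝ → ℝ) (γ N : ℝ) (χN : EE d → ℝ) (i j : Fin d) (p : EE d) (r : ℝ) : ℝ :=
  χN p * (a i j p (clip N r) * clip N r - (if i = j then γ / 2 else 0) * clip N r)

lemma Hyp.gd_meas (H : Hyp a b γ Q) (c1 N : ℝ) {χN : EE d → ℝ} (hχ : Measurable χN) :
    Measurable fun q : EE d × ℝ × EE d => gd a γ c1 N χN q.1 q.2.1 q.2.2 := by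
  have hc := clip_cont N
  have cM : Continuous fun q : EE d × ℝ × EE d => MM a γ q.1 (clip N q.2.1) :=
    H.MM_cont.comp (by fun_prop : Continuous fun q : EE d × ℝ × EE d => (q.1, clip N q.2.1))
  have cd := cM.matrix_det
  have ca := cM.matrix_adjugate
  have ms : MeasurableSet {q : EE d × ℝ × EE d | q.2.2 ∈ Ell (MM a γ q.1 (clip N q.2.1))} := by
    refine measurableSet_le (Continuous.measurable ?_) cd.measurable
    exact Continuous.dotProduct (by fun_prop) (ca.matrix_mulVec (by fun_prop))
  have mi : Measurable fun q : EE d × ℝ × EE d => (Ell (MM a γ q.1 (clip N q.2.1))).indicator (fun _ => (1 : ℝ)) q.2.2 :=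
    (measurable_const (a := (1 : ℝ))).indicator ms
  exact (hχ.comp measurable_fst).mul ((cd.measurable.sqrt.inv.const_mul _).mul mi)

lemma Hyp.gd_bd (H : Hyp a b γ Q) {c1 N : ℝ} (hc1 : 0 < c1) (hN : 0 ≤ N) {χN : EE d → ℝ}
    (h1 : ∀ x, χN x ≤ 1) (h2 : ∀ x, 2 * N ≤ ‖x‖ → χN x = 0) :
    ∃ R G : ℝ, 0 ≤ R ∧ 0 ≤ G ∧ (∀ p s z, gd a γ c1 N χN p s z ≤ G) ∧
      ∀ p s z, (2 * N < ‖p‖ ∨ R < ‖z‖) → gd a γ c1 N χN p s z = 0 := by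
  have hK : IsCompact (Metric.closedBall (0 : EE d) (2 * N) ×ˢ Set.Icc (-N) N) :=
    (isCompact_closedBall _ _).prod isCompact_Icc
  have cd := H.MM_cont.matrix_det
  have c3 : Continuous fun q : EE d × ℝ => (Real.sqrt (MM a γ q.1 q.2).det)⁻¹ :=
    cd.sqrt.inv₀ fun q => (Real.sqrt_pos.2 (H.MM_pos q.1 q.2).det_pos).ne'
  obtain ⟨G, hG⟩ := hK.exists_bound_of_continuousOn c3.continuousOn
  have c4 : Continuous fun q : EE d × ℝ => MM a γ q.1 q.2 := H.MM_cont
  have c5 : ∀ i, ∃ C, ∀ q ∈ Metric.closedBall (0 : EE d) (2 * N) ×ˢ Set.Icc (-N) N, ‖MM a γ q.1 q.2 i i‖ ≤ C := fun i =>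
    hK.exists_bound_of_continuousOn (f := fun q : EE d × ℝ => MM a γ q.1 q.2 i i) (c4.matrix_elem i i).continuousOn
  choose C hC using c5
  have memK : ∀ p s, ¬ 2 * N ≤ ‖p‖ → (p, clip N s) ∈ Metric.closedBall (0 : EE d) (2 * N) ×ˢ Set.Icc (-N) N := by
    intro p s hp
    refine ⟨by simpa using (not_le.1 hp).le, abs_le.1 (clip_le hN s)⟩
  refine ⟨1 + ∑ i, |C i|, 2 / c1 * |G|, by positivity, by positivity, fun p s z => ?_, fun p s z h => ?_⟩
  · by_cases hp : 2 * N ≤ ‖p‖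
    · rw [gd, h2 p hp, zero_mul]; positivity
    · have := hG _ (memK p s hp)
      dsimp only at this
      rw [Real.norm_of_nonneg (by positivity)] at this
      have i0 : (Ell (MM a γ p (clip N s))).indicator (fun _ => (1 : ℝ)) z ≤ 1 :=
        Set.indicator_le_self' (fun _ _ => zero_le_one) z
      have i1 : 0 ≤ (Ell (MM a γ p (clip N s))).indicator (fun _ => (1 : ℝ)) z :=
        Set.indicator_nonneg (fun _ _ => zero_le_one) z
      have k1 : (Real.sqrt (MM a γ p (clip N s)).det)⁻¹ ≤ |G| := this.trans (le_abs_self G)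
      rw [gd]
      calc _ ≤ 1 * (2 / c1 * |G| * 1) := by
            refine mul_le_mul (h1 p) ?_ (by positivity) zero_le_one
            refine mul_le_mul ?_ i0 i1 (by positivity)
            gcongr
        _ = _ := by ring
  · by_cases hp : 2 * N ≤ ‖p‖
    · rw [gd, h2 p hp, zero_mul]
    · rcases h with h | h
      · exact absurd h.le hp
      · rw [gd, Set.indicator_of_notMem, mul_zero, mul_zero]
        intro hz
        refine h.not_ge ((pi_norm_le_iff_of_nonneg (by positivity)).2 fun i => ?_)
        have e1 := Ell_bdd (H.MM_pos p (clip N s)) hz i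
        have e2 := hC i _ (memK p s hp)
        have e3 : |C i| ≤ ∑ i, |C i| := Finset.single_le_sum (f := fun i => |C i|) (fun i _ => abs_nonneg _) (Finset.mem_univ i)
        have e4 : z i ^ 2 ≤ ∑ i, |C i| := e1.trans ((le_abs_self _).trans (e2.trans ((le_abs_self _).trans e3)))
        rw [Real.norm_eq_abs]
        nlinarith [sq_abs (z i), sq_nonneg (|z i| - 1), abs_nonneg (z i)]

lemma Hyp.gd_mom (H : Hyp a b γ Q) {c1 : ℝ} (hc1 : 0 < c1)
    (hc : ∀ k l : Fin d, ∫ z in {z : EE d | ∑ i, z i ^ 2 ≤ 1}, z k * z l = if k = l then c1 else 0)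
    (N : ℝ) (χN : EE d → ℝ) (i j : Fin d) (p : EE d) (s : ℝ) :
    ∫ z, gd a γ c1 N χN p s z * (z i * z j) = 2 * (χN p * MM a γ p (clip N s) i j) := by
  set M := MM a γ p (clip N s) with hM
  have hpos : 0 < Real.sqrt M.det := Real.sqrt_pos.2 (H.MM_pos p (clip N s)).det_pos
  have e : ∀ z, gd a γ c1 N χN p s z * (z i * z j) =
      (χN p * (2 / c1 * (Real.sqrt M.det)⁻¹)) * (Ell M).indicator (fun z => z i * z j) z := by
    intro z
    rw [gd, ← hM]
    by_cases hz : z ∈ Ell M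
    · rw [Set.indicator_of_mem hz, Set.indicator_of_mem hz]; ring
    · rw [Set.indicator_of_notMem hz, Set.indicator_of_notMem hz]; ring
  simp only [e]
  rw [integral_const_mul, integral_indicator (Ell_meas M), Ell_moment hc (H.MM_pos p (clip N s))]
  field_simp
  rfl

lemma Hyp.At_eq (H : Hyp a b γ Q) {N : ℝ} (hN : 0 ≤ N) (χN : EE d → ℝ) (i j : Fin d) (p : EE d) (r : ℝ) :
    At a γ N χN i j p r = ∫ s in (0 : ℝ)..clip N r, χN p * MM a γ p (clip N s) i j := by
  have e1 : ∫ s in (0 : ℝ)..clip N r, χN p * MM a γ p (clip N s) i j = ∫ s in (0 : ℝ)..clip N r, χN p * MM a γ p s i j := by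
    refine intervalIntegral.integral_congr fun s hs => ?_
    have h1 : |s| ≤ N := by
      have := clip_le hN r
      have h0 := abs_le.1 this
      rw [Set.mem_uIcc] at hs
      rw [abs_le]
      rcases hs with ⟨h2, h3⟩ | ⟨h2, h3⟩
      · constructor <;> linarith
      · constructor <;> linarith
    simp only [clip_id h1]
  have hM : Continuous fun s => MM a γ p s i j :=
    (H.MM_cont.matrix_elem i j).comp (by fun_prop : Continuous fun s : ℝ => ((p, s) : EE d × ℝ))
  have hd : ∀ s, HasDerivAt (fun s => a i j p s * s - (if i = j then γ / 2 else 0) * s) (MM a γ p s i j) s := by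
    intro s
    have h1 := H.diff_r i j p s
    have h2 := (h1.mul (hasDerivAt_id s)).sub ((hasDerivAt_id s).const_mul (if i = j then γ / 2 else 0))
    refine HasDerivAt.congr_deriv h2 ?_
    simp only [MM, Matrix.of_apply, h1.deriv, id]
    ring
  rw [e1, intervalIntegral.integral_const_mul,
    intervalIntegral.integral_eq_sub_of_hasDerivAt (fun s _ => hd s) (hM.intervalIntegrable _ _), At]
  ring

lemma Hyp.lev (H : Hyp a b γ Q) {N : ℝ} (hN : 0 ≤ N) {χ χN : EE d → ℝ} (hχ : TF χ) (hχ0 : ∀ x, 0 ≤ χ x)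
    (hm : Measurable χN) (h0 : ∀ x, 0 ≤ χN x)
    (h1 : ∀ x, χN x ≤ 1) (h2 : ∀ x, 2 * N ≤ ‖x‖ → χN x = 0) :
    ∃ w R K, Lev χ w (At a γ N χN) (2 * N) R K := by
  obtain ⟨c1, hc1, hc⟩ := (symSet_euc (d := d)).moment
  obtain ⟨R, G, hR, hG, hb, hs⟩ := H.gd_bd hc1 hN h1 h2
  refine ⟨_, R, G, lev_of_density (g := gd a γ c1 N χN) hχ hχ0 hR hG hN (H.gd_meas c1 N hm) ?_ hb hs ?_
    (H.gd_mom hc1 hc N χN) (H.At_eq hN χN)⟩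
  · intro p s z
    have : 0 ≤ (Ell (MM a γ p (clip N s))).indicator (fun _ => (1 : ℝ)) z :=
        Set.indicator_nonneg (fun _ _ => zero_le_one) z
    have := h0 p
    rw [gd]; positivity
  · intro p s z
    by_cases hz : z ∈ Ell (MM a γ p (clip N s))
    · rw [gd, gd, Set.indicator_of_mem hz, Set.indicator_of_mem (Ell_neg z |>.2 hz)]
    · rw [gd, gd, Set.indicator_of_notMem hz, Set.indicator_of_notMem fun h' => hz (Ell_neg z |>.1 h')]

end Coeff

section Drift
variable {d : ℕ}

lemma moll (d : ℕ) {ε : ℝ} (hε : 0 < ε) : ∃ χ : EE d → ℝ, TF χ ∧ (∀ x, 0 ≤ χ x) ∧ ∫ x, χ x = 1 ∧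
    ∀ x, ε ≤ ‖x‖ → χ x = 0 := by
  let f : ContDiffBump (0 : EE d) := ⟨ε / 2, ε, by positivity, by linarith⟩
  refine ⟨f.normed volume, ⟨f.contDiff_normed, f.hasCompactSupport_normed⟩, f.nonneg_normed, f.integral_normed, ?_⟩
  intro x hx
  have h := f.support_normed_eq (μ := volume)
  by_contra h0
  have h1 : x ∈ Function.support (f.normed volume) := h0
  rw [h] at h1
  have h2 : dist x 0 < ε := h1
  rw [dist_zero_right] at h2
  linarith

lemma clipLip {F : EE d × ℝ → ℝ} (hF : ContDiff ℝ 1 F) {N : ℝ} (hN : 0 ≤ N) (P : ℝ) :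
    ∃ L : ℝ, 0 ≤ L ∧ ∀ x, ‖x‖ ≤ P → ∀ r s, |F (x, clip N r) - F (x, clip N s)| ≤ L * |r - s| := by
  set S : Set (EE d × ℝ) := Metric.closedBall 0 P ×ˢ Set.Icc (-N) N with hS
  have hc : IsCompact S := (isCompact_closedBall _ _).prod isCompact_Icc
  have hco : Convex ℝ S := (convex_closedBall _ _).prod (convex_Icc _ _)
  obtain ⟨L, hL⟩ := hc.exists_bound_of_continuousOn (hF.continuous_fderiv (by simp)).continuousOn
  refine ⟨max L 0, le_max_right _ _, fun x hx r s => ?_⟩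
  have mem : ∀ r, (x, clip N r) ∈ S := fun r =>
    ⟨by simpa using hx, abs_le.1 (clip_le hN r)⟩
  have h1 := hco.norm_image_sub_le_of_norm_fderiv_le (𝕜 := ℝ) (f := F) (C := max L 0)
    (fun y _ => hF.differentiable (by simp) y) (fun y hy => (hL y hy).trans (le_max_left _ _)) (mem s) (mem r)
  have h2 : ‖((x, clip N r) : EE d × ℝ) - (x, clip N s)‖ = |clip N r - clip N s| := by
    rw [Prod.mk_sub_mk, sub_self, Prod.norm_mk]; simp
  rw [h2, Real.norm_eq_abs] at h1
  exact h1.trans (mul_le_mul_of_nonneg_left (clip_lip N r s) (le_max_right _ _))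

variable {a : Fin d → Fin d → EE d → ℝ → ℝ} {b : Fin d → EE d → ℝ → ℝ} {γ Q : ℝ}

lemma Hyp.At_abs (H : Hyp a b γ Q) {N : ℝ} (hN : 0 ≤ N) {χN : EE d → ℝ} (h0 : ∀ x, 0 ≤ χN x)
    (h1 : ∀ x, χN x ≤ 1) (i j : Fin d) (p : EE d) (r : ℝ) : |At a γ N χN i j p r| ≤ (Q + γ) * |r| := by
  have hg := H.γpos
  have h3 : |a i j p (clip N r) - if i = j then γ / 2 else 0| ≤ Q + γ := by
    refine (abs_sub _ _).trans (add_le_add (H.abd _ _ _ _) ?_)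
    split_ifs
    · rw [abs_of_pos] <;> linarith
    · simpa using hg.le
  rw [At, ← sub_mul, abs_mul, abs_mul, abs_of_nonneg (h0 p)]
  have h4 := clip_abs hN r
  have hQ := H.Qnn
  calc χN p * _ ≤ 1 * ((Q + γ) * |r|) := by
        refine mul_le_mul (h1 p) ?_ (by positivity) zero_le_one
        exact mul_le_mul h3 h4 (abs_nonneg _) (by positivity)
    _ = _ := one_mul _

lemma Hyp.At_cont (H : Hyp a b γ Q) (N : ℝ) {χN : EE d → ℝ} (hχ : Continuous χN) (i j : Fin d) :
    Continuous fun q : EE d × ℝ => At a γ N χN i j q.1 q.2 := by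
  have hc := clip_cont N
  have h1 : Continuous fun q : EE d × ℝ => a i j q.1 (clip N q.2) :=
    (H.a_cont i j).comp (continuous_fst.prodMk (hc.comp continuous_snd))
  unfold At
  exact (hχ.comp continuous_fst).mul ((h1.mul (hc.comp continuous_snd)).sub (continuous_const.mul (hc.comp continuous_snd)))

lemma Hyp.At_lip (H : Hyp a b γ Q) {N : ℝ} (hN : 0 ≤ N) {χN : EE d → ℝ} (h0 : ∀ x, 0 ≤ χN x)
    (h1 : ∀ x, χN x ≤ 1) (h2 : ∀ x, 2 * N ≤ ‖x‖ → χN x = 0) (i j : Fin d) :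
    ∃ L, 0 ≤ L ∧ ∀ p r s, |At a γ N χN i j p r - At a γ N χN i j p s| ≤ L * |r - s| := by
  obtain ⟨L, hL, h⟩ := clipLip (F := fun q : EE d × ℝ => a i j q.1 q.2 * q.2 - (if i = j then γ / 2 else 0) * q.2)
    (((((H.smooth i j).of_le (by norm_num)).mul contDiff_snd)).sub (contDiff_const.mul contDiff_snd)) hN (2 * N)
  refine ⟨L, hL, fun p r s => ?_⟩
  by_cases hp : ‖p‖ ≤ 2 * N
  · have := h p hp r s
    simp only [At]
    rw [← mul_sub, abs_mul, abs_of_nonneg (h0 p)]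
    calc _ ≤ 1 * (L * |r - s|) := mul_le_mul (h1 p) this (abs_nonneg _) zero_le_one
      _ = _ := one_mul _
  · simp only [At, h2 p (by linarith)]
    simp; positivity

lemma Hyp.drift1 (H : Hyp a b γ Q) {N : ℝ} (hN : 0 ≤ N) {χN : EE d → ℝ} (h0 : ∀ x, 0 ≤ χN x)
    (h1 : ∀ x, χN x ≤ 1) (h2 : ∀ x, 2 * N ≤ ‖x‖ → χN x = 0) (i : Fin d) :
    ∃ L, 0 ≤ L ∧ ∀ p r s, |χN p * (b i p (clip N r) * clip N r) - χN p * (b i p (clip N s) * clip N s)| ≤ L * |r - s| := by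
  obtain ⟨L, hL, h⟩ := clipLip (F := fun q : EE d × ℝ => b i q.1 q.2 * q.2)
    ((H.bsmooth i).mul contDiff_snd) hN (2 * N)
  refine ⟨L, hL, fun p r s => ?_⟩
  by_cases hp : ‖p‖ ≤ 2 * N
  · have := h p hp r s
    rw [← mul_sub, abs_mul, abs_of_nonneg (h0 p)]
    calc _ ≤ 1 * (L * |r - s|) := mul_le_mul (h1 p) this (abs_nonneg _) zero_le_one
      _ = _ := one_mul _
  · simp only [h2 p (by linarith)]
    simp; positivity

lemma Hyp.At_pd (H : Hyp a b γ Q) {N : ℝ} (hN : 0 ≤ N) {χN : EE d → ℝ} (hχ : TF χN) (h0 : ∀ x, 0 ≤ χN x)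
    (h1 : ∀ x, χN x ≤ 1) {c : ℝ} (hD : ∀ i x, |pd i χN x| ≤ c) (i j k : Fin d) (r : ℝ) :
    ContDiff ℝ 1 (fun p => At a γ N χN i j p r) ∧ HasCompactSupport (fun p => At a γ N χN i j p r) ∧
    ∀ p, |pd k (fun p => At a γ N χN i j p r) p| ≤ (c * (Q + γ) + Q) * |r| := by
  have hs : ContDiff ℝ 1 (fun p : EE d => a i j p (clip N r)) := by
    have := (H.smooth i j).comp (contDiff_id.prodMk (contDiff_const (c := clip N r)) : ContDiff ℝ 2 fun p : EE d => (p, clip N r))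
    exact this.of_le (by norm_num)
  have hB : ContDiff ℝ 1 (fun p : EE d => a i j p (clip N r) * clip N r - (if i = j then γ / 2 else 0) * clip N r) :=
    (hs.mul contDiff_const).sub contDiff_const
  have hχ1 : ContDiff ℝ 1 χN := hχ.1.of_le (by exact_mod_cast le_top)
  refine ⟨hχ1.mul hB, hχ.2.mul_right, fun p => ?_⟩
  have d1 : HasFDerivAt χN (fderiv ℝ χN p) p := (hχ1.differentiable (by simp) p).hasFDerivAt
  have d2 : HasFDerivAt (fun p : EE d => a i j p (clip N r)) (fderiv ℝ (fun p : EE d => a i j p (clip N r)) p) p :=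
    (hs.differentiable (by simp) p).hasFDerivAt
  have d3 := d1.mul ((d2.mul_const (clip N r)).sub_const ((if i = j then γ / 2 else 0) * clip N r))
  have e : pd k (fun p => At a γ N χN i j p r) p = χN p * (clip N r * fderiv ℝ (fun p : EE d => a i j p (clip N r)) p (Pi.single k 1))
      + (a i j p (clip N r) - (if i = j then γ / 2 else 0)) * clip N r * pd k χN p := by
    have : HasFDerivAt (fun p => At a γ N χN i j p r) _ p := d3
    rw [pd, this.fderiv, pd]
    simp only [add_apply, smul_apply, smul_eq_mul]
    ring
  have hg := H.γpos
  have hQ := H.Qnn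
  have h3 : |a i j p (clip N r) - if i = j then γ / 2 else 0| ≤ Q + γ := by
    refine (abs_sub _ _).trans (add_le_add (H.abd _ _ _ _) ?_)
    split_ifs
    · rw [abs_of_pos] <;> linarith
    · simpa using hg.le
  have h4 := clip_abs hN r
  have h5 : |fderiv ℝ (fun p : EE d => a i j p (clip N r)) p (Pi.single k 1)| ≤ Q := by
    have := (fderiv ℝ (fun p : EE d => a i j p (clip N r)) p).le_opNorm (Pi.single k 1)
    have n1 : ‖(Pi.single k 1 : EE d)‖ = 1 := by simp [Pi.norm_single]
    rw [n1, mul_one] at this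
    exact this.trans (H.axbd _ _ _ _)
  rw [e]
  refine (abs_add_le _ _).trans ?_
  have t1 : |χN p * (clip N r * fderiv ℝ (fun p : EE d => a i j p (clip N r)) p (Pi.single k 1))| ≤ 1 * (|r| * Q) := by
    rw [abs_mul, abs_mul, abs_of_nonneg (h0 p)]
    exact mul_le_mul (h1 p) (mul_le_mul h4 h5 (abs_nonneg _) (abs_nonneg _)) (by positivity) zero_le_one
  have t2 : |(a i j p (clip N r) - (if i = j then γ / 2 else 0)) * clip N r * pd k χN p| ≤ (Q + γ) * |r| * c := by
    rw [abs_mul, abs_mul]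
    exact mul_le_mul (mul_le_mul h3 h4 (abs_nonneg _) (by positivity)) (hD k p) (abs_nonneg _) (by positivity)
  linarith

lemma by_parts {χ g : EE d → ℝ} (hχ : TF χ) (hg : ContDiff ℝ 1 g) (hgs : HasCompactSupport g) (j : Fin d) (x : EE d) :
    ∫ p, pd j χ (x - p) * g p = ∫ p, χ (x - p) * pd j g p := by
  have hχ1 : ContDiff ℝ 1 χ := hχ.1.of_le (by exact_mod_cast le_top)
  have hs : ContDiff ℝ 1 (fun p : EE d => χ (x - p)) := hχ1.comp (contDiff_const.sub contDiff_id)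
  have e : ∀ p, fderiv ℝ (fun p : EE d => χ (x - p)) p (Pi.single j 1) = - pd j χ (x - p) := by
    intro p
    have h1 : HasFDerivAt χ (fderiv ℝ χ (x - p)) (x - p) := (hχ1.differentiable (by simp) _).hasFDerivAt
    have h2 : HasFDerivAt (fun p : EE d => x - p) (-(ContinuousLinearMap.id ℝ (EE d))) p := (hasFDerivAt_id p).const_sub x
    have h3 : HasFDerivAt (fun p : EE d => χ (x - p)) _ p := h1.comp p h2
    rw [h3.fderiv, pd]; simp
  have c1 : Continuous fun p => χ (x - p) := hs.continuous
  have c2 : Continuous fun p => pd j χ (x - p) := (hχ.pd j).1.continuous.comp (continuous_const.sub continuous_id)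
  have c3 : Continuous (pd j g) := (hg.continuous_fderiv (by simp)).clm_apply continuous_const
  have s3 : HasCompactSupport (pd j g) := hgs.fderiv_apply ℝ _
  have := integral_mul_fderiv_eq_neg_fderiv_mul_of_integrable (μ := volume) (𝕜 := ℝ) (f := g) (g := fun p => χ (x - p)) (v := Pi.single j 1)
    ((c1.mul c3).integrable_of_hasCompactSupport s3.mul_left |>.congr (Eventually.of_forall fun p => mul_comm _ _))
    (by
      simp only [e]
      exact (hg.continuous.mul c2.neg).integrable_of_hasCompactSupport hgs.mul_right)
    ((hg.continuous.mul c1).integrable_of_hasCompactSupport hgs.mul_right)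
    (fun p _ => hg.differentiable (by simp) p) (fun p _ => hs.differentiable (by simp) p)
  simp only [e] at this
  have t1 : ∫ p, g p * -pd j χ (x - p) = - ∫ p, pd j χ (x - p) * g p := by
    rw [← integral_neg]; congr 1; ext p; ring
  have t2 : ∫ p, (fderiv ℝ g p) (Pi.single j 1) * χ (x - p) = ∫ p, χ (x - p) * pd j g p := by
    congr 1; ext p; rw [mul_comm]; rfl
  rw [t1, t2] at this
  linarith

end Drift

section Level
variable {d : ℕ} {a : Fin d → Fin d → EE d → ℝ → ℝ} {b : Fin d → EE d → ℝ → ℝ} {γ Q : ℝ}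

/-- the corrected drift -/
noncomputable def VV (a : Fin d → Fin d → EE d → ℝ → ℝ) (b : Fin d → EE d → ℝ → ℝ) (γ N : ℝ) (χ χN : EE d → ℝ)
    (i : Fin d) (x : EE d) (r : ℝ) : ℝ :=
  χN x * (b i x (clip N r) * clip N r) - ∑ j, ∫ p, pd j χ (x - p) * At a γ N χN i j p r

lemma shift_integrable {f : EE d → ℝ} (hf : Integrable f) (x : EE d) : Integrable fun p => f (x - p) :=
  hf.comp_sub_left x

lemma moll_mul_int {f g : EE d → ℝ} (hf : TF f) (hg : Continuous g) (x : EE d) :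
    Integrable fun p => f (x - p) * g p := by
  refine ((hf.1.continuous.comp (continuous_const.sub continuous_id)).mul hg).integrable_of_hasCompactSupport ?_
  refine HasCompactSupport.mul_right ?_
  exact hf.2.comp_homeomorph (Homeomorph.subLeft x)

lemma moll_bd {f g : EE d → ℝ} (hf : TF f) (_ : Continuous g) {c : ℝ} (hc : ∀ p, |g p| ≤ c) (x : EE d) :
    |∫ p, f (x - p) * g p| ≤ c * ∫ p, |f p| := by
  have h1 : |∫ p, f (x - p) * g p| ≤ ∫ p, c * |f (x - p)| := by
    rw [← Real.norm_eq_abs]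
    refine norm_integral_le_of_norm_le ((shift_integrable hf.integrable x).abs.const_mul c) (Eventually.of_forall fun p => ?_)
    rw [Real.norm_eq_abs, abs_mul, mul_comm]
    exact mul_le_mul_of_nonneg_right (hc p) (abs_nonneg _)
  rwa [integral_const_mul, integral_sub_left_eq_self (fun p => |f p|) volume x] at h1

lemma Hyp.VV_abs (H : Hyp a b γ Q) {N : ℝ} (hN : 0 ≤ N) {χ χN : EE d → ℝ} (hχ : TF χ) (hχ0 : ∀ x, 0 ≤ χ x)
    (hχ1 : ∫ x, χ x = 1) (hχN : TF χN) (h0 : ∀ x, 0 ≤ χN x)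
    (h1 : ∀ x, χN x ≤ 1) {c : ℝ} (hD : ∀ i x, |pd i χN x| ≤ c) (i : Fin d) (x : EE d) (r : ℝ) :
    |VV a b γ N χ χN i x r| ≤ (Q + d * (c * (Q + γ) + Q)) * |r| := by
  have hQ := H.Qnn
  have e : ∀ j, |∫ p, pd j χ (x - p) * At a γ N χN i j p r| ≤ (c * (Q + γ) + Q) * |r| := by
    intro j
    obtain ⟨k1, k2, k3⟩ := H.At_pd hN hχN h0 h1 hD i j j r
    rw [by_parts hχ k1 k2]
    have := moll_bd hχ (show Continuous (pd j fun p => At a γ N χN i j p r) from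
      (k1.continuous_fderiv (by simp)).clm_apply continuous_const) k3 x
    have e2 : ∫ p, |χ p| = 1 := by rw [← hχ1]; congr 1; ext p; exact abs_of_nonneg (hχ0 p)
    rwa [e2, mul_one] at this
  have s : |∑ j, ∫ p, pd j χ (x - p) * At a γ N χN i j p r| ≤ d * ((c * (Q + γ) + Q) * |r|) := by
    refine (Finset.abs_sum_le_sum_abs _ _).trans ?_
    refine (Finset.sum_le_sum fun j _ => e j).trans ?_
    simp
  have t1 : |χN x * (b i x (clip N r) * clip N r)| ≤ 1 * (Q * |r|) := by
    rw [abs_mul, abs_mul, abs_of_nonneg (h0 x)]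
    exact mul_le_mul (h1 x) (mul_le_mul (H.bbd _ _ _) (clip_abs hN r) (abs_nonneg _) hQ) (by positivity) zero_le_one
  rw [VV]
  refine (abs_sub _ _).trans ?_
  nlinarith

lemma Hyp.VV_dr (H : Hyp a b γ Q) {N : ℝ} (hN : 0 ≤ N) {χ χN : EE d → ℝ} (hχ : TF χ)
    (hχN : TF χN) (h0 : ∀ x, 0 ≤ χN x)
    (h1 : ∀ x, χN x ≤ 1) (h2 : ∀ x, 2 * N ≤ ‖x‖ → χN x = 0) : ∃ Λ, Dr (VV a b γ N χ χN) Λ := by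
  choose L hL hL2 using H.At_lip hN h0 h1 h2
  choose B hB hB2 using H.drift1 hN h0 h1 h2
  have I0 : ∀ j, 0 ≤ ∫ p, |pd j χ p| := fun j => integral_nonneg fun p => abs_nonneg _
  have nnB : 0 ≤ ∑ i, B i := Finset.sum_nonneg fun i _ => hB i
  have nnL : 0 ≤ ∑ i, ∑ j, L i j * ∫ p, |pd j χ p| :=
    Finset.sum_nonneg fun i _ => Finset.sum_nonneg fun j _ => mul_nonneg (hL i j) (I0 j)
  have cA : ∀ i j r, Continuous fun p => At a γ N χN i j p r := fun i j r =>
    (H.At_cont N hχN.1.continuous i j).comp (continuous_id.prodMk continuous_const)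
  refine ⟨(∑ i, B i) + ∑ i, ∑ j, L i j * ∫ p, |pd j χ p|, ?_, ?_, ?_, by positivity⟩
  · intro i
    have hc := clip_cont N
    have m1 : Measurable fun q : EE d × ℝ => χN q.1 * (b i q.1 (clip N q.2) * clip N q.2) := by
      have : Continuous fun q : EE d × ℝ => b i q.1 (clip N q.2) :=
        (H.b_cont i).comp (continuous_fst.prodMk (hc.comp continuous_snd))
      exact ((hχN.1.continuous.comp continuous_fst).mul (this.mul (hc.comp continuous_snd))).measurable
    refine m1.sub (Finset.measurable_fun_sum _ fun j _ => ?_)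
    have c1 : Continuous fun q : (EE d × ℝ) × EE d => pd j χ (q.1.1 - q.2) * At a γ N χN i j q.2 q.1.2 := by
      have k1 := (hχ.pd j).1.continuous
      have k2 := (H.At_cont N hχN.1.continuous i j)
      exact (k1.comp ((continuous_fst.comp continuous_fst).sub continuous_snd)).mul
        (k2.comp (continuous_snd.prodMk (continuous_snd.comp continuous_fst)))
    exact (c1.stronglyMeasurable.integral_prod_right (ν := volume)).measurable
  · intro i x
    simp [VV, At, clip_zero hN]
  · intro i x r s
    have t1 := hB2 i x r s
    have t2 : ∀ j, |(∫ p, pd j χ (x - p) * At a γ N χN i j p r) - ∫ p, pd j χ (x - p) * At a γ N χN i j p s|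
        ≤ (L i j * |r - s|) * ∫ p, |pd j χ p| := by
      intro j
      rw [← integral_sub (moll_mul_int (hχ.pd j) (cA i j r) x) (moll_mul_int (hχ.pd j) (cA i j s) x)]
      have := moll_bd (hχ.pd j) ((cA i j r).sub (cA i j s)) (fun p => hL2 i j p r s) x
      simpa only [Pi.sub_apply, mul_sub] using this
    have t3 : |(∑ j, ∫ p, pd j χ (x - p) * At a γ N χN i j p r) - ∑ j, ∫ p, pd j χ (x - p) * At a γ N χN i j p s|
        ≤ (∑ j, L i j * ∫ p, |pd j χ p|) * |r - s| := by
      rw [← Finset.sum_sub_distrib, Finset.sum_mul]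
      refine (Finset.abs_sum_le_sum_abs _ _).trans (Finset.sum_le_sum fun j _ => ?_)
      refine (t2 j).trans (le_of_eq (by ring))
    have t4 : B i ≤ ∑ i, B i := Finset.single_le_sum (fun i _ => hB i) (Finset.mem_univ i)
    have t5 : (∑ j, L i j * ∫ p, |pd j χ p|) ≤ ∑ i, ∑ j, L i j * ∫ p, |pd j χ p| :=
      Finset.single_le_sum (f := fun i => ∑ j, L i j * ∫ p, |pd j χ p|)
        (fun i _ => Finset.sum_nonneg fun j _ => mul_nonneg (hL i j) (I0 j)) (Finset.mem_univ i)
    simp only [VV]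
    rw [sub_sub_sub_comm]
    refine (abs_sub _ _).trans ?_
    have k1 := mul_le_mul_of_nonneg_right t4 (abs_nonneg (r - s))
    have k2 := mul_le_mul_of_nonneg_right t5 (abs_nonneg (r - s))
    rw [add_mul]
    linarith

/-- data at one discretisation level -/
structure LevD (a : Fin d → Fin d → EE d → ℝ → ℝ) (b : Fin d → EE d → ℝ → ℝ) (γ Vb N ε : ℝ)
    (χ χN : EE d → ℝ) (w : EE d → EE d → ℝ → ℝ) (R K Λ : ℝ) : Prop where
  lev : Lev χ w (At a γ N χN) (2 * N) R K
  dr : Dr (VV a b γ N χ χN) Λ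
  vb : ∀ i x r, |VV a b γ N χ χN i x r| ≤ Vb * |r|
  int1 : ∫ x, χ x = 1
  supp : ∀ x, ε ≤ ‖x‖ → χ x = 0
  c0 : ∀ x, 0 ≤ χN x
  c1 : ∀ x, χN x ≤ 1
  cin : ∀ x, ‖x‖ ≤ N → χN x = 1
  cc : Continuous χN

lemma Hyp.level (H : Hyp a b γ Q) : ∃ Vb : ℝ, 0 ≤ Vb ∧ ∀ N : ℝ, 1 ≤ N → ∀ ε : ℝ, 0 < ε →
    ∃ χ χN w R K Λ, LevD a b γ Vb N ε χ χN w R K Λ := by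
  obtain ⟨c, hc, hcut⟩ := cutoff d
  have hQ := H.Qnn
  have hγ := H.γpos
  refine ⟨Q + d * (c * (Q + γ) + Q), by positivity, fun N hN ε hε => ?_⟩
  obtain ⟨χ, k1, k2, k3, k4⟩ := moll d hε
  obtain ⟨χN, l1, l2, l3, l4, l5, l6⟩ := hcut N hN
  have hN0 : 0 ≤ N := by linarith
  obtain ⟨w, R, K, hlev⟩ := H.lev hN0 k1 k2 l1.meas l2 l3 l5
  obtain ⟨Λ, hΛ⟩ := H.VV_dr hN0 k1 l1 l2 l3 l5
  have hD : ∀ i x, |pd i χN x| ≤ c := fun i x => (l6.1 i x).trans (div_le_self hc hN)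
  exact ⟨χ, χN, w, R, K, Λ, hlev, hΛ, H.VV_abs hN0 k1 k2 k3 l1 l2 l3 hD, k3, k4, l2, l3, l4, l1.1.continuous⟩

end Level

section Assemble
variable {d : ℕ} {a : Fin d → Fin d → EE d → ℝ → ℝ} {b : Fin d → EE d → ℝ → ℝ} {γ Q : ℝ}

/-- regularised operator -/
noncomputable def LL (a : Fin d → Fin d → EE d → ℝ → ℝ) (b : Fin d → EE d → ℝ → ℝ) (γ N : ℝ) (χ χN : EE d → ℝ)
    (φ : EE d → ℝ) (x : EE d) (r : ℝ) : ℝ :=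
  (∑ i, ∑ j, pd2 i j φ x * ∫ p, χ (x - p) * At a γ N χN i j p r) + γ / 2 * r * (∑ i, pd2 i i φ x)
    + ∑ i, χN x * (b i x (clip N r) * clip N r) * pd i φ x

lemma Hyp.step (H : Hyp a b γ Q) {c : ℝ} (hc : 0 < c)
    (hmom : ∀ k l : Fin d, ∫ z in Metric.closedBall (0 : EE d) 1, z k * z l = if k = l then c else 0)
    {Vb N ε : ℝ} {χ χN : EE d → ℝ} {w : EE d → EE d → ℝ → ℝ} {R K Λ : ℝ} (hL : LevD a b γ Vb N ε χ χN w R K Λ)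
    (hε : 0 < ε) (hε1 : ε ≤ 1) :
    ∃ h : ℝ, 0 < h ∧ h ≤ ε ∧ c⁻¹ * (d * Λ * h) ≤ γ / c ∧ ∀ φ, TF φ → ∀ Kφ, TK φ Kφ → ∀ x r,
      |JL (KK χ w (γ / c) c (VV a b γ N χ χN) h) φ x r - LL a b γ N χ χN φ x r| ≤ Kφ * ε * |r| := by
  have hγ := H.γpos
  have hκ : 0 < γ / c := by positivity
  obtain ⟨C, hC, hC2⟩ := KK_cons hL.lev hL.dr hc hκ hmom
  have hΛ := hL.dr.nn
  set h := min (ε / (1 + C)) (γ / (1 + d * Λ)) with hh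
  have h0 : 0 < h := by positivity
  have h1 : h * (1 + C) ≤ ε := (le_div_iff₀ (by positivity)).1 (min_le_left _ _)
  have h2 : h * (1 + d * Λ) ≤ γ := (le_div_iff₀ (by positivity)).1 (min_le_right _ _)
  have h3 : h ≤ ε := by nlinarith
  have h4 : c⁻¹ * (d * Λ * h) ≤ γ / c := by
    rw [div_eq_inv_mul]
    exact mul_le_mul_of_nonneg_left (by nlinarith) (by positivity)
  refine ⟨h, h0, h3, h4, fun φ hφ Kφ hK x r => ?_⟩
  have := hC2 h h0 (h3.trans hε1) h4 φ hφ Kφ hK x r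
  have e : LL a b γ N χ χN φ x r = (((∑ i, pd i φ x * ∑ j, ∫ p, pd j χ (x - p) * At a γ N χN i j p r)
      + ∑ i, ∑ j, pd2 i j φ x * ∫ p, χ (x - p) * At a γ N χN i j p r)
      + (γ / c * c / 2 * r * (∑ i, pd2 i i φ x) + ∑ i, VV a b γ N χ χN i x r * pd i φ x)) := by
    have e1 : ∑ i, VV a b γ N χ χN i x r * pd i φ x = (∑ i, χN x * (b i x (clip N r) * clip N r) * pd i φ x)
        - ∑ i, pd i φ x * ∑ j, ∫ p, pd j χ (x - p) * At a γ N χN i j p r := by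
      rw [← Finset.sum_sub_distrib]
      refine Finset.sum_congr rfl fun i _ => ?_
      rw [VV]; ring
    rw [e1, LL, div_mul_cancel₀ _ hc.ne']
    ring
  rw [← e] at this
  refine this.trans ?_
  have : C * Kφ * h ≤ Kφ * ε := by
    have := mul_le_mul_of_nonneg_left (show h * C ≤ ε by nlinarith) hK.nn
    linarith
  exact mul_le_mul_of_nonneg_right this (abs_nonneg _)

lemma Hyp.At_mol (H : Hyp a b γ Q) {Vb N ε : ℝ} (hN : 0 ≤ N) {χ χN : EE d → ℝ} {w : EE d → EE d → ℝ → ℝ} {R K Λ : ℝ}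
    (hL : LevD a b γ Vb N ε χ χN w R K Λ) (i j : Fin d) (x : EE d) (r : ℝ) :
    |∫ p, χ (x - p) * At a γ N χN i j p r| ≤ (Q + γ) * |r| := by
  have cA : Continuous fun p => At a γ N χN i j p r :=
    (H.At_cont N hL.cc i j).comp (continuous_id.prodMk continuous_const)
  have := moll_bd hL.lev.tf cA (fun p => H.At_abs hN hL.c0 hL.c1 i j p r) x
  have e2 : ∫ p, |χ p| = 1 := by rw [← hL.int1]; congr 1; ext p; exact abs_of_nonneg (hL.lev.χnn p)
  rwa [e2, mul_one] at this

lemma Hyp.LL_bd (H : Hyp a b γ Q) {Vb N ε : ℝ} (hN : 0 ≤ N) {χ χN : EE d → ℝ} {w : EE d → EE d → ℝ → ℝ} {R K Λ : ℝ}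
    (hL : LevD a b γ Vb N ε χ χN w R K Λ) {φ : EE d → ℝ} {D : ℝ} (hD : DB φ D) (x : EE d) (r : ℝ) :
    |LL a b γ N χ χN φ x r| ≤ ((d * d * (Q + γ) + d * γ + d * Q) * D) * |r| := by
  have hγ := H.γpos
  have hQ := H.Qnn
  have t1 : |∑ i, ∑ j, pd2 i j φ x * ∫ p, χ (x - p) * At a γ N χN i j p r| ≤ d * (d * (D * ((Q + γ) * |r|))) := by
    refine (Finset.abs_sum_le_sum_abs _ _).trans ?_
    refine (Finset.sum_le_sum fun i _ => ((Finset.abs_sum_le_sum_abs _ _).trans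
      (Finset.sum_le_sum (g := fun _ => D * ((Q + γ) * |r|)) fun j _ => ?_))).trans (le_of_eq ?_)
    · rw [abs_mul]
      exact mul_le_mul (hD.2 i j x) (H.At_mol hN hL i j x r) (abs_nonneg _) ((abs_nonneg _).trans (hD.2 i j x))
    · simp
  have t2 : |∑ i, pd2 i i φ x| ≤ d * D := by
    refine (Finset.abs_sum_le_sum_abs _ _).trans ((Finset.sum_le_sum fun i _ => hD.2 i i x).trans (le_of_eq ?_))
    simp
  have t3 : |∑ i, χN x * (b i x (clip N r) * clip N r) * pd i φ x| ≤ d * ((1 * (Q * |r|)) * D) := by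
    refine (Finset.abs_sum_le_sum_abs _ _).trans
      ((Finset.sum_le_sum (g := fun _ => (1 * (Q * |r|)) * D) fun i _ => ?_).trans (le_of_eq ?_))
    · rw [abs_mul, abs_mul, abs_mul, abs_of_nonneg (hL.c0 x)]
      refine mul_le_mul ?_ (hD.1 i x) (abs_nonneg _) (by positivity)
      exact mul_le_mul (hL.c1 x) (mul_le_mul (H.bbd _ _ _) (clip_abs hN r) (abs_nonneg _) hQ) (by positivity) zero_le_one
    · simp
  have t4 : |γ / 2 * r * ∑ i, pd2 i i φ x| ≤ γ * |r| * (d * D) := by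
    rw [abs_mul, abs_mul, abs_of_pos (by positivity : 0 < γ / 2)]
    refine mul_le_mul (mul_le_mul_of_nonneg_right (by linarith) (abs_nonneg _)) t2 (abs_nonneg _) (by positivity)
  rw [LL]
  refine (abs_add_three _ _ _).trans ?_
  refine (add_le_add (add_le_add t1 t4) t3).trans (le_of_eq ?_)
  ring

lemma Hyp.mol_tendsto (H : Hyp a b γ Q) {Vb : ℝ} {χ χN : ℕ → EE d → ℝ} {w : ℕ → EE d → EE d → ℝ → ℝ} {R K Λ : ℕ → ℝ}
    (hL : ∀ n : ℕ, LevD a b γ Vb ((n : ℝ) + 1) (1 / ((n : ℝ) + 1)) (χ n) (χN n) (w n) (R n) (K n) (Λ n))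
    (i j : Fin d) (x : EE d) (r : ℝ) :
    Tendsto (fun q : ℕ × ℝ => ∫ p, χ q.1 (x - p) * At a γ ((q.1 : ℝ) + 1) (χN q.1) i j p q.2) (atTop ×ˢ nhds r)
      (nhds (a i j x r * r - (if i = j then γ / 2 else 0) * r)) := by
  set G : EE d × ℝ → ℝ := fun q => a i j q.1 q.2 * q.2 - (if i = j then γ / 2 else 0) * q.2 with hG
  have cG : Continuous G := ((H.a_cont i j).mul continuous_snd).sub (continuous_const.mul continuous_snd)
  rw [Metric.tendsto_nhds]
  intro η hη
  obtain ⟨δ, hδ, hδ2⟩ := Metric.continuousAt_iff.1 (cG.continuousAt (x := (x, r))) (η / 2) (half_pos hη)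
  have lim : Tendsto (fun n : ℕ => 1 / ((n : ℝ) + 1)) atTop (nhds 0) := tendsto_one_div_add_atTop_nhds_zero_nat
  have E1 : ∀ᶠ n : ℕ in atTop, 1 / ((n : ℝ) + 1) < δ := lim.eventually_lt_const hδ
  have E2 : ∀ᶠ n : ℕ in atTop, ‖x‖ + |r| + 1 + δ ≤ (n : ℝ) :=
    tendsto_natCast_atTop_atTop.eventually_ge_atTop _
  have E3 : ∀ᶠ s in nhds r, |s - r| < min δ 1 := by
    have := Metric.ball_mem_nhds r (lt_min hδ one_pos)
    filter_upwards [this] with s hs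
    exact hs
  filter_upwards [(E1.and E2).prod_mk E3] with ⟨n, s⟩ ⟨⟨h1, h2⟩, h3⟩
  dsimp only at h1 h2 h3 ⊢
  have hn := hL n
  have cA : Continuous fun p => At a γ ((n : ℝ) + 1) (χN n) i j p s :=
    (H.At_cont _ hn.cc i j).comp (continuous_id.prodMk continuous_const)
  have e1 : ∫ p, χ n (x - p) = 1 := by
    rw [integral_sub_left_eq_self (χ n) volume x]; exact hn.int1
  have I1 := shift_integrable hn.lev.tf.integrable x
  have e2 : (∫ p, χ n (x - p) * At a γ ((n : ℝ) + 1) (χN n) i j p s) - G (x, r)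
      = ∫ p, (χ n (x - p) * At a γ ((n : ℝ) + 1) (χN n) i j p s - χ n (x - p) * G (x, r)) := by
    rw [integral_sub (moll_mul_int hn.lev.tf cA x) (I1.mul_const _), integral_mul_const, e1, one_mul]
  have key : |∫ p, (χ n (x - p) * At a γ ((n : ℝ) + 1) (χN n) i j p s - χ n (x - p) * G (x, r))| ≤ ∫ p, χ n (x - p) * (η / 2) := by
    rw [← Real.norm_eq_abs]
    refine norm_integral_le_of_norm_le (I1.mul_const _) (Eventually.of_forall fun p => ?_)
    rw [Real.norm_eq_abs, ← mul_sub, abs_mul, abs_of_nonneg (hn.lev.χnn _)]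
    rcases le_or_gt (1 / ((n : ℝ) + 1)) ‖x - p‖ with hp | hp
    · rw [hn.supp _ hp]; simp
    · refine mul_le_mul_of_nonneg_left ?_ (hn.lev.χnn _)
      have p1 : ‖p‖ ≤ (n : ℝ) + 1 := by
        have := norm_sub_norm_le p x
        rw [norm_sub_rev] at this
        have := abs_nonneg r
        linarith
      have p2 : |s| ≤ (n : ℝ) + 1 := by
        have k1 : |s| ≤ |s - r| + |r| := by
          have := abs_add_le (s - r) r
          simpa using this
        have := h3.trans_le (min_le_right _ _)
        have := norm_nonneg x
        linarith
      rw [At, hn.cin p p1, clip_id p2, one_mul]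
      have p3 : dist (p, s) (x, r) < δ := by
        rw [Prod.dist_eq, max_lt_iff]
        refine ⟨?_, ?_⟩
        · show dist p x < δ
          rw [dist_eq_norm, norm_sub_rev]; linarith
        · exact h3.trans_le (min_le_left _ _)
      exact (hδ2 p3).le
  rw [integral_mul_const, e1, one_mul] at key
  rw [Real.dist_eq]
  change |_ - G (x, r)| < η
  rw [e2]
  linarith

lemma Hyp.LL_tendsto (H : Hyp a b γ Q) {Vb : ℝ} {χ χN : ℕ → EE d → ℝ} {w : ℕ → EE d → EE d → ℝ → ℝ} {R K Λ : ℕ → ℝ}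
    (hL : ∀ n : ℕ, LevD a b γ Vb ((n : ℝ) + 1) (1 / ((n : ℝ) + 1)) (χ n) (χN n) (w n) (R n) (K n) (Λ n))
    (φ : EE d → ℝ) (x : EE d) (r : ℝ) :
    Tendsto (fun q : ℕ × ℝ => LL a b γ ((q.1 : ℝ) + 1) (χ q.1) (χN q.1) φ x q.2) (atTop ×ˢ nhds r)
      (nhds (Lop a b φ x r)) := by
  have e : Lop a b φ x r = (∑ i, ∑ j, pd2 i j φ x * (a i j x r * r - (if i = j then γ / 2 else 0) * r))
      + γ / 2 * r * (∑ i, pd2 i i φ x) + ∑ i, b i x r * r * pd i φ x := by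
    have e1 : (∑ i, ∑ j, pd2 i j φ x * (a i j x r * r - (if i = j then γ / 2 else 0) * r))
        = (∑ i, ∑ j, a i j x r * r * pd2 i j φ x) - γ / 2 * r * (∑ i, pd2 i i φ x) := by
      rw [Finset.mul_sum, ← Finset.sum_sub_distrib]
      refine Finset.sum_congr rfl fun i _ => ?_
      simp only [mul_sub, Finset.sum_sub_distrib]
      congr 1
      · exact Finset.sum_congr rfl fun j _ => by ring
      · rw [Finset.sum_eq_single i]
        · simp; ring
        · intro j _ hj; simp [hj.symm]
        · simp
    rw [e1, Lop, Finset.mul_sum]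
    have : ∀ i, r * (b i x r * pd i φ x) = b i x r * r * pd i φ x := fun i => by ring
    simp only [this]; ring
  have hs : Tendsto (fun q : ℕ × ℝ => q.2) (atTop ×ˢ nhds r) (nhds r) := tendsto_snd
  have ev : ∀ᶠ q : ℕ × ℝ in atTop ×ˢ nhds r, χN q.1 x = 1 ∧ clip ((q.1 : ℝ) + 1) q.2 = q.2 := by
    have E2 : ∀ᶠ n : ℕ in atTop, ‖x‖ + |r| + 1 ≤ (n : ℝ) :=
      tendsto_natCast_atTop_atTop.eventually_ge_atTop _
    have E3 : ∀ᶠ s in nhds r, |s| < |r| + 1 := continuous_abs.continuousAt.eventually_lt_const (by linarith)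
    filter_upwards [E2.prod_mk E3] with ⟨n, s⟩ ⟨h2, h3⟩
    dsimp only at h2 h3 ⊢
    have := norm_nonneg x
    have := abs_nonneg r
    exact ⟨(hL n).cin x (by linarith), clip_id (by linarith)⟩
  rw [e]
  refine Tendsto.add (Tendsto.add ?_ ?_) ?_
  · exact tendsto_finsetSum _ fun i _ => tendsto_finsetSum _ fun j _ => (H.mol_tendsto hL i j x r).const_mul _
  · exact (hs.const_mul _).mul_const _
  · refine tendsto_finsetSum _ fun i _ => Tendsto.mul_const _ ?_
    have hb : Tendsto (fun q : ℕ × ℝ => b i x q.2 * q.2) (atTop ×ˢ nhds r) (nhds (b i x r * r)) := by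
      have : Continuous fun s : ℝ => b i x s * s :=
        ((H.b_cont i).comp (continuous_const.prodMk continuous_id)).mul continuous_id
      exact (this.tendsto r).comp hs
    refine hb.congr' ?_
    filter_upwards [ev] with q ⟨h1, h2⟩
    rw [h1, h2, one_mul]

theorem Hyp.approx (H : Hyp a b γ Q) : ∃ Φ q h C κ, ApproxFam (d := d) a b Φ q h C κ := by
  obtain ⟨c, hc, hmom⟩ := (symSet_sup (d := d)).moment
  obtain ⟨Vb, hVb, hlev⟩ := H.level
  have hγ := H.γpos
  have hQ := H.Qnn
  have hκ : 0 < γ / c := by positivity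
  have pos : ∀ n : ℕ, (0 : ℝ) < 1 / ((n : ℝ) + 1) := fun n => by positivity
  have le1 : ∀ n : ℕ, 1 / ((n : ℝ) + 1) ≤ 1 := fun n => by
    rw [div_le_one (by positivity)]; have : (0 : ℝ) ≤ n := n.cast_nonneg; linarith
  choose χ χN w R K Λ hL using fun n : ℕ => hlev ((n : ℝ) + 1) (by have : (0 : ℝ) ≤ n := n.cast_nonneg; linarith)
    (1 / ((n : ℝ) + 1)) (pos n)
  choose h h0 h1 h2 h3 using fun n : ℕ => H.step hc hmom (hL n) (pos n) (le1 n)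
  have lim : Tendsto (fun n : ℕ => 1 / ((n : ℝ) + 1)) atTop (nhds 0) := tendsto_one_div_add_atTop_nhds_zero_nat
  have N0 : ∀ n : ℕ, (0 : ℝ) ≤ (n : ℝ) + 1 := fun n => by positivity
  set C1 := d * d * (Q + γ) + d * γ + d * Q with hC1
  set C2 := (c⁻¹ * d * Vb) ^ 2 / (γ / c) * volume.real (Metric.closedBall (0 : EE d) 1) with hC2
  have hC1n : 0 ≤ C1 := by positivity
  have hC2n : 0 ≤ C2 := by positivity
  refine ⟨fun n => KK (χ n) (w n) (γ / c) c (VV a b γ ((n : ℝ) + 1) (χ n) (χN n)) (h n),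
    fun n => KQ (χ n) (γ / c) c (K n) (R n) (Λ n) (h n), h, C1 + C2, γ / c / 4,
    fun n => KK_jump (hL n).lev (hL n).dr (h0 n) hc hκ.le (h2 n), h0, ?_, by positivity, by positivity, ?_, ?_, ?_⟩
  · exact squeeze_zero (fun n => (h0 n).le) h1 lim
  · intro n u hu hm ⟨M, hM⟩
    refine (KK_energy (hL n).lev (hL n).dr (h0 n) hc hκ hVb (h2 n) (hL n).vb hu hm hM).trans ?_
    have : 0 ≤ ∫ x, u x ^ 2 := integral_nonneg fun x => sq_nonneg _
    rw [← hC2]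
    nlinarith
  · intro φ hφ
    obtain ⟨Kφ, hK⟩ := tf_tk hφ
    refine ⟨fun n => Kφ * (1 / ((n : ℝ) + 1)), by simpa using lim.const_mul Kφ, fun D hD n x r => ?_⟩
    have k1 := h3 n φ hφ Kφ hK x r
    have k2 := H.LL_bd (N0 n) (hL n) hD x r
    have hDn : C1 * D * |r| ≤ (C1 + C2) * D * |r| := by
      have hd : (d = 0) ∨ 0 < d := Nat.eq_zero_or_pos d
      rcases hd with hd | hd
      · subst hd
        have : C1 = 0 := by simp [hC1]
        have : C2 = 0 := by simp [hC2]
        simp [*]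
      · have : 0 ≤ D := (abs_nonneg _).trans (hD.1 ⟨0, hd⟩ x)
        have : 0 ≤ C2 * D * |r| := by positivity
        linarith
    have := abs_sub_abs_le_abs_sub (JL (KK (χ n) (w n) (γ / c) c (VV a b γ ((n : ℝ) + 1) (χ n) (χN n)) (h n)) φ x r)
      (LL a b γ ((n : ℝ) + 1) (χ n) (χN n) φ x r)
    dsimp only
    rw [add_mul]
    linarith
  · intro φ hφ x r
    obtain ⟨Kφ, hK⟩ := tf_tk hφ
    have k1 := H.LL_tendsto hL φ x r
    have k2 : Tendsto (fun q : ℕ × ℝ => JL (KK (χ q.1) (w q.1) (γ / c) c (VV a b γ ((q.1 : ℝ) + 1) (χ q.1) (χN q.1)) (h q.1)) φ x q.2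
        - LL a b γ ((q.1 : ℝ) + 1) (χ q.1) (χN q.1) φ x q.2) (atTop ×ˢ nhds r) (nhds 0) := by
      refine squeeze_zero_norm (fun q => h3 q.1 φ hφ Kφ hK x q.2) ?_
      have l1 : Tendsto (fun q : ℕ × ℝ => 1 / ((q.1 : ℝ) + 1)) (atTop ×ˢ nhds r) (nhds 0) := lim.comp tendsto_fst
      have l2 : Tendsto (fun q : ℕ × ℝ => |q.2|) (atTop ×ˢ nhds r) (nhds |r|) := (continuous_abs.tendsto r).comp tendsto_snd
      have := (l1.const_mul Kφ).mul l2
      simpa using this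
    have := k2.add k1
    simpa using this

end Assemble

section Final
variable {d : ℕ} {a : Fin d → Fin d → EE d → ℝ → ℝ} {b : Fin d → EE d → ℝ → ℝ} {γ Q : ℝ}

lemma ResFam.bdd {X : Type*} [NormedAddCommGroup X] [NormedSpace ℝ X] {J : ℝ → X → X} {l0 : ℝ} (hJ : ResFam J l0)
    (T : ℝ) (hT : 0 ≤ T) (u : X) : ∃ M, 0 ≤ M ∧ ∀ l, 0 < l → l ≤ l0 → ∀ t, t ≤ T → ‖(J l)^[⌊t / l⌋₊] u‖ ≤ M := by
  have hp := hJ.pos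
  set v := J l0 0 with hv
  have h1 : ∀ l, 0 < l → l ≤ l0 → ‖J l v - v‖ ≤ l / l0 * ‖v‖ := by
    intro l hl hl0
    have e := hJ.resid l l0 hl hl0 le_rfl 0
    rw [← hv, smul_zero, zero_add] at e
    calc ‖J l v - v‖ = ‖J l v - J l ((1 - l / l0) • v)‖ := by rw [← e]
      _ ≤ ‖v - (1 - l / l0) • v‖ := hJ.contr l hl hl0 _ _
      _ = ‖(l / l0) • v‖ := by congr 1; rw [sub_smul, one_smul]; abel
      _ = l / l0 * ‖v‖ := by rw [norm_smul, Real.norm_eq_abs, abs_of_pos (by positivity)]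
  have h2 : ∀ l, 0 < l → l ≤ l0 → ∀ n : ℕ, ‖(J l)^[n] v - v‖ ≤ n * (l / l0 * ‖v‖) := by
    intro l hl hl0 n
    induction n with
    | zero => simp
    | succ n ih =>
      rw [Function.iterate_succ_apply]
      have k1 := iter_contr (hJ.contr l hl hl0) n (J l v) v
      have k2 := h1 l hl hl0
      have k3 := norm_add_le ((J l)^[n] (J l v) - (J l)^[n] v) ((J l)^[n] v - v)
      rw [sub_add_sub_cancel] at k3
      push_cast
      linarith
  refine ⟨‖u - v‖ + ‖v‖ + T / l0 * ‖v‖, by positivity, fun l hl hl0 t ht => ?_⟩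
  set n := ⌊t / l⌋₊ with hn
  have k1 := iter_contr (hJ.contr l hl hl0) n u v
  have k2 := h2 l hl hl0 n
  have k3 : (n : ℝ) * l ≤ T := by
    rcases le_or_gt 0 t with h | h
    · have := Nat.floor_le (div_nonneg h hl.le)
      rw [← hn, le_div_iff₀ hl] at this
      linarith
    · have : n = 0 := by rw [hn]; exact Nat.floor_of_nonpos (div_nonpos_of_nonpos_of_nonneg h.le hl.le)
      rw [this]; simpa using hT
  have k4 : n * (l / l0 * ‖v‖) ≤ T / l0 * ‖v‖ := by
    calc _ = (n * l) / l0 * ‖v‖ := by ring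
      _ ≤ _ := by gcongr
  have k5 : (J l)^[n] u = ((J l)^[n] u - (J l)^[n] v) + (((J l)^[n] v - v) + v) := by abel
  rw [k5]
  have k6 := norm_add_le ((J l)^[n] u - (J l)^[n] v) (((J l)^[n] v - v) + v)
  have k7 := norm_add_le ((J l)^[n] v - v) v
  linarith

/-- boundedness of the pairing -/
lemma pair_bd {f : EE d → ℝ → ℝ} {K : ℝ} (hK : ∀ x r, |f x r| ≤ K * |r|) (v : L1E d) :
    |∫ x, f x (v x)| ≤ K * ‖v‖ := by
  have e : ‖v‖ = ∫ x, |v x| := by rw [L1.norm_eq_integral_norm]; rfl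
  rw [e, ← integral_const_mul, ← Real.norm_eq_abs]
  exact norm_integral_le_of_norm_le ((L1E.int v).abs.const_mul K) (Eventually.of_forall fun x => hK _ _)

lemma pair_int {f : EE d → ℝ → ℝ} {K : ℝ} (hf : Continuous fun p : EE d × ℝ => f p.1 p.2)
    (hK : ∀ x r, |f x r| ≤ K * |r|) (v : L1E d) :
    Integrable fun x => f x (v x) :=
  ((L1E.int v).abs.const_mul K).mono' (hf.measurable.comp (measurable_id.prodMk (L1E.meas v))).aestronglyMeasurable
    (Eventually.of_forall fun x => hK _ _)

lemma pair_meas {f : ℝ → EE d → ℝ → ℝ} (hf : Continuous fun p : ℝ × EE d × ℝ => f p.1 p.2.1 p.2.2)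
    (F : L1E d → L1E d) (u : L1E d) (l : ℝ) :
    Measurable fun t : ℝ => ∫ x, f t x ((F^[⌊t / l⌋₊] u : L1E d) x) := by
  have h1 : ∀ m : ℕ, Measurable fun t : ℝ => ∫ x, f t x ((F^[m] u : L1E d) x) := by
    intro m
    have : Measurable fun q : ℝ × EE d => f q.1 q.2 ((F^[m] u : L1E d) q.2) :=
      hf.measurable.comp (measurable_fst.prodMk (measurable_snd.prodMk ((L1E.meas _).comp measurable_snd)))
    exact (this.stronglyMeasurable.integral_prod_right (ν := volume)).measurable
  have h2 : Measurable fun q : ℕ × ℝ => ∫ x, f q.2 x ((F^[q.1] u : L1E d) x) :=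
    measurable_from_prod_countable_right h1
  exact h2.comp ((Nat.measurable_floor.comp (measurable_id.div_const l)).prodMk measurable_id)

lemma pair_time_int {f : ℝ → EE d → ℝ → ℝ} (hf : Continuous fun p : ℝ × EE d × ℝ => f p.1 p.2.1 p.2.2)
    {K T M : ℝ} (hKnn : 0 ≤ K) (hK : ∀ t x r, |f t x r| ≤ K * |r|) (hs : ∀ t, (t < 0 ∨ T < t) → ∀ x r, f t x r = 0)
    (F : L1E d → L1E d) (u : L1E d) (l : ℝ) (hM : ∀ t, t ≤ T → ‖F^[⌊t / l⌋₊] u‖ ≤ M) :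
    Integrable fun t : ℝ => ∫ x, f t x ((F^[⌊t / l⌋₊] u : L1E d) x) := by
  have hI : Integrable (Set.indicator (Set.Icc 0 T) (fun _ : ℝ => K * M)) :=
    (integrable_indicator_iff measurableSet_Icc).2 (integrableOn_const (by simp))
  refine hI.mono' (pair_meas hf F u l).aestronglyMeasurable (Eventually.of_forall fun t => ?_)
  by_cases ht : t ∈ Set.Icc 0 T
  · rw [Set.indicator_of_mem ht]
    exact (pair_bd (hK t) _).trans (mul_le_mul_of_nonneg_left (hM t ht.2) hKnn)
  · rw [Set.indicator_of_notMem ht]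
    have : t < 0 ∨ T < t := by
      by_contra h; push Not at h; exact ht h
    simp [hs t this]

end Final

section Slices
variable {d : ℕ} {a : Fin d → Fin d → EE d → ℝ → ℝ} {b : Fin d → EE d → ℝ → ℝ} {γ Q : ℝ}

/-- time slice of a test function -/
def slc (φ : ℝ × EE d → ℝ) (s : ℝ) : EE d → ℝ := fun y => φ (s, y)

lemma pdx_smooth {φ : ℝ × EE d → ℝ} (h : ContDiff ℝ (⊤ : ℕ∞) φ) (i : Fin d) : ContDiff ℝ (⊤ : ℕ∞) (pdx i φ) := by
  have : ContDiff ℝ (⊤ : ℕ∞) (fderiv ℝ φ) := h.fderiv_right (by simp)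
  exact this.clm_apply contDiff_const

lemma pdx_supp {φ : ℝ × EE d → ℝ} (h : HasCompactSupport φ) (i : Fin d) : HasCompactSupport (pdx i φ) :=
  h.fderiv_apply ℝ _

lemma slc_pd {φ : ℝ × EE d → ℝ} (h : ContDiff ℝ (⊤ : ℕ∞) φ) (i : Fin d) (s : ℝ) :
    pd i (slc φ s) = slc (pdx i φ) s := by
  ext x
  have h1 : HasFDerivAt φ (fderiv ℝ φ (s, x)) (s, x) := (h.differentiable (by simp) _).hasFDerivAt
  have h2 : HasFDerivAt (𝕜 := ℝ) (fun y : EE d => ((s, y) : ℝ × EE d)) _ x := (hasFDerivAt_const s x).prodMk (hasFDerivAt_id x)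
  have h3 : HasFDerivAt (𝕜 := ℝ) (slc φ s) _ x := h1.comp x h2
  rw [pd, h3.fderiv, slc, pdx]
  simp

lemma slc_pd2 {φ : ℝ × EE d → ℝ} (h : ContDiff ℝ (⊤ : ℕ∞) φ) (i j : Fin d) (s : ℝ) (x : EE d) :
    pd2 i j (slc φ s) x = pdxx i j φ (s, x) := by
  rw [pd2, slc_pd h, slc_pd (pdx_smooth h j)]
  rfl

lemma slc_tf {φ : ℝ × EE d → ℝ} (h : ContDiff ℝ (⊤ : ℕ∞) φ) (hs : HasCompactSupport φ) (s : ℝ) : TF (slc φ s) := by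
  refine ⟨h.comp (contDiff_const.prodMk contDiff_id), ?_⟩
  have : Topology.IsClosedEmbedding (fun y : EE d => ((s, y) : ℝ × EE d)) := by
    refine Topology.IsClosedEmbedding.of_continuous_injective_isClosedMap (by fun_prop) (fun _ _ h => (Prod.mk.inj h).2) ?_
    exact isClosedMap_prodMk_left s
  exact hs.comp_isClosedEmbedding this

lemma bdd_of {φ : ℝ × EE d → ℝ} (h : ContDiff ℝ (⊤ : ℕ∞) φ) (hs : HasCompactSupport φ) : ∃ C, 0 ≤ C ∧ ∀ p, |φ p| ≤ C := by
  obtain ⟨C, hC⟩ := hs.exists_bound_of_continuous h.continuous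
  exact ⟨C, (norm_nonneg _).trans (hC 0), hC⟩

lemma slc_db {φ : ℝ × EE d → ℝ} (h : ContDiff ℝ (⊤ : ℕ∞) φ) (hs : HasCompactSupport φ) : ∃ D, 0 ≤ D ∧ ∀ s, DB (slc φ s) D := by
  choose A hA hA2 using fun i => bdd_of (pdx_smooth h i) (pdx_supp hs i)
  choose B hB hB2 using fun i j => bdd_of (pdx_smooth (pdx_smooth h j) i) (pdx_supp (pdx_supp hs j) i)
  have n1 : 0 ≤ ∑ i, A i := Finset.sum_nonneg fun i _ => hA i
  have n2 : 0 ≤ ∑ i, ∑ j, B i j := Finset.sum_nonneg fun i _ => Finset.sum_nonneg fun j _ => hB i j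
  refine ⟨(∑ i, A i) + ∑ i, ∑ j, B i j, by positivity, fun s => ⟨fun i x => ?_, fun i j x => ?_⟩⟩
  · rw [slc_pd h]
    have := Finset.single_le_sum (fun i _ => hA i) (Finset.mem_univ i)
    have := hA2 i (s, x)
    rw [slc]; linarith
  · rw [slc_pd2 h]
    have t1 : B i j ≤ ∑ j, B i j := Finset.single_le_sum (f := fun j => B i j) (fun j _ => hB i j) (Finset.mem_univ j)
    have t2 : ∑ j, B i j ≤ ∑ i, ∑ j, B i j := Finset.single_le_sum (f := fun i => ∑ j, B i j)
      (fun i _ => Finset.sum_nonneg fun j _ => hB i j) (Finset.mem_univ i)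
    have := hB2 i j (s, x)
    rw [pdxx]; linarith

lemma Hyp.Lop_bd (H : Hyp a b γ Q) {φ : EE d → ℝ} {D : ℝ} (hD : DB φ D) (x : EE d) (r : ℝ) :
    |Lop a b φ x r| ≤ ((d * d * Q + d * Q) * D) * |r| := by
  have hQ := H.Qnn
  have t1 : |∑ i, ∑ j, a i j x r * r * pd2 i j φ x| ≤ d * (d * (Q * |r| * D)) := by
    refine (Finset.abs_sum_le_sum_abs _ _).trans ?_
    refine (Finset.sum_le_sum fun i _ => ((Finset.abs_sum_le_sum_abs _ _).trans
      (Finset.sum_le_sum (g := fun _ => Q * |r| * D) fun j _ => ?_))).trans (le_of_eq ?_)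
    · rw [abs_mul, abs_mul]
      exact mul_le_mul (mul_le_mul_of_nonneg_right (H.abd _ _ _ _) (abs_nonneg _)) (hD.2 i j x) (abs_nonneg _) (by positivity)
    · simp
  have t2 : |∑ i, b i x r * pd i φ x| ≤ d * (Q * D) := by
    refine (Finset.abs_sum_le_sum_abs _ _).trans ((Finset.sum_le_sum (g := fun _ => Q * D) fun i _ => ?_).trans (le_of_eq ?_))
    · rw [abs_mul]
      exact mul_le_mul (H.bbd _ _ _) (hD.1 i x) (abs_nonneg _) hQ
    · simp
  rw [Lop]
  refine (abs_add_le _ _).trans ?_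
  rw [abs_mul r]
  have := mul_le_mul_of_nonneg_left t2 (abs_nonneg r)
  nlinarith

lemma Hyp.Lop_cont (H : Hyp a b γ Q) {φ : ℝ × EE d → ℝ} (h : ContDiff ℝ (⊤ : ℕ∞) φ) :
    Continuous fun p : ℝ × EE d × ℝ => Lop a b (slc φ p.1) p.2.1 p.2.2 := by
  have e : (fun p : ℝ × EE d × ℝ => Lop a b (slc φ p.1) p.2.1 p.2.2) = fun p =>
      (∑ i, ∑ j, a i j p.2.1 p.2.2 * p.2.2 * pdxx i j φ (p.1, p.2.1)) + p.2.2 * ∑ i, b i p.2.1 p.2.2 * pdx i φ (p.1, p.2.1) := by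
    ext p
    rw [Lop]
    simp only [slc_pd2 h, slc_pd h, slc]
  rw [e]
  have c1 : ∀ i j, Continuous (pdxx i j φ) := fun i j => (pdx_smooth (pdx_smooth h j) i).continuous
  have c2 : ∀ i, Continuous (pdx i φ) := fun i => (pdx_smooth h i).continuous
  have ca := H.a_cont
  have cb := H.b_cont
  have k1 : Continuous fun p : ℝ × EE d × ℝ => (p.1, p.2.1) := by fun_prop
  refine Continuous.add ?_ (Continuous.mul (by fun_prop) ?_)
  · refine continuous_finsetSum _ fun i _ => continuous_finsetSum _ fun j _ => ?_
    exact (((ca i j).comp continuous_snd).mul (by fun_prop)).mul ((c1 i j).comp k1)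
  · refine continuous_finsetSum _ fun i _ => ?_
    exact ((cb i).comp continuous_snd).mul ((c2 i).comp k1)

lemma Lop_zero {φ : EE d → ℝ} (h : ∀ x, φ x = 0) (x : EE d) (r : ℝ) : Lop a b φ x r = 0 := by
  have : φ = fun _ => 0 := funext h
  subst this
  have e : ∀ i : Fin d, pd i (fun _ : EE d => (0 : ℝ)) = fun _ => 0 := fun i => by ext x; simp [pd]
  simp [Lop, pd2, e]

lemma time_deriv {φ : ℝ × EE d → ℝ} (h : ContDiff ℝ (⊤ : ℕ∞) φ) (x : EE d) (t : ℝ) :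
    HasDerivAt (fun s => φ (s, x)) (pdt φ (t, x)) t := by
  have h1 : HasFDerivAt φ (fderiv ℝ φ (t, x)) (t, x) := (h.differentiable (by simp) _).hasFDerivAt
  have h2 : HasDerivAt (fun s : ℝ => ((s, x) : ℝ × EE d)) (1, 0) t := (hasDerivAt_id t).prodMk (hasDerivAt_const t x)
  exact h1.comp_hasDerivAt t h2

lemma time_lip {φ : ℝ × EE d → ℝ} (h : ContDiff ℝ (⊤ : ℕ∞) φ) {C : ℝ} (hC : ∀ p, |pdt φ p| ≤ C) (x : EE d) (s t : ℝ) :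
    |φ (s, x) - φ (t, x)| ≤ C * |s - t| := by
  have := convex_univ.norm_image_sub_le_of_norm_hasDerivWithin_le (f := fun s => φ (s, x)) (C := C)
    (fun t _ => (time_deriv h x t).hasDerivWithinAt) (fun t _ => hC (t, x)) (Set.mem_univ t) (Set.mem_univ s)
  exact this

lemma time_quot {φ : ℝ × EE d → ℝ} (h : ContDiff ℝ (⊤ : ℕ∞) φ) (x : EE d) (t : ℝ) {l : ℕ → ℝ}
    (h0 : ∀ k, 0 < l k) (hl : Tendsto l atTop (nhds 0)) :
    Tendsto (fun k => (l k)⁻¹ * (φ (t - l k, x) - φ (t, x))) atTop (nhds (-pdt φ (t, x))) := by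
  have h1 := (time_deriv h x t).tendsto_slope_zero
  have h2 : Tendsto (fun k => -l k) atTop (nhdsWithin 0 {0}ᶜ) := by
    rw [tendsto_nhdsWithin_iff]
    exact ⟨by simpa using hl.neg, Eventually.of_forall fun k => by simpa using (h0 k).ne'⟩
  refine ((h1.comp h2).neg).congr fun k => ?_
  simp only [Function.comp, smul_eq_mul, sub_eq_add_neg, inv_neg]
  ring

end Slices

section Final
variable {d : ℕ} {a : Fin d → Fin d → EE d → ℝ → ℝ} {b : Fin d → EE d → ℝ → ℝ} {γ Q : ℝ}

lemma Hyp.level_id (H : Hyp a b γ Q) {l : ℝ} (hl : 0 < l) {F : L1E d → L1E d}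
    (hF : ∀ (f : L1E d) (φ : EE d → ℝ), TF φ → (∫ x, F f x * φ x) - ∫ x, f x * φ x = l * ∫ x, Lop a b φ x (F f x))
    {φ : ℝ × EE d → ℝ} (h : ContDiff ℝ (⊤ : ℕ∞) φ) (hs : HasCompactSupport φ) {T : ℝ}
    (hsu : ∀ t x, (t ≤ 0 ∨ T < t) → φ (t, x) = 0) (u : L1E d) {M : ℝ}
    (hM : ∀ t, t ≤ T + l → ‖F^[⌊t / l⌋₊] u‖ ≤ M) :
    ∫ t : ℝ, ∫ x, ((F^[⌊t / l⌋₊] u : L1E d) x * (l⁻¹ * (φ (t - l, x) - φ (t, x)))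
      - Lop a b (slc φ (t - l)) x ((F^[⌊t / l⌋₊] u : L1E d) x)) = 0 := by
  have hQ := H.Qnn
  obtain ⟨C, hC, hC2⟩ := bdd_of h hs
  obtain ⟨D, hD, hD2⟩ := slc_db h hs
  set W : ℝ → L1E d := fun t => F^[⌊t / l⌋₊] u with hW
  have bP : ∀ t x r, |r * φ (t - l, x)| ≤ C * |r| := fun t x r => by
    rw [abs_mul, mul_comm]; exact mul_le_mul_of_nonneg_right (hC2 _) (abs_nonneg _)
  have bQ : ∀ t x r, |r * φ (t, x)| ≤ C * |r| := fun t x r => by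
    rw [abs_mul, mul_comm]; exact mul_le_mul_of_nonneg_right (hC2 _) (abs_nonneg _)
  have bR : ∀ t x r, |Lop a b (slc φ (t - l)) x r| ≤ ((d * d * Q + d * Q) * D) * |r| := fun t x r =>
    H.Lop_bd (hD2 _) x r
  have cφ := h.continuous
  have cP : Continuous fun p : ℝ × EE d × ℝ => p.2.2 * φ (p.1 - l, p.2.1) := by fun_prop
  have cQ : Continuous fun p : ℝ × EE d × ℝ => p.2.2 * φ (p.1, p.2.1) := by fun_prop
  have cR : Continuous fun p : ℝ × EE d × ℝ => Lop a b (slc φ (p.1 - l)) p.2.1 p.2.2 := by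
    have k : Continuous fun p : ℝ × EE d × ℝ => ((p.1 - l, p.2) : ℝ × EE d × ℝ) := by fun_prop
    exact (H.Lop_cont h).comp k
  have sh : ∀ t, (t < 0 ∨ T + l < t) → (t - l ≤ 0 ∨ T < t - l) := fun t ht => by
    rcases ht with ht | ht
    · left; linarith
    · right; linarith
  have sh2 : ∀ t, (t < 0 ∨ T + l < t) → (t ≤ 0 ∨ T < t) := fun t ht => by
    rcases ht with ht | ht
    · left; linarith
    · right; linarith
  have IP : Integrable fun t => ∫ x, W t x * φ (t - l, x) :=
    pair_time_int (f := fun t x r => r * φ (t - l, x)) cP hC bP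
      (fun t ht x r => by rw [hsu _ x (sh t ht), mul_zero]) F u l hM
  have IQ : Integrable fun t => ∫ x, W t x * φ (t, x) :=
    pair_time_int (f := fun t x r => r * φ (t, x)) cQ hC bQ
      (fun t ht x r => by rw [hsu _ x (sh2 t ht), mul_zero]) F u l hM
  have IR : Integrable fun t => ∫ x, Lop a b (slc φ (t - l)) x (W t x) :=
    pair_time_int (f := fun t x r => Lop a b (slc φ (t - l)) x r) cR (by positivity) bR
      (fun t ht x r => Lop_zero (fun y => hsu _ y (sh t ht)) x r) F u l hM
  have key : ∀ t, (∫ x, W (t + l) x * φ (t + l - l, x)) = (∫ x, W t x * φ (t, x)) + l * ∫ x, Lop a b (slc φ (t + l - l)) x (W (t + l) x) := by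
    intro t
    rw [add_sub_cancel_right]
    rcases le_or_gt t 0 with ht | ht
    · have z : ∀ x, φ (t, x) = 0 := fun x => hsu t x (Or.inl ht)
      have z2 : ∀ x r, Lop a b (slc φ t) x r = 0 := fun x r => Lop_zero z x r
      simp [z, z2]
    · have e : W (t + l) = F (W t) := by
        simp only [hW]
        rw [add_div, div_self hl.ne', Nat.floor_add_one (by positivity), Function.iterate_succ_apply']
      have := hF (W t) (slc φ t) (slc_tf h hs t)
      rw [e]
      simp only [slc] at this ⊢
      linarith
  have e1 : ∫ t, ∫ x, W t x * φ (t - l, x) = (∫ t, ∫ x, W t x * φ (t, x)) + l * ∫ t, ∫ x, Lop a b (slc φ (t - l)) x (W t x) := by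
    have s1 := integral_add_right_eq_self (μ := volume) (fun t => ∫ x, W t x * φ (t - l, x)) l
    have s2 := integral_add_right_eq_self (μ := volume) (fun t => ∫ x, Lop a b (slc φ (t - l)) x (W t x)) l
    have s3 := IR.comp_add_right l
    rw [← s1, ← s2, ← integral_const_mul, ← integral_add IQ (s3.const_mul l)]
    congr 1
    ext t
    exact key t
  have e2 : ∀ t, ∫ x, (W t x * (l⁻¹ * (φ (t - l, x) - φ (t, x))) - Lop a b (slc φ (t - l)) x (W t x))
      = l⁻¹ * ((∫ x, W t x * φ (t - l, x)) - ∫ x, W t x * φ (t, x)) - ∫ x, Lop a b (slc φ (t - l)) x (W t x) := by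
    intro t
    have i1 : Integrable fun x => W t x * φ (t - l, x) :=
      pair_int (f := fun x r => r * φ (t - l, x)) (by fun_prop) (bP t) (W t)
    have i2 : Integrable fun x => W t x * φ (t, x) :=
      pair_int (f := fun x r => r * φ (t, x)) (by fun_prop) (bQ t) (W t)
    have i3 : Integrable fun x => Lop a b (slc φ (t - l)) x (W t x) :=
      pair_int (f := fun x r => Lop a b (slc φ (t - l)) x r)
        (cR.comp (continuous_const.prodMk continuous_id)) (bR t) (W t)
    have i12 : Integrable fun x => l⁻¹ * (W t x * φ (t - l, x) - W t x * φ (t, x)) := (i1.sub i2).const_mul _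
    rw [← integral_sub i1 i2, ← integral_const_mul, ← integral_sub i12 i3]
    congr 1
    ext x
    ring
  have e3 : ∫ t : ℝ, ∫ x, (W t x * (l⁻¹ * (φ (t - l, x) - φ (t, x))) - Lop a b (slc φ (t - l)) x (W t x))
      = ∫ t : ℝ, (l⁻¹ * ((∫ x, W t x * φ (t - l, x)) - ∫ x, W t x * φ (t, x)) - ∫ x, Lop a b (slc φ (t - l)) x (W t x)) := by
    congr 1; ext t; exact e2 t
  have I12 : Integrable fun t => l⁻¹ * ((∫ x, W t x * φ (t - l, x)) - ∫ x, W t x * φ (t, x)) := (IP.sub IQ).const_mul _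
  rw [e3, integral_sub I12 IR, integral_const_mul, integral_sub IP IQ, e1, add_sub_cancel_left, ← mul_assoc,
    inv_mul_cancel₀ hl.ne', one_mul, sub_self]

lemma tend3 {F : ℝ → EE d → ℝ → ℝ} (hF : Continuous fun p : ℝ × EE d × ℝ => F p.1 p.2.1 p.2.2) (x : EE d) (t r : ℝ) {l : ℕ → ℝ}
    (s2 : Tendsto (fun p : ℕ × ℝ => l p.1) (atTop ×ˢ nhds r) (nhds 0)) :
    Tendsto (fun p : ℕ × ℝ => F (t - l p.1) x p.2) (atTop ×ˢ nhds r) (nhds (F t x r)) := by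
  have s1 : Tendsto (fun p : ℕ × ℝ => p.2) (atTop ×ˢ nhds r) (nhds r) := tendsto_snd
  have q : Tendsto (fun p : ℕ × ℝ => ((t - l p.1, x, p.2) : ℝ × EE d × ℝ)) (atTop ×ˢ nhds r) (nhds (t, x, r)) := by
    have q1 : Tendsto (fun p : ℕ × ℝ => t - l p.1) (atTop ×ˢ nhds r) (nhds t) := by
      simpa using s2.const_sub t
    exact q1.prodMk_nhds (tendsto_const_nhds.prodMk_nhds s1)
  exact (hF.tendsto (t, x, r)).comp q

lemma Hyp.G_tendsto (H : Hyp a b γ Q) {φ : ℝ × EE d → ℝ} (h : ContDiff ℝ (⊤ : ℕ∞) φ) (x : EE d) (t r : ℝ) {l : ℕ → ℝ}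
    (lpos : ∀ k, 0 < l k) (llim : Tendsto l atTop (nhds 0)) :
    Tendsto (fun p : ℕ × ℝ => p.2 * ((l p.1)⁻¹ * (φ (t - l p.1, x) - φ (t, x))) - Lop a b (slc φ (t - l p.1)) x p.2)
      (atTop ×ˢ nhds r) (nhds (-(r * pdt φ (t, x)) - Lop a b (slc φ t) x r)) := by
  have s1 : Tendsto (fun p : ℕ × ℝ => p.2) (atTop ×ˢ nhds r) (nhds r) := tendsto_snd
  have s2 : Tendsto (fun p : ℕ × ℝ => l p.1) (atTop ×ˢ nhds r) (nhds 0) := llim.comp tendsto_fst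
  have s3 : Tendsto (fun p : ℕ × ℝ => (l p.1)⁻¹ * (φ (t - l p.1, x) - φ (t, x))) (atTop ×ˢ nhds r) (nhds (-pdt φ (t, x))) :=
    (time_quot h x t lpos llim).comp tendsto_fst
  have s4 := tend3 (F := fun s x r => Lop a b (slc φ s) x r) (H.Lop_cont h) x t r s2
  have := (s1.mul s3).sub s4
  rwa [mul_neg] at this

set_option maxHeartbeats 1000000 in
theorem Hyp.solution (H : Hyp a b γ Q) {J : ℝ → L1E d → L1E d} {l0 : ℝ} (hJ : ResFam J l0)
    (hw : ∀ l, 0 < l → l ≤ l0 → ∀ (f : L1E d) (φ : EE d → ℝ), TF φ →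
      (∫ x, J l f x * φ x) - ∫ x, f x * φ x = l * ∫ x, Lop a b φ x (J l f x))
    {S : ℝ → L1E d → L1E d}
    (hS : ∀ t, 0 ≤ t → ∀ v, Tendsto (fun k : ℕ => (J (l0 / 2^k))^[⌊t / (l0 / 2^k)⌋₊] v) atTop (nhds (S t v)))
    (u : L1E d) : IsFPESol a b (fun t x => (S t u : L1E d) x) := by
  intro φ h hs hpos
  have hQ := H.Qnn
  have hp := hJ.pos
  obtain ⟨T, hT, hsu⟩ : ∃ T : ℝ, 0 ≤ T ∧ ∀ t x, (t ≤ 0 ∨ T < t) → φ (t, x) = 0 := by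
    obtain ⟨T, hT⟩ := hs.isBounded.exists_norm_le
    refine ⟨max T 0, le_max_right _ _, fun t x ht => ?_⟩
    by_contra h0
    have m : (t, x) ∈ tsupport φ := subset_tsupport _ h0
    rcases ht with ht | ht
    · have : 0 < t := hpos m
      linarith
    · have k1 := hT _ m
      have k2 : |t| ≤ ‖(t, x)‖ := norm_fst_le (t, x)
      have := le_abs_self t
      have := le_max_left T 0
      linarith
  obtain ⟨C, hC, hC2⟩ : ∃ C, 0 ≤ C ∧ ∀ p, |pdt φ p| ≤ C := by
    have c1 : Continuous (pdt φ) := (h.continuous_fderiv (by simp)).clm_apply continuous_const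
    have c2 : HasCompactSupport (pdt φ) := hs.fderiv_apply ℝ _
    obtain ⟨C, hC⟩ := c2.exists_bound_of_continuous c1
    exact ⟨C, (norm_nonneg _).trans (hC 0), hC⟩
  obtain ⟨D, hD, hD2⟩ := slc_db h hs
  obtain ⟨M, hM, hM2⟩ := hJ.bdd (T + l0) (by positivity) u
  obtain ⟨l, hl⟩ : ∃ l : ℕ → ℝ, l = fun k => l0 / 2 ^ k := ⟨_, rfl⟩
  have lpos : ∀ k, 0 < l k := fun k => by rw [hl]; positivity
  have lle : ∀ k, l k ≤ l0 := fun k => by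
    rw [hl]; exact div_le_self hp.le (one_le_pow₀ (by norm_num))
  have llim : Tendsto l atTop (nhds 0) := by
    rw [hl]
    have : Tendsto (fun k : ℕ => l0 * (1 / 2 : ℝ) ^ k) atTop (nhds (l0 * 0)) :=
      (tendsto_pow_atTop_nhds_zero_of_lt_one (by norm_num) (by norm_num)).const_mul l0
    rw [mul_zero] at this
    refine this.congr fun k => ?_
    rw [one_div, inv_pow, div_eq_mul_inv]
  have hS2 : ∀ t, 0 ≤ t → Tendsto (fun k : ℕ => (J (l k))^[⌊t / l k⌋₊] u) atTop (nhds (S t u)) := fun t ht => by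
    rw [hl]; exact hS t ht u
  clear hS
  set E := (d * d * Q + d * Q) * D with hE
  have hE0 : 0 ≤ E := by positivity
  -- the integrand at level k
  set G : ℕ → ℝ → EE d → ℝ → ℝ := fun k t x r =>
    r * ((l k)⁻¹ * (φ (t - l k, x) - φ (t, x))) - Lop a b (slc φ (t - l k)) x r with hG
  have cφ := h.continuous
  have cG : ∀ k, Continuous fun p : ℝ × EE d × ℝ => G k p.1 p.2.1 p.2.2 := by
    intro k
    have k1 : Continuous fun p : ℝ × EE d × ℝ => ((p.1 - l k, p.2) : ℝ × EE d × ℝ) := by fun_prop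
    have k2 := (H.Lop_cont h).comp k1
    have k3 : Continuous fun p : ℝ × EE d × ℝ => p.2.2 * ((l k)⁻¹ * (φ (p.1 - l k, p.2.1) - φ (p.1, p.2.1))) := by fun_prop
    exact k3.sub k2
  have bG : ∀ k t x r, |G k t x r| ≤ (C + E) * |r| := by
    intro k t x r
    have t1 : |(l k)⁻¹ * (φ (t - l k, x) - φ (t, x))| ≤ C := by
      have := time_lip h hC2 x (t - l k) t
      rw [sub_sub_cancel_left, abs_neg, abs_of_pos (lpos k)] at this
      rw [abs_mul, abs_of_pos (inv_pos.2 (lpos k)), inv_mul_le_iff₀ (lpos k)]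
      linarith
    have t2 := H.Lop_bd (hD2 (t - l k)) x r
    have t3 : |r * ((l k)⁻¹ * (φ (t - l k, x) - φ (t, x)))| ≤ |r| * C := by
      rw [abs_mul]; exact mul_le_mul_of_nonneg_left t1 (abs_nonneg _)
    refine (abs_sub _ _).trans ?_
    rw [← hE] at t2
    linarith
  have zG : ∀ k t, (t ≤ 0 ∨ T + l0 < t) → ∀ x r, G k t x r = 0 := by
    intro k t ht x r
    have z1 : t ≤ 0 ∨ T < t := ht.imp id fun h => by linarith
    have z2 : t - l k ≤ 0 ∨ T < t - l k := by
      have := lpos k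
      have := lle k
      exact ht.imp (fun h => by linarith) fun h => by linarith
    simp only [hG]
    rw [hsu _ x z1, hsu _ x z2, Lop_zero (φ := slc φ (t - l k)) (fun y => hsu _ y z2) x r]
    simp
  have I0 : ∀ k, ∫ t in Set.Ioi (0 : ℝ), ∫ x, G k t x (((J (l k))^[⌊t / l k⌋₊] u : L1E d) x) = 0 := by
    intro k
    rw [setIntegral_eq_integral_of_forall_compl_eq_zero]
    · exact H.level_id (lpos k) (hw (l k) (lpos k) (lle k)) h hs hsu u
        (fun t ht => hM2 (l k) (lpos k) (lle k) t (ht.trans (by linarith [lle k])))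
    · intro t ht
      have : t ≤ 0 := by simpa using ht
      simp [zG k t (Or.inl this)]
  have lim : Tendsto (fun k => ∫ t in Set.Ioi (0 : ℝ), ∫ x, G k t x (((J (l k))^[⌊t / l k⌋₊] u : L1E d) x)) atTop
      (nhds (∫ t in Set.Ioi (0 : ℝ), ∫ x, (-(S t u x * pdt φ (t, x)) - Lop a b (slc φ t) x (S t u x)))) := by
    have hI : Integrable (Set.indicator (Set.Icc 0 (T + l0)) (fun _ : ℝ => (C + E) * M)) (volume.restrict (Set.Ioi 0)) :=
      ((integrable_indicator_iff measurableSet_Icc).2 (integrableOn_const (by simp))).restrict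
    refine tendsto_integral_of_dominated_convergence _ (fun k => (pair_meas (cG k) (J (l k)) u (l k)).aestronglyMeasurable) hI
      (fun k => Eventually.of_forall fun t => ?_) ?_
    · by_cases ht : t ∈ Set.Icc 0 (T + l0)
      · rw [Set.indicator_of_mem ht]
        exact (pair_bd (bG k t) _).trans (mul_le_mul_of_nonneg_left (hM2 (l k) (lpos k) (lle k) t ht.2) (by positivity))
      · rw [Set.indicator_of_notMem ht]
        have : t ≤ 0 ∨ T + l0 < t := by
          by_contra h; push Not at h; exact ht ⟨h.1.le, h.2⟩
        simp [zG k t this]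
    · refine (ae_restrict_iff' measurableSet_Ioi).2 (Eventually.of_forall fun t ht => ?_)
      have ht0 : 0 < t := ht
      refine nemytskii (hS2 t ht0.le) (G := fun k x r => G k t x r)
        (g := fun x r => -(r * pdt φ (t, x)) - Lop a b (slc φ t) x r) (K := C + E) (by positivity) (fun k x r => bG k t x r) ?_ ?_
      · intro k
        have : Continuous fun p : EE d × ℝ => G k t p.1 p.2 := (cG k).comp (continuous_const.prodMk continuous_id)
        exact (pair_int this (bG k t) _).aestronglyMeasurable
      · intro x r
        exact H.G_tendsto h x t r lpos llim
  simp only [I0] at lim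
  have e := tendsto_nhds_unique lim tendsto_const_nhds
  have e2 : (∫ t in Set.Ioi (0 : ℝ), ∫ x, (-(S t u x * pdt φ (t, x)) - Lop a b (slc φ t) x (S t u x)))
      = - ∫ t in Set.Ioi (0 : ℝ), ∫ x, (S t u x * pdt φ (t, x)
      + ∑ i, ∑ j, a i j x (S t u x) * S t u x * pdxx i j φ (t, x)
      + S t u x * ∑ i, b i x (S t u x) * pdx i φ (t, x)) := by
    rw [← integral_neg]
    congr 1
    ext t
    rw [← integral_neg]
    congr 1
    ext x
    rw [Lop]
    simp only [slc_pd2 h, slc_pd h, slc]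
    ring
  rw [e2, neg_eq_zero] at e
  exact e

end Final

/-- under (H1)–(H3), the nonlinear Fokker–Planck equation generates a
continuous contraction semigroup on `L¹(ℝ^d)`. -/
theorem statement10 (d : ℕ) (a : Fin d → Fin d → (Fin d → ℝ) → ℝ → ℝ)
    (b : Fin d → (Fin d → ℝ) → ℝ → ℝ) (γ : ℝ)
    (hd : 1 ≤ d)
    (ha_smooth : ∀ i j, ContDiff ℝ 2 (fun p : (Fin d → ℝ) × ℝ => a i j p.1 p.2))
    (ha_bdd : ∀ i j, ∃ M : ℝ, ∀ (x : Fin d → ℝ) (r : ℝ), |a i j x r| ≤ M)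
    (hax_cont : ∀ i j,
      Continuous (fun p : (Fin d → ℝ) × ℝ => fderiv ℝ (fun y => a i j y p.2) p.1))
    (hax_bdd : ∀ i j, ∃ M : ℝ, ∀ (x : Fin d → ℝ) (r : ℝ),
      ‖fderiv ℝ (fun y => a i j y r) x‖ ≤ M)
    (ha_symm : ∀ i j x r, a i j x r = a j i x r)
    (hγ : 0 < γ)
    (hH2 : ∀ (x ξ : Fin d → ℝ) (r : ℝ),
      γ * ∑ i, ξ i ^ 2 ≤ ∑ i, ∑ j, (a i j x r + r * deriv (fun s => a i j x s) r) * ξ i * ξ j)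
    (hb_smooth : ∀ i, ContDiff ℝ 1 (fun p : (Fin d → ℝ) × ℝ => b i p.1 p.2))
    (hb_bdd : ∀ i, ∃ M : ℝ, ∀ (x : Fin d → ℝ) (r : ℝ), |b i x r| ≤ M)
    (hb_zero : ∀ i x, b i x 0 = 0)
 :
    ∃ S : ℝ → Lp ℝ 1 (volume : Measure (Fin d → ℝ)) → Lp ℝ 1 (volume : Measure (Fin d → ℝ)),
      (∀ v, S 0 v = v) ∧
      (∀ t s : ℝ, 0 ≤ t → 0 ≤ s → ∀ v, S (t + s) v = S t (S s v)) ∧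
      (∀ t : ℝ, 0 ≤ t → ∀ v w, ‖S t v - S t w‖ ≤ ‖v - w‖) ∧
      (∀ u₀, ContinuousOn (fun t => S t u₀) (Set.Ici (0 : ℝ))) ∧
      (∀ u₀, IsFPESol a b (fun t x => (S t u₀ : (Fin d → ℝ) → ℝ) x)) := by
  choose A hA using ha_bdd
  choose B hB using hax_bdd
  choose G hG using hb_bdd
  obtain ⟨Q, hQ, hQA, hQB, hQG⟩ : ∃ Q : ℝ, 0 ≤ Q ∧ (∀ i j, A i j ≤ Q) ∧ (∀ i j, B i j ≤ Q) ∧ ∀ i, G i ≤ Q := by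
    have nA : ∀ i j, 0 ≤ A i j := fun i j => (abs_nonneg _).trans (hA i j 0 0)
    have nB : ∀ i j, 0 ≤ B i j := fun i j => (norm_nonneg _).trans (hB i j 0 0)
    have nG : ∀ i, 0 ≤ G i := fun i => (abs_nonneg _).trans (hG i 0 0)
    have sA : 0 ≤ ∑ i, ∑ j, A i j := Finset.sum_nonneg fun i _ => Finset.sum_nonneg fun j _ => nA i j
    have sB : 0 ≤ ∑ i, ∑ j, B i j := Finset.sum_nonneg fun i _ => Finset.sum_nonneg fun j _ => nB i j
    have sG : 0 ≤ ∑ i, G i := Finset.sum_nonneg fun i _ => nG i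
    refine ⟨(∑ i, ∑ j, A i j) + (∑ i, ∑ j, B i j) + ∑ i, G i, by positivity, fun i j => ?_, fun i j => ?_, fun i => ?_⟩
    · have t1 : A i j ≤ ∑ j, A i j := Finset.single_le_sum (f := fun j => A i j) (fun j _ => nA i j) (Finset.mem_univ j)
      have t2 : ∑ j, A i j ≤ ∑ i, ∑ j, A i j := Finset.single_le_sum (f := fun i => ∑ j, A i j)
        (fun i _ => Finset.sum_nonneg fun j _ => nA i j) (Finset.mem_univ i)
      linarith
    · have t1 : B i j ≤ ∑ j, B i j := Finset.single_le_sum (f := fun j => B i j) (fun j _ => nB i j) (Finset.mem_univ j)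
      have t2 : ∑ j, B i j ≤ ∑ i, ∑ j, B i j := Finset.single_le_sum (f := fun i => ∑ j, B i j)
        (fun i _ => Finset.sum_nonneg fun j _ => nB i j) (Finset.mem_univ i)
      linarith
    · have t1 : G i ≤ ∑ i, G i := Finset.single_le_sum (fun i _ => nG i) (Finset.mem_univ i)
      linarith
  have H : Hyp a b γ Q := ⟨ha_smooth, fun i j x r => (hA i j x r).trans (hQA i j),
    fun i j x r => (hB i j x r).trans (hQB i j), ha_symm, hγ, hH2, hb_smooth,
    fun i x r => (hG i x r).trans (hQG i), hQ⟩
  obtain ⟨Φ, q, h, C, κ, hF⟩ := H.approx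
  obtain ⟨l0, J, hJ, hw⟩ := hF.limit
  obtain ⟨S, h1, h2, h3, h4, h5⟩ := crandall_liggett hJ
  exact ⟨S, h1, h2, h3, h4, fun u₀ => H.solution hJ hw h5 u₀⟩
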